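/- Let K be a number field and assume the Riemann hypothesis for ζ_K. Then there exists a constant C > 0 such that for every integer n ≥ 4 there exists a real number T_n with n ≤ T_n < n + 1 such that |ζ_K(σ + iT_n)| ≥ exp(−C log n / log log n) for all σ ∈ [−1, 2]. -/

import Mathlib

noncomputable section

open NumberField Filter Topology MeasureTheory Complex

open scoped Classical

/-- The Möbius function on integral ideals of a number field `K`. -/
def moebiusK (K : Type) [Field K] [NumberField K] (I : Ideal (𝓞 K)) : ℤ :=
  if Squarefree I then (-1) ^ (UniqueFactorizationMonoid.factors I).card else 0

/-- The Mertens function of a number field `K`: the sum of `μ_K(𝔞)` over nonzero integral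
ideals `𝔞` of norm at most `x`, where ideals of norm exactly `x` count with weight `1/2`. -/
def mertensK (K : Type) [Field K] [NumberField K] (x : ℝ) : ℝ :=
  ∑' I : Ideal (𝓞 K),
    if I ≠ ⊥ ∧ (Ideal.absNorm I : ℝ) < x then (moebiusK K I : ℝ)
    else if I ≠ ⊥ ∧ (Ideal.absNorm I : ℝ) = x then (moebiusK K I : ℝ) / 2
    else 0

/-- `M_K^- = liminf_{x → ∞} M_K(x) / x^{1/2}`, as an extended real number. -/
def MKminus (K : Type) [Field K] [NumberField K] : EReal :=
  Filter.liminf (fun x : ℝ => ((mertensK K x / Real.sqrt x : ℝ) : EReal)) Filter.atTop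

/-- `M_K^+ = limsup_{x → ∞} M_K(x) / x^{1/2}`, as an extended real number. -/
def MKplus (K : Type) [Field K] [NumberField K] : EReal :=
  Filter.limsup (fun x : ℝ => ((mertensK K x / Real.sqrt x : ℝ) : EReal)) Filter.atTop

/-- The naïve Mertens-type conjecture over `K`: `-1 ≤ M_K^- ≤ M_K^+ ≤ 1`. -/
def NaiveMertensConj (K : Type) [Field K] [NumberField K] : Prop :=
  -1 ≤ MKminus K ∧ MKminus K ≤ MKplus K ∧ MKplus K ≤ 1

/-- A predicate identifying the Dedekind zeta function of `K`: a function analytic away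
from `s = 1` agreeing with the Dirichlet series `∑ N(𝔞)^{-s}` on `Re s > 1`. -/
def IsDedekindZeta (K : Type) [Field K] [NumberField K] (Z : ℂ → ℂ) : Prop :=
  (∀ s : ℂ, s ≠ 1 → DifferentiableAt ℂ Z s) ∧
  ∀ s : ℂ, 1 < s.re →
    Z s = ∑' I : {I : Ideal (𝓞 K) // I ≠ ⊥}, (Ideal.absNorm I.1 : ℂ) ^ (-s)

/-- The Riemann hypothesis for a zeta function `Z`: all nontrivial zeros lie on `Re s = 1/2`. -/
def ZetaRH (Z : ℂ → ℂ) : Prop :=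
  ∀ ρ : ℂ, Z ρ = 0 → 0 < ρ.re → ρ.re < 1 → ρ.re = 1 / 2

namespace LargeStrip

/-! ### Poisson summation for Gaussians -/

section Poisson

variable {ι : Type*} [Fintype ι]

lemma summable_prod_fin {g : ℤ → ℝ} (hg : Summable g) (hg0 : ∀ k, 0 ≤ g k) (n : ℕ) :
    Summable fun m : Fin n → ℤ ↦ ∏ i, g (m i) := by
  induction n with
  | zero => exact Summable.of_finite
  | succ n ih =>
    rw [← (Fin.consEquiv (fun _ ↦ ℤ)).summable_iff]
    have := Summable.mul_of_nonneg hg ih (fun k ↦ hg0 k)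
      (fun m ↦ Finset.prod_nonneg fun i _ ↦ hg0 _)
    refine this.congr fun x ↦ ?_
    simp [Fin.prod_univ_succ, Fin.consEquiv]

lemma summable_prod_pi {g : ℤ → ℝ} (hg : Summable g) (hg0 : ∀ k, 0 ≤ g k) :
    Summable fun m : ι → ℤ ↦ ∏ i, g (m i) := by
  have e := Fintype.equivFin ι
  rw [← (e.symm.arrowCongr (Equiv.refl ℤ)).summable_iff]
  refine (summable_prod_fin hg hg0 (Fintype.card ι)).congr fun m ↦ ?_
  simp only [Function.comp]
  rw [← e.prod_comp]
  simp [Equiv.arrowCongr]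

lemma summable_int_exp_neg_sq {c : ℝ} (hc : 0 < c) :
    Summable fun k : ℤ ↦ Real.exp (-c * (k : ℝ) ^ 2) := by
  have h1 : Summable fun k : ℕ ↦ Real.exp (-c * (k : ℝ)) := by
    have := Real.summable_exp_nat_mul_iff (a := -c)
    simpa [mul_comm] using this.mpr (by linarith)
  have h2 : Summable fun k : ℕ ↦ Real.exp (-c * (k : ℝ) ^ 2) := by
    refine Summable.of_nonneg_of_le (fun _ ↦ (Real.exp_pos _).le) (fun k ↦ ?_) h1
    apply Real.exp_le_exp.mpr
    have : (k : ℝ) ≤ (k : ℝ) ^ 2 := by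
      rcases Nat.eq_zero_or_pos k with h | h
      · simp [h]
      · have : (1 : ℝ) ≤ k := by exact_mod_cast h
        nlinarith
    nlinarith
  refine Summable.of_nat_of_neg ?_ ?_
  · simpa using h2
  · simpa using h2

lemma summable_exp_neg_sum_sq {c : ℝ} (hc : 0 < c) :
    Summable fun m : ι → ℤ ↦ Real.exp (-c * ∑ i, (m i : ℝ) ^ 2) := by
  refine (summable_prod_pi (ι := ι) (summable_int_exp_neg_sq hc)
    (fun _ ↦ (Real.exp_pos _).le)).congr fun m ↦ ?_
  rw [← Real.exp_sum, Finset.mul_sum]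

lemma exists_sum_sq_mulVec_ge (A : Matrix ι ι ℝ) (hA : IsUnit A.det) :
    ∃ c > 0, ∀ x : ι → ℝ, c * ∑ i, x i ^ 2 ≤ ∑ i, (A.mulVec x i) ^ 2 := by
  set B := A⁻¹
  set K : ℝ := ∑ i, ∑ j, B i j ^ 2
  have hK : 0 ≤ K := Finset.sum_nonneg fun i _ ↦ Finset.sum_nonneg fun j _ ↦ sq_nonneg _
  refine ⟨(K + 1)⁻¹, by positivity, fun x ↦ ?_⟩
  rw [inv_mul_le_iff₀ (by positivity)]
  set y := A.mulVec x
  have hx : x = B.mulVec y := by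
    simp [y, B, Matrix.mulVec_mulVec, Matrix.nonsing_inv_mul A hA]
  have hy : 0 ≤ ∑ i, y i ^ 2 := Finset.sum_nonneg fun i _ ↦ sq_nonneg _
  calc ∑ i, x i ^ 2 = ∑ i, (∑ j, B i j * y j) ^ 2 := by
        conv_lhs => rw [hx]
        rfl
    _ ≤ ∑ i, (∑ j, B i j ^ 2) * ∑ j, y j ^ 2 :=
        Finset.sum_le_sum fun i _ ↦ Finset.sum_mul_sq_le_sq_mul_sq _ _ _
    _ = K * ∑ j, y j ^ 2 := by rw [Finset.sum_mul]
    _ ≤ (K + 1) * ∑ i, y i ^ 2 := by nlinarith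

/-- The Gaussian attached to a matrix. -/
def gaussMat (A : Matrix ι ι ℝ) (x : ι → ℝ) : ℝ := Real.exp (-Real.pi * ∑ i, (A.mulVec x i) ^ 2)

lemma gaussMat_pos (A : Matrix ι ι ℝ) (x : ι → ℝ) : 0 < gaussMat A x := Real.exp_pos _

lemma continuous_gaussMat (A : Matrix ι ι ℝ) : Continuous (gaussMat A) := by
  unfold gaussMat Matrix.mulVec dotProduct
  fun_prop

/-- Locally uniform majorant for the translates of a Gaussian. -/
lemma exists_gaussMat_add_le (A : Matrix ι ι ℝ) (hA : IsUnit A.det) :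
    ∃ c > 0, ∀ x y : ι → ℝ, gaussMat A (x + y) ≤
      Real.exp (2 * c * ∑ i, x i ^ 2) * Real.exp (-c * ∑ i, y i ^ 2) := by
  obtain ⟨c, hc, h⟩ := exists_sum_sq_mulVec_ge A hA
  refine ⟨Real.pi * c / 2, by positivity, fun x y ↦ ?_⟩
  rw [gaussMat, ← Real.exp_add]
  apply Real.exp_le_exp.mpr
  have h1 : ∑ i, y i ^ 2 ≤ 2 * ∑ i, (x + y) i ^ 2 + 2 * ∑ i, x i ^ 2 := by
    rw [Finset.mul_sum, Finset.mul_sum, ← Finset.sum_add_distrib]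
    refine Finset.sum_le_sum fun i _ ↦ ?_
    simp only [Pi.add_apply]
    nlinarith [sq_nonneg (2 * x i + y i)]
  have h2 := h (x + y)
  have := mul_le_mul_of_nonneg_left h2 Real.pi_pos.le
  have h3 := mul_le_mul_of_nonneg_left h1 (by positivity : 0 ≤ Real.pi * c / 2)
  linarith

lemma summable_gaussMat_add (A : Matrix ι ι ℝ) (hA : IsUnit A.det) (x : ι → ℝ) :
    Summable fun m : ι → ℤ ↦ gaussMat A (x + fun i ↦ (m i : ℝ)) := by
  obtain ⟨c, hc, h⟩ := exists_gaussMat_add_le A hA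
  exact Summable.of_nonneg_of_le (fun _ ↦ (gaussMat_pos _ _).le) (fun m ↦ h x _)
    ((summable_exp_neg_sum_sq hc).mul_left _)

lemma continuous_tsum_gaussMat (A : Matrix ι ι ℝ) (hA : IsUnit A.det) :
    Continuous fun x : ι → ℝ ↦ ∑' m : ι → ℤ, gaussMat A (x + fun i ↦ (m i : ℝ)) := by
  obtain ⟨c, hc, h⟩ := exists_gaussMat_add_le A hA
  rw [continuous_iff_continuousAt]
  intro x₀
  set R : ℝ := ∑ i, x₀ i ^ 2 + 1
  have hU : {x : ι → ℝ | ∑ i, x i ^ 2 < R} ∈ 𝓝 x₀ :=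
    (isOpen_lt (by fun_prop) continuous_const).mem_nhds (by simp [R])
  refine ContinuousOn.continuousAt ?_ hU
  refine continuousOn_tsum (u := fun m : ι → ℤ ↦
    Real.exp (2 * c * R) * Real.exp (-c * ∑ i, (m i : ℝ) ^ 2)) ?_ ?_ ?_
  · intro m
    exact ((continuous_gaussMat A).comp (by fun_prop)).continuousOn
  · exact (summable_exp_neg_sum_sq hc).mul_left _
  · intro m x hx
    rw [Real.norm_of_nonneg (gaussMat_pos _ _).le]
    refine (h x _).trans ?_
    gcongr
    exact hx.le

lemma integral_comp_mulVec (A : Matrix ι ι ℝ) (hA : IsUnit A.det) (g : (ι → ℝ) → ℂ) :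
    ∫ x, g (A.mulVec x) = (|A.det|⁻¹ : ℝ) * ∫ x, g x := by
  have h0 : A.det ≠ 0 := hA.ne_zero
  have hmap := Real.map_matrix_volume_pi_eq_smul_volume_pi h0
  let e : (ι → ℝ) ≃L[ℝ] (ι → ℝ) :=
    (Matrix.toLinearEquiv' A ((Matrix.invertibleOfIsUnitDet A hA))).toContinuousLinearEquiv
  have he : ∀ x, e x = A.mulVec x := fun x ↦ rfl
  have := e.toHomeomorph.measurableEmbedding.integral_map (μ := volume) g
  have h2 : Measure.map e.toHomeomorph volume = ENNReal.ofReal |A.det⁻¹| •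
      (volume : Measure (ι → ℝ)) := by
    rw [← hmap]; congr 1
  rw [h2, integral_smul_measure] at this
  rw [abs_inv, ENNReal.toReal_ofReal (by positivity)] at this
  simp only [ContinuousLinearEquiv.coe_toHomeomorph, he] at this
  rw [← this, Complex.real_smul]

lemma integral_gaussMat_mul_cexp (A : Matrix ι ι ℝ) (hA : IsUnit A.det) (n : ι → ℤ) :
    ∫ x : ι → ℝ, cexp (-(2 * Real.pi * Complex.I) * ∑ i, (n i : ℂ) * x i) * (gaussMat A x : ℂ)
      = (|A.det|⁻¹ : ℝ) * (gaussMat (A⁻¹).transpose (fun i ↦ (n i : ℝ)) : ℂ) := by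
  set v : ι → ℝ := (A⁻¹).transpose.mulVec (fun i ↦ (n i : ℝ)) with hv
  let g : (ι → ℝ) → ℂ := fun u ↦ cexp (-(Real.pi : ℂ) * ∑ i, (u i : ℂ) ^ 2 +
    ∑ i, (-(2 * Real.pi * Complex.I) * v i) * u i)
  have key : ∀ x : ι → ℝ, cexp (-(2 * Real.pi * Complex.I) * ∑ i, (n i : ℂ) * x i)
      * (gaussMat A x : ℂ) = g (A.mulVec x) := by
    intro x
    have h1 : ∑ i, (n i : ℝ) * x i = ∑ i, v i * A.mulVec x i := by
      change dotProduct (fun i ↦ (n i : ℝ)) x = dotProduct v (A.mulVec x)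
      rw [hv, Matrix.dotProduct_mulVec, ← Matrix.mulVec_transpose, Matrix.mulVec_mulVec,
        ← Matrix.transpose_mul, Matrix.nonsing_inv_mul A hA, Matrix.transpose_one,
        Matrix.one_mulVec]
    have h2 : ∑ i, (n i : ℂ) * x i = ∑ i, (v i : ℂ) * (A.mulVec x i : ℝ) := by
      exact_mod_cast congrArg (fun r : ℝ ↦ (r : ℂ)) h1
    simp only [gaussMat, g]
    rw [h2]
    push_cast
    rw [← Complex.exp_add]
    congr 1
    rw [Finset.mul_sum]
    simp_rw [mul_assoc]
    ring
  simp_rw [key]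
  rw [integral_comp_mulVec A hA,
    GaussianFourier.integral_cexp_neg_mul_sum_add (by simpa using Real.pi_pos)]
  have hpi : (Real.pi : ℂ) ≠ 0 := by exact_mod_cast Real.pi_ne_zero
  rw [div_self hpi, Complex.one_cpow, one_mul]
  congr 1
  simp only [gaussMat]
  push_cast
  congr 1
  simp only [mul_pow, ← hv]
  rw [← Finset.mul_sum]
  field_simp
  ring_nf
  rw [Complex.I_sq]
  ring

lemma integrable_gaussMat (A : Matrix ι ι ℝ) (hA : IsUnit A.det) : Integrable (gaussMat A) := by
  obtain ⟨c, hc, h⟩ := exists_sum_sq_mulVec_ge A hA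
  have h1 : Integrable fun x : ι → ℝ ↦ Real.exp (-(Real.pi * c) * ∑ i, x i ^ 2) := by
    have := (GaussianFourier.integrable_cexp_neg_mul_sum_add (ι := ι) (b := ((Real.pi * c : ℝ) : ℂ))
      (by simpa using mul_pos Real.pi_pos hc) (fun _ ↦ 0)).norm
    refine this.congr (ae_of_all _ fun x ↦ ?_)
    simp only [Complex.norm_exp]
    congr 1
    simp only [zero_mul, Finset.sum_const_zero, add_zero]
    rw [show (-(((Real.pi * c : ℝ)) : ℂ) * ∑ i, (x i : ℂ) ^ 2) =
      ((-(Real.pi * c) * ∑ i, x i ^ 2 : ℝ) : ℂ) by push_cast; ring, Complex.ofReal_re]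
  refine h1.mono' (continuous_gaussMat A).aestronglyMeasurable (ae_of_all _ fun x ↦ ?_)
  rw [Real.norm_of_nonneg (gaussMat_pos _ _).le, gaussMat]
  apply Real.exp_le_exp.mpr
  have := mul_le_mul_of_nonneg_left (h x) Real.pi_pos.le
  linarith

/-- The unit cube `∏ (m i, m i + 1]`. -/
def cubeAt (m : ι → ℤ) : Set (ι → ℝ) := {x | ∀ i, x i ∈ Set.Ioc (m i : ℝ) (m i + 1)}

lemma measurableSet_cubeAt (m : ι → ℤ) : MeasurableSet (cubeAt m) :=
  MeasurableSet.univ_pi' fun _ ↦ measurableSet_Ioc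

lemma iUnion_cubeAt {κ : Type*} : ⋃ m : κ → ℤ, cubeAt m = Set.univ := by
  refine Set.eq_univ_of_forall fun x ↦ Set.mem_iUnion.mpr ⟨fun i ↦ ⌈x i⌉ - 1, fun i ↦ ?_⟩
  push_cast
  exact ⟨by linarith [Int.ceil_lt_add_one (x i)], by linarith [Int.le_ceil (x i)]⟩

lemma pairwise_disjoint_cubeAt {κ : Type*} :
    Pairwise (Function.onFun Disjoint (cubeAt (ι := κ))) := by
  intro m m' hmm
  rw [Function.onFun, Set.disjoint_left]
  intro x hx hx'
  refine hmm (funext fun i ↦ ?_)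
  have h1 := hx i
  have h2 := hx' i
  have a : (m i : ℝ) < m' i + 1 := h1.1.trans_le h2.2
  have b : (m' i : ℝ) < m i + 1 := h2.1.trans_le h1.2
  norm_cast at a b
  omega

lemma setIntegral_cubeAt {E : Type*} [NormedAddCommGroup E] [NormedSpace ℝ E]
    (g : (ι → ℝ) → E) (m : ι → ℤ) :
    ∫ x in cubeAt m, g x = ∫ x in cubeAt (0 : ι → ℤ), g (x + fun i ↦ (m i : ℝ)) := by
  rw [← (measurePreserving_add_right volume (fun i ↦ (m i : ℝ))).setIntegral_preimage_emb
    (measurableEmbedding_addRight _) g (cubeAt m)]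
  congr 2
  ext x
  simp only [cubeAt, Set.mem_preimage, Set.mem_ofPred_eq, Pi.add_apply, Set.mem_Ioc, Pi.zero_apply,
    Int.cast_zero, zero_add]
  refine forall_congr' fun i ↦ ?_
  constructor <;> rintro ⟨h1, h2⟩ <;> constructor <;> linarith

lemma integral_eq_setIntegral_tsum (g : (ι → ℝ) → ℂ) (hg : Integrable g) :
    ∫ x, g x = ∫ x in cubeAt (0 : ι → ℤ), ∑' m : ι → ℤ, g (x + fun i ↦ (m i : ℝ)) := by
  have h1 : HasSum (fun m : ι → ℤ ↦ ∫ x in cubeAt m, g x) (∫ x, g x) := by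
    have := hasSum_integral_iUnion (μ := volume) (f := g) (fun m : ι → ℤ ↦ measurableSet_cubeAt m)
      pairwise_disjoint_cubeAt (by rw [iUnion_cubeAt]; exact hg.integrableOn)
    rwa [iUnion_cubeAt, setIntegral_univ] at this
  have h2 : HasSum (fun m : ι → ℤ ↦ ∫ x in cubeAt m, ‖g x‖) (∫ x, ‖g x‖) := by
    have := hasSum_integral_iUnion (μ := volume) (f := fun x ↦ ‖g x‖)
      (fun m : ι → ℤ ↦ measurableSet_cubeAt m)
      pairwise_disjoint_cubeAt (by rw [iUnion_cubeAt]; exact hg.norm.integrableOn)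
    rwa [iUnion_cubeAt, setIntegral_univ] at this
  rw [← h1.tsum_eq]
  simp_rw [setIntegral_cubeAt g]
  refine integral_tsum_of_summable_integral_norm ?_ ?_
  · intro m
    exact (hg.comp_add_right _).integrableOn
  · exact h2.summable.congr fun m ↦ setIntegral_cubeAt (fun x ↦ ‖g x‖) m

lemma exists_continuousMap_of_periodic {κ : Type*} (P : (κ → ℝ) → ℂ) (hP : Continuous P)
    (hper : ∀ x, ∀ m : κ → ℤ, P (x + fun i ↦ (m i : ℝ)) = P x) :
    ∃ f : C(UnitAddTorus κ, ℂ), ∀ x : κ → ℝ, f (fun i ↦ (x i : UnitAddCircle)) = P x := by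
  let q : (κ → ℝ) → UnitAddTorus κ := fun x i ↦ (x i : UnitAddCircle)
  have hq : IsOpenQuotientMap q :=
    IsOpenQuotientMap.piMap fun _ ↦ QuotientAddGroup.isOpenQuotientMap_mk
  let F : UnitAddTorus κ → ℂ := fun y ↦ P (Function.surjInv hq.surjective y)
  have hF : ∀ x, F (q x) = P x := by
    intro x
    have h1 : q (Function.surjInv hq.surjective (q x)) = q x := Function.surjInv_eq hq.surjective _
    have h2 : ∀ i, ∃ k : ℤ, Function.surjInv hq.surjective (q x) i = x i + k := by
      intro i
      have h3 := congrFun h1 i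
      simp only [q] at h3
      rw [← sub_eq_zero, ← AddCircle.coe_sub, AddCircle.coe_eq_zero_iff] at h3
      obtain ⟨k, hk⟩ := h3
      exact ⟨k, by rw [zsmul_one] at hk; linarith⟩
    choose m hm using h2
    have h4 : Function.surjInv hq.surjective (q x) = x + fun i ↦ (m i : ℝ) := funext hm
    simp only [F]
    rw [h4, hper]
  refine ⟨⟨F, hq.isQuotientMap.continuous_iff.mpr ?_⟩, hF⟩
  exact hP.congr fun x ↦ (hF x).symm

/-- Poisson summation for Gaussians on `ℤ^ι`. -/
theorem tsum_gaussMat (A : Matrix ι ι ℝ) (hA : IsUnit A.det) :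
    ∑' m : ι → ℤ, gaussMat A (fun i ↦ (m i : ℝ)) =
      |A.det|⁻¹ * ∑' m : ι → ℤ, gaussMat (A⁻¹).transpose (fun i ↦ (m i : ℝ)) := by
  have hA' : IsUnit (A⁻¹).transpose.det := by
    rw [Matrix.det_transpose]; exact Matrix.isUnit_nonsing_inv_det A hA
  let P : (ι → ℝ) → ℂ := fun x ↦ ((∑' m : ι → ℤ, gaussMat A (x + fun i ↦ (m i : ℝ)) : ℝ) : ℂ)
  obtain ⟨f, hf⟩ := exists_continuousMap_of_periodic P
    (Complex.continuous_ofReal.comp (continuous_tsum_gaussMat A hA)) (by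
      intro x m
      simp only [P]
      congr 1
      rw [← (Equiv.addLeft m).tsum_eq (fun m : ι → ℤ ↦ gaussMat A (x + fun i ↦ (m i : ℝ)))]
      refine tsum_congr fun k ↦ ?_
      congr 1
      ext i
      simp [add_assoc])
  have hcoef : ∀ n, UnitAddTorus.mFourierCoeff f n =
      (|A.det|⁻¹ : ℝ) * (gaussMat (A⁻¹).transpose (fun i ↦ (n i : ℝ)) : ℂ) := by
    intro n
    rw [UnitAddTorus.mFourierCoeff_eq_integral f n 0, ← integral_gaussMat_mul_cexp A hA n,
      integral_eq_setIntegral_tsum]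
    · have : cubeAt (0 : ι → ℤ) =
          {x : ι → ℝ | ∀ i, x i ∈ Set.Ioc ((0 : ι → ℝ) i) ((0 : ι → ℝ) i + 1)} := by
        simp [cubeAt]
      rw [← this]
      refine setIntegral_congr_fun (measurableSet_cubeAt _) fun x _ ↦ ?_
      have hm : UnitAddTorus.mFourier (-n) (fun i ↦ (x i : UnitAddCircle)) =
          cexp (-(2 * Real.pi * Complex.I) * ∑ i, (n i : ℂ) * x i) := by
        simp only [UnitAddTorus.mFourier, ContinuousMap.coe_mk, fourier_coe_apply]
        rw [← Complex.exp_sum, Finset.mul_sum]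
        congr 1
        refine Finset.sum_congr rfl fun i _ ↦ ?_
        simp
        ring
      simp only [smul_eq_mul]
      simp only [hm, hf, P]
      rw [Complex.ofReal_tsum, ← tsum_mul_left]
      refine tsum_congr fun m ↦ ?_
      congr 1
      rw [Complex.exp_eq_exp_iff_exists_int]
      refine ⟨∑ i, n i * m i, ?_⟩
      simp only [Pi.add_apply]
      push_cast
      simp only [mul_add, Finset.sum_add_distrib]
      ring
    · refine (integrable_gaussMat A hA).ofReal.bdd_mul (c := 1) ?_ (ae_of_all _ fun x ↦ ?_)
      · exact Continuous.aestronglyMeasurable (by fun_prop)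
      · rw [show (-(2 * Real.pi * Complex.I) * ∑ i, (n i : ℂ) * x i) =
          ((-(2 * Real.pi) * ∑ i, (n i : ℝ) * x i : ℝ) : ℂ) * Complex.I by push_cast; ring,
          Complex.norm_exp_ofReal_mul_I]
  have hsum : Summable (UnitAddTorus.mFourierCoeff f) := by
    rw [show UnitAddTorus.mFourierCoeff f = _ from funext hcoef]
    have := summable_gaussMat_add _ hA' 0
    simp only [zero_add] at this
    exact (Complex.ofRealCLM.summable this).mul_left _
  have h0 := (UnitAddTorus.hasSum_mFourier_series_apply_of_summable hsum 0).tsum_eq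
  have h1 : f 0 = P 0 := by rw [← hf 0]; congr 1
  rw [h1] at h0
  simp only [hcoef, P, zero_add] at h0
  rw [← Complex.ofReal_inj, ← h0]
  push_cast
  rw [← tsum_mul_left]
  refine tsum_congr fun n ↦ ?_
  have : UnitAddTorus.mFourier n (0 : UnitAddTorus ι) = 1 := by
    simp [UnitAddTorus.mFourier]
  rw [this]
  simp

end Poisson

end LargeStrip

namespace LargeStrip

open scoped nonZeroDivisors

/-! ### Theta series of lattices in a number field -/

section Gram

variable {ι : Type*} [Fintype ι]

open Matrix in
/-- Poisson summation for the theta series of a positive definite real quadratic form. -/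
theorem tsum_exp_gram (G : Matrix ι ι ℝ) (hG : G.PosDef) :
    ∑' m : ι → ℤ, Real.exp (-Real.pi * ((fun i ↦ (m i : ℝ)) ⬝ᵥ G *ᵥ (fun i ↦ (m i : ℝ)))) =
      (Real.sqrt G.det)⁻¹ *
      ∑' m : ι → ℤ, Real.exp (-Real.pi * ((fun i ↦ (m i : ℝ)) ⬝ᵥ G⁻¹ *ᵥ (fun i ↦ (m i : ℝ)))) := by
  obtain ⟨A, rfl⟩ : ∃ A : Matrix ι ι ℝ, G = Aᵀ * A := by
    open MatrixOrder in
    obtain ⟨A, hA⟩ := CStarAlgebra.nonneg_iff_eq_star_mul_self.mp hG.posSemidef.nonneg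
    exact ⟨A, by simpa [star_eq_conjTranspose] using hA⟩
  have hdet : (Aᵀ * A).det = A.det ^ 2 := by rw [det_mul, det_transpose, sq]
  have hA : IsUnit A.det := by
    have := hG.det_pos
    rw [hdet] at this
    exact isUnit_iff_ne_zero.mpr fun h ↦ by simp [h] at this
  have key : ∀ (B : Matrix ι ι ℝ) (x : ι → ℝ), x ⬝ᵥ (Bᵀ * B) *ᵥ x = ∑ i, (B *ᵥ x) i ^ 2 := by
    intro B x
    rw [← mulVec_mulVec, dotProduct_mulVec, vecMul_transpose]
    simp [dotProduct, sq]
  have hinv : (Aᵀ * A)⁻¹ = (A⁻¹)ᵀᵀ * (A⁻¹)ᵀ := by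
    rw [Matrix.mul_inv_rev, transpose_transpose, transpose_nonsing_inv]
  rw [hinv, hdet, Real.sqrt_sq_eq_abs]
  simp_rw [key]
  exact tsum_gaussMat A hA

end Gram

section Theta

variable (K : Type*) [Field K] [NumberField K]

/-- The infinite place below a complex embedding. -/
def plc {K : Type*} [Field K] [NumberField K] (φ : K →ₐ[ℚ] ℂ) : InfinitePlace K :=
  InfinitePlace.mk φ.toRingHom

variable {K}

lemma filter_plc_card (w : InfinitePlace K) :
    (Finset.univ.filter fun φ : K →ₐ[ℚ] ℂ ↦ plc φ = w).card = w.mult := by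
  rw [← InfinitePlace.card_filter_mk_eq w]
  refine Finset.card_equiv (RingHom.equivRatAlgHom K ℂ).symm fun φ ↦ ?_
  rw [Finset.mem_filter_univ, Finset.mem_filter_univ]
  rfl

lemma sum_plc (f : InfinitePlace K → ℝ) :
    ∑ φ : K →ₐ[ℚ] ℂ, f (plc φ) = ∑ w, (w.mult : ℝ) * f w := by
  rw [← Finset.sum_fiberwise_of_maps_to (t := Finset.univ) (g := plc)
    (fun _ _ ↦ Finset.mem_univ _)]
  refine Finset.sum_congr rfl fun w _ ↦ ?_
  rw [Finset.sum_congr rfl (g := fun _ ↦ f w) (fun φ hφ ↦ by rw [(Finset.mem_filter.mp hφ).2]),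
    Finset.sum_const, filter_plc_card, nsmul_eq_mul]

lemma prod_plc (f : InfinitePlace K → ℝ) :
    ∏ φ : K →ₐ[ℚ] ℂ, f (plc φ) = ∏ w, f w ^ w.mult := by
  rw [← Finset.prod_fiberwise_of_maps_to (t := Finset.univ) (g := plc)
    (fun _ _ ↦ Finset.mem_univ _)]
  refine Finset.prod_congr rfl fun w _ ↦ ?_
  rw [Finset.prod_congr rfl (g := fun _ ↦ f w) (fun φ hφ ↦ by rw [(Finset.mem_filter.mp hφ).2]),
    Finset.prod_const, filter_plc_card]

/-- The quadratic form `∑ m_w y_w |a|_w²`. -/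
def qform (y : InfinitePlace K → ℝ) (a : K) : ℝ := ∑ w, (w.mult : ℝ) * (y w * w a ^ 2)

lemma qform_eq (y : InfinitePlace K → ℝ) (a : K) :
    qform y a = ∑ φ : K →ₐ[ℚ] ℂ, y (plc φ) * ‖φ a‖ ^ 2 := by
  rw [qform, ← sum_plc]
  rfl

/-- Complex conjugation on embeddings. -/
def conjEmb (φ : K →ₐ[ℚ] ℂ) : K →ₐ[ℚ] ℂ :=
  ((Complex.conjAe.restrictScalars ℚ : ℂ ≃ₐ[ℚ] ℂ) : ℂ →ₐ[ℚ] ℂ).comp φ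

lemma conjEmb_apply (φ : K →ₐ[ℚ] ℂ) (a : K) : conjEmb φ a = starRingEnd ℂ (φ a) := rfl

lemma conjEmb_involutive : Function.Involutive (conjEmb (K := K)) := fun φ ↦ by
  ext a
  simp [conjEmb_apply]

lemma plc_conjEmb (φ : K →ₐ[ℚ] ℂ) : plc (conjEmb φ) = plc φ :=
  InfinitePlace.mk_conjugate_eq φ.toRingHom

/-- The matrix of conjugates of a basis. -/
def conjMat (b : (K →ₐ[ℚ] ℂ) → K) : Matrix (K →ₐ[ℚ] ℂ) (K →ₐ[ℚ] ℂ) ℂ := Matrix.of fun φ i ↦ φ (b i)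

/-- The Gram matrix of a basis with respect to `qform y`. -/
def gramMat (y : InfinitePlace K → ℝ) (b : (K →ₐ[ℚ] ℂ) → K) :
    Matrix (K →ₐ[ℚ] ℂ) (K →ₐ[ℚ] ℂ) ℝ :=
  Matrix.of fun i j ↦ (∑ φ : K →ₐ[ℚ] ℂ, y (plc φ) * (starRingEnd ℂ (φ (b i)) * φ (b j))).re

lemma coe_gramMat_apply (y : InfinitePlace K → ℝ) (b : (K →ₐ[ℚ] ℂ) → K) (i j : K →ₐ[ℚ] ℂ) :
    (gramMat y b i j : ℂ) = ∑ φ : K →ₐ[ℚ] ℂ, y (plc φ) * (starRingEnd ℂ (φ (b i)) * φ (b j)) := by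
  rw [gramMat, Matrix.of_apply]
  apply Complex.conj_eq_iff_re.mp
  rw [map_sum]
  refine Fintype.sum_equiv (conjEmb_involutive.toPerm) _ _ fun φ ↦ ?_
  simp [conjEmb_apply, plc_conjEmb]

open Matrix in
lemma coe_gramMat (y : InfinitePlace K → ℝ) (b : (K →ₐ[ℚ] ℂ) → K) :
    (gramMat y b).map ((↑) : ℝ → ℂ) =
      (conjMat b)ᴴ * (diagonal fun φ ↦ (y (plc φ) : ℂ)) * conjMat b := by
  ext i j
  rw [map_apply, coe_gramMat_apply, mul_apply]
  refine Finset.sum_congr rfl fun φ _ ↦ ?_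
  rw [mul_diagonal, conjTranspose_apply]
  simp only [conjMat, of_apply, RCLike.star_def]
  ring

open Matrix in
lemma dotProduct_gramMat (y : InfinitePlace K → ℝ) (b : (K →ₐ[ℚ] ℂ) → K) (x : (K →ₐ[ℚ] ℂ) → ℝ) :
    x ⬝ᵥ gramMat y b *ᵥ x =
      ∑ φ : K →ₐ[ℚ] ℂ, y (plc φ) * ‖(conjMat b *ᵥ fun i ↦ (x i : ℂ)) φ‖ ^ 2 := by
  rw [← Complex.ofReal_inj]
  have h1 : ((x ⬝ᵥ gramMat y b *ᵥ x : ℝ) : ℂ) =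
      (fun i ↦ (x i : ℂ)) ⬝ᵥ (gramMat y b).map ((↑) : ℝ → ℂ) *ᵥ (fun i ↦ (x i : ℂ)) := by
    simp [dotProduct, mulVec]
  have h2 : (fun i ↦ (x i : ℂ)) = star (fun i ↦ (x i : ℂ)) := by
    ext i; simp
  rw [h1, coe_gramMat, ← mulVec_mulVec, ← mulVec_mulVec, dotProduct_mulVec, h2,
    vecMul_conjTranspose, star_star, ← h2]
  simp only [dotProduct, mulVec_diagonal, Pi.star_apply]
  push_cast
  refine Finset.sum_congr rfl fun φ _ ↦ ?_
  rw [← Complex.conj_mul', RCLike.star_def]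
  ring

open Matrix in
lemma normSq_det_conjMat (b : (K →ₐ[ℚ] ℂ) → K) :
    ‖(conjMat b).det‖ ^ 2 = |(Algebra.discr ℚ b : ℝ)| := by
  have h := Algebra.discr_eq_det_embeddingsMatrixReindex_pow_two ℚ ℂ b (Equiv.refl _)
  have h2 : Algebra.embeddingsMatrixReindex ℚ ℂ b (Equiv.refl _) = (conjMat b)ᵀ := by
    ext i φ; rfl
  rw [h2, det_transpose] at h
  rw [← norm_pow, ← h]
  simp only [eq_ratCast]
  rw [← Complex.ofReal_ratCast, Complex.norm_real, Real.norm_eq_abs]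

open Matrix in
lemma isUnit_det_conjMat (b : Module.Basis (K →ₐ[ℚ] ℂ) ℚ K) : IsUnit (conjMat b).det := by
  rw [isUnit_iff_ne_zero, ← norm_ne_zero_iff, ← pow_ne_zero_iff two_ne_zero, normSq_det_conjMat]
  simpa using Algebra.discr_not_zero_of_basis ℚ b

open Matrix in
lemma posDef_gramMat {y : InfinitePlace K → ℝ} (hy : ∀ w, 0 < y w)
    (b : Module.Basis (K →ₐ[ℚ] ℂ) ℚ K) : (gramMat y b).PosDef := by
  refine PosDef.of_dotProduct_mulVec_pos ?_ fun x hx ↦ ?_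
  · ext i j
    rw [conjTranspose_apply, star_trivial, ← Complex.ofReal_inj, coe_gramMat_apply,
      ← Complex.conj_ofReal, coe_gramMat_apply, map_sum]
    refine Finset.sum_congr rfl fun φ _ ↦ ?_
    simp [mul_comm]
  · rw [star_trivial, dotProduct_gramMat]
    have hne : conjMat b *ᵥ (fun i ↦ (x i : ℂ)) ≠ 0 := by
      intro h
      apply hx
      have := congrArg (fun v ↦ (conjMat b)⁻¹ *ᵥ v) h
      simp only [mulVec_mulVec, nonsing_inv_mul _ (isUnit_det_conjMat b), one_mulVec,
        mulVec_zero] at this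
      ext i
      simpa using congrFun this i
    obtain ⟨φ, hφ⟩ := Function.ne_iff.mp hne
    refine Finset.sum_pos' (fun ψ _ ↦ by have := hy (plc ψ); positivity) ⟨φ, Finset.mem_univ _, ?_⟩
    have := hy (plc φ)
    have h2 : 0 < ‖(conjMat b *ᵥ fun i ↦ (x i : ℂ)) φ‖ := norm_pos_iff.mpr hφ
    positivity

open Matrix in
lemma det_gramMat (y : InfinitePlace K → ℝ) (b : (K →ₐ[ℚ] ℂ) → K) :
    (gramMat y b).det = |(Algebra.discr ℚ b : ℝ)| * ∏ w, y w ^ w.mult := by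
  rw [← normSq_det_conjMat, ← prod_plc, ← Complex.ofReal_inj]
  have : ((gramMat y b).det : ℂ) = ((gramMat y b).map ((↑) : ℝ → ℂ)).det :=
    RingHom.map_det Complex.ofRealHom _
  rw [this, coe_gramMat, det_mul, det_mul, det_conjTranspose, det_diagonal]
  push_cast
  rw [← Complex.conj_mul', RCLike.star_def]
  ring

open Matrix in
lemma inv_gramMat {y : InfinitePlace K → ℝ} (hy : ∀ w, 0 < y w)
    (b : Module.Basis (K →ₐ[ℚ] ℂ) ℚ K) :
    (gramMat y b)⁻¹ = gramMat (fun w ↦ (y w)⁻¹) b.traceDual := by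
  refine inv_eq_left_inv ?_
  have hNM : (conjMat b.traceDual)ᵀ * conjMat b = 1 := by
    ext i j
    rw [mul_apply, one_apply]
    simp only [conjMat, transpose_apply, of_apply, ← map_mul]
    rw [← trace_eq_sum_embeddings (K := ℚ) ℂ, Module.Basis.trace_traceDual_mul]
    simp [eq_comm]
  have hMN : (conjMat b.traceDual) * (conjMat b)ᵀ = 1 := by
    have := mul_eq_one_comm.mp hNM
    have := congrArg transpose this
    simpa using this
  have hMN' : (conjMat b.traceDual).map (starRingEnd ℂ) * (conjMat b)ᴴ = 1 := by
    have := congrArg (fun A : Matrix (K →ₐ[ℚ] ℂ) (K →ₐ[ℚ] ℂ) ℂ ↦ A.map (starRingEnd ℂ)) hMN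
    simp only [Matrix.map_mul] at this
    rw [Matrix.map_one _ (map_zero _) (map_one _)] at this
    rw [← this]
    rfl
  have hreal : (gramMat (fun w ↦ (y w)⁻¹) b.traceDual).map ((↑) : ℝ → ℂ) =
      (conjMat b.traceDual)ᵀ * (diagonal fun φ ↦ ((y (plc φ))⁻¹ : ℂ)) *
        (conjMat b.traceDual).map (starRingEnd ℂ) := by
    have h := congrArg (fun A : Matrix (K →ₐ[ℚ] ℂ) (K →ₐ[ℚ] ℂ) ℂ ↦ A.map (starRingEnd ℂ))
      (coe_gramMat (fun w ↦ (y w)⁻¹) b.traceDual)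
    simp only [Matrix.map_mul] at h
    have h1 : ((gramMat (fun w ↦ (y w)⁻¹) b.traceDual).map ((↑) : ℝ → ℂ)).map (starRingEnd ℂ) =
        (gramMat (fun w ↦ (y w)⁻¹) b.traceDual).map ((↑) : ℝ → ℂ) := by
      ext i j; simp
    rw [h1] at h
    rw [h]
    congr 2
    · ext i j; simp
    · ext i j; by_cases hij : i = j <;> simp [hij]
  have hinj : Function.Injective fun A : Matrix (K →ₐ[ℚ] ℂ) (K →ₐ[ℚ] ℂ) ℝ ↦ A.map ((↑) : ℝ → ℂ) :=
    Matrix.map_injective Complex.ofReal_injective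
  apply hinj
  simp only
  rw [show ∀ A B : Matrix (K →ₐ[ℚ] ℂ) (K →ₐ[ℚ] ℂ) ℝ, (A * B).map ((↑) : ℝ → ℂ) =
    A.map ((↑) : ℝ → ℂ) * B.map ((↑) : ℝ → ℂ) from fun A B ↦
      Matrix.map_mul (f := Complex.ofRealHom), hreal, coe_gramMat]
  simp only [Matrix.mul_assoc]
  rw [← Matrix.mul_assoc _ (conjMat b)ᴴ, hMN', Matrix.one_mul,
    ← Matrix.mul_assoc (diagonal _) (diagonal _), diagonal_mul_diagonal]
  have : (fun φ : K →ₐ[ℚ] ℂ ↦ ((y (plc φ))⁻¹ : ℂ) * (y (plc φ) : ℂ)) = 1 := by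
    ext φ
    have := (hy (plc φ)).ne'
    simp [this]
  rw [this]
  simp only [Pi.one_def, diagonal_one, Matrix.one_mul, hNM]
  rw [Matrix.map_one _ rfl rfl]

open Matrix in
lemma tsum_span_exp_qform (y : InfinitePlace K → ℝ) (b : Module.Basis (K →ₐ[ℚ] ℂ) ℚ K) :
    ∑' a : Submodule.span ℤ (Set.range b), Real.exp (-Real.pi * qform y a) =
      ∑' m : (K →ₐ[ℚ] ℂ) → ℤ, Real.exp (-Real.pi *
        ((fun i ↦ (m i : ℝ)) ⬝ᵥ gramMat y b *ᵥ (fun i ↦ (m i : ℝ)))) := by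
  rw [← (b.restrictScalars ℤ).equivFun.symm.toEquiv.tsum_eq]
  refine tsum_congr fun m ↦ ?_
  rw [dotProduct_gramMat, qform_eq]
  congr 3
  ext φ
  congr 3
  simp only [LinearEquiv.coe_toEquiv, Module.Basis.equivFun_symm_apply,
    AddSubmonoidClass.coe_finsetSum, SetLike.val_smul, map_sum, mulVec, dotProduct, conjMat,
    of_apply]
  refine Finset.sum_congr rfl fun i _ ↦ ?_
  simp [mul_comm]

theorem tsum_span_exp_qform_eq {y : InfinitePlace K → ℝ} (hy : ∀ w, 0 < y w)
    (b : Module.Basis (K →ₐ[ℚ] ℂ) ℚ K) :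
    ∑' a : Submodule.span ℤ (Set.range b), Real.exp (-Real.pi * qform y a) =
      (Real.sqrt (|(Algebra.discr ℚ b : ℝ)| * ∏ w, y w ^ w.mult))⁻¹ *
      ∑' a : Submodule.span ℤ (Set.range b.traceDual),
        Real.exp (-Real.pi * qform (fun w ↦ (y w)⁻¹) a) := by
  rw [tsum_span_exp_qform, tsum_span_exp_qform, tsum_exp_gram _ (posDef_gramMat hy b), det_gramMat,
    inv_gramMat hy]

/-- The theta series of a fractional ideal. -/
def theta (J : (FractionalIdeal (𝓞 K)⁰ K)ˣ) (y : InfinitePlace K → ℝ) : ℝ :=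
  ∑' a : (J : FractionalIdeal (𝓞 K)⁰ K), Real.exp (-Real.pi * qform y a)

/-- The dual fractional ideal for the trace form. -/
def dualUnit (J : (FractionalIdeal (𝓞 K)⁰ K)ˣ) : (FractionalIdeal (𝓞 K)⁰ K)ˣ :=
  Units.mk0 (FractionalIdeal.dual ℤ ℚ (J : FractionalIdeal (𝓞 K)⁰ K))
    (FractionalIdeal.dual_ne_zero ℤ ℚ J.ne_zero)

lemma exists_basis (J : (FractionalIdeal (𝓞 K)⁰ K)ˣ) :
    ∃ b : Module.Basis (K →ₐ[ℚ] ℂ) ℚ K,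
      (∀ x, x ∈ Submodule.span ℤ (Set.range b) ↔ x ∈ (J : FractionalIdeal (𝓞 K)⁰ K)) ∧
      |(Algebra.discr ℚ b : ℝ)| =
        |(discr K : ℝ)| * (FractionalIdeal.absNorm (J : FractionalIdeal (𝓞 K)⁰ K) : ℝ) ^ 2 := by
  have hc : Fintype.card (Module.Free.ChooseBasisIndex ℤ J.1) = Fintype.card (K →ₐ[ℚ] ℂ) := by
    rw [AlgHom.card, Module.finrank_eq_card_basis (basisOfFractionalIdeal K J)]
  have hc' : Fintype.card (Module.Free.ChooseBasisIndex ℤ (𝓞 K)) =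
      Fintype.card (Module.Free.ChooseBasisIndex ℤ J.1) := by
    rw [hc, AlgHom.card, Module.finrank_eq_card_basis (integralBasis K)]
  let e := Fintype.equivOfCardEq hc
  let e' := Fintype.equivOfCardEq hc'
  refine ⟨(basisOfFractionalIdeal K J).reindex e, fun x ↦ ?_, ?_⟩
  · rw [Module.Basis.range_reindex, mem_span_basisOfFractionalIdeal]
    rfl
  · rw [Module.Basis.coe_reindex, Algebra.discr_reindex]
    have h1 := Algebra.discr_reindex ℚ (basisOfFractionalIdeal K J) e'.symm
    rw [← h1, ← Module.Basis.coe_reindex]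
    set b' := (basisOfFractionalIdeal K J).reindex e'.symm
    have h2 := det_basisOfFractionalIdeal_eq_absNorm K J e'
    have h3 := Algebra.discr_of_matrix_vecMul (integralBasis K) ((integralBasis K).toMatrix b')
    rw [Module.Basis.toMatrix_map_vecMul, ← coe_discr] at h3
    rw [h3, ← h2, Module.Basis.det_apply, Rat.cast_mul, Rat.cast_pow, Rat.cast_intCast, abs_mul,
      abs_pow, mul_comm, ← Rat.cast_abs]

theorem theta_eq (J : (FractionalIdeal (𝓞 K)⁰ K)ˣ) {y : InfinitePlace K → ℝ} (hy : ∀ w, 0 < y w) :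
    theta J y = (Real.sqrt (|(discr K : ℝ)| *
        (FractionalIdeal.absNorm (J : FractionalIdeal (𝓞 K)⁰ K) : ℝ) ^ 2 * ∏ w, y w ^ w.mult))⁻¹ *
      theta (dualUnit J) (fun w ↦ (y w)⁻¹) := by
  obtain ⟨b, hb, hd⟩ := exists_basis J
  have h := tsum_span_exp_qform_eq hy b
  rw [hd] at h
  have hb' : ∀ x, x ∈ Submodule.span ℤ (Set.range b.traceDual) ↔
      x ∈ (dualUnit J : FractionalIdeal (𝓞 K)⁰ K) := by
    intro x
    have := Submodule.traceDual_span_of_basis (A := ℤ) (K := ℚ) (L := K) (B := 𝓞 K)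
      ((J : FractionalIdeal (𝓞 K)⁰ K) : Submodule (𝓞 K) K) b (by
        ext x; rw [hb]; rfl)
    rw [← this, Submodule.restrictScalars_mem, dualUnit, Units.val_mk0, ← FractionalIdeal.mem_coe,
      FractionalIdeal.coe_dual ℤ ℚ J.ne_zero]
  have e1 := (Equiv.subtypeEquivRight hb).tsum_eq (fun a ↦ Real.exp (-Real.pi * qform y a))
  have e2 := (Equiv.subtypeEquivRight hb').tsum_eq
    (fun a ↦ Real.exp (-Real.pi * qform (fun w ↦ (y w)⁻¹) a))
  rw [theta, theta]
  refine (e1.symm.trans h).trans ?_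
  congr 1

end Theta

end LargeStrip

namespace LargeStrip

open scoped nonZeroDivisors

variable {ι : Type*} [Fintype ι]

open Matrix in
lemma exists_sum_sq_le_dotProduct_mulVec (G : Matrix ι ι ℝ) (hG : G.PosDef) :
    ∃ c > 0, ∀ x : ι → ℝ, c * ∑ i, x i ^ 2 ≤ x ⬝ᵥ G *ᵥ x := by
  obtain ⟨A, rfl⟩ : ∃ A : Matrix ι ι ℝ, G = Aᵀ * A := by
    open MatrixOrder in
    obtain ⟨A, hA⟩ := CStarAlgebra.nonneg_iff_eq_star_mul_self.mp hG.posSemidef.nonneg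
    exact ⟨A, by simpa [star_eq_conjTranspose] using hA⟩
  have hA : IsUnit A.det := by
    have := hG.det_pos
    rw [det_mul, det_transpose] at this
    exact isUnit_iff_ne_zero.mpr fun h ↦ by simp [h] at this
  obtain ⟨c, hc, h⟩ := exists_sum_sq_mulVec_ge A hA
  refine ⟨c, hc, fun x ↦ (h x).trans_eq ?_⟩
  rw [← mulVec_mulVec, dotProduct_mulVec, vecMul_transpose]
  simp [dotProduct, sq]

variable {K : Type*} [Field K] [NumberField K]

lemma qform_mono {y z : InfinitePlace K → ℝ} (hyz : ∀ w, y w ≤ z w) (a : K) :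
    qform y a ≤ qform z a :=
  Finset.sum_le_sum fun w _ ↦ by have := hyz w; gcongr

lemma qform_const_mul (c : ℝ) (y : InfinitePlace K → ℝ) (a : K) :
    qform (fun w ↦ c * y w) a = c * qform y a := by
  rw [qform, qform, Finset.mul_sum]
  exact Finset.sum_congr rfl fun w _ ↦ by ring

lemma qform_mul (y : InfinitePlace K → ℝ) (u a : K) :
    qform y (u * a) = qform (fun w ↦ y w * w u ^ 2) a :=
  Finset.sum_congr rfl fun w _ ↦ by rw [map_mul]; ring

@[simp] lemma qform_zero (y : InfinitePlace K → ℝ) : qform y 0 = 0 := by simp [qform]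

lemma continuous_qform (a : K) : Continuous fun y : InfinitePlace K → ℝ ↦ qform y a := by
  unfold qform; fun_prop

/-- The elements of a fractional ideal. -/
abbrev Elts (J : (FractionalIdeal (𝓞 K)⁰ K)ˣ) : Type _ :=
  {a : K // a ∈ (J : FractionalIdeal (𝓞 K)⁰ K)}

/-- The coordinates of the elements of a fractional ideal in some integral basis. -/
lemma exists_coordinates (J : (FractionalIdeal (𝓞 K)⁰ K)ˣ) {y : InfinitePlace K → ℝ}
    (hy : ∀ w, 0 < y w) :
    ∃ (e : Elts J ≃ ((K →ₐ[ℚ] ℂ) → ℤ)) (c : ℝ), 0 < c ∧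
      ∀ a, c * ∑ i, (e a i : ℝ) ^ 2 ≤ qform y a ∧ (e a = 0 → (a : K) = 0) := by
  obtain ⟨b, hb, -⟩ := exists_basis J
  obtain ⟨c, hc, h⟩ := exists_sum_sq_le_dotProduct_mulVec _ (posDef_gramMat hy b)
  let e₁ := Equiv.subtypeEquivRight hb
  let e₂ := (b.restrictScalars ℤ).equivFun
  refine ⟨e₁.symm.trans e₂.toEquiv, c, hc, fun a ↦ ⟨?_, fun h0 ↦ ?_⟩⟩
  · refine (h _).trans_eq ?_
    obtain ⟨a, rfl⟩ := e₁.surjective a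
    obtain ⟨m, rfl⟩ := e₂.symm.surjective a
    simp only [Equiv.trans_apply, Equiv.symm_apply_apply, LinearEquiv.coe_toEquiv,
      LinearEquiv.apply_symm_apply]
    rw [dotProduct_gramMat, qform_eq]
    refine Finset.sum_congr rfl fun φ _ ↦ ?_
    congr 3
    simp only [e₁, e₂, Equiv.subtypeEquivRight_apply_coe,
      Module.Basis.equivFun_symm_apply, AddSubmonoidClass.coe_finsetSum,
      SetLike.val_smul, map_sum, Matrix.mulVec, dotProduct, conjMat, Matrix.of_apply]
    refine Finset.sum_congr rfl fun i _ ↦ ?_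
    simp [mul_comm]
  · have : e₁.symm a = 0 := e₂.map_eq_zero_iff.mp h0
    rw [Equiv.symm_apply_eq] at this
    rw [this]
    rfl

lemma summable_exp_qform (J : (FractionalIdeal (𝓞 K)⁰ K)ˣ) {y : InfinitePlace K → ℝ}
    (hy : ∀ w, 0 < y w) :
    Summable fun a : Elts J ↦ Real.exp (-Real.pi * qform y a) := by
  obtain ⟨e, c, hc, h⟩ := exists_coordinates J hy
  rw [← e.symm.summable_iff]
  refine (summable_exp_neg_sum_sq (ι := K →ₐ[ℚ] ℂ) (mul_pos Real.pi_pos hc)).of_nonneg_of_le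
    (fun _ ↦ (Real.exp_pos _).le) fun m ↦ Real.exp_le_exp.mpr ?_
  have := (h (e.symm m)).1
  rw [e.apply_symm_apply] at this
  have := mul_le_mul_of_nonneg_left this Real.pi_pos.le
  simp only [neg_mul]
  linarith

lemma exists_le_qform_one (J : (FractionalIdeal (𝓞 K)⁰ K)ˣ) :
    ∃ q > 0, ∀ a : Elts J, (a : K) ≠ 0 → q ≤ qform (fun _ ↦ 1) (a : K) := by
  obtain ⟨e, c, hc, h⟩ := exists_coordinates J (y := fun _ ↦ 1) (by simp)
  refine ⟨c, hc, fun a ha ↦ le_trans ?_ (h a).1⟩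
  obtain ⟨i, hi⟩ := Function.ne_iff.mp fun h0 ↦ ha ((h a).2 h0)
  have h1 : (1 : ℝ) ≤ (e a i : ℝ) ^ 2 := by
    exact_mod_cast Int.one_le_abs (sq_pos_of_ne_zero hi).ne' |>.trans_eq
      (abs_of_nonneg (sq_nonneg _))
  have := Finset.single_le_sum (f := fun i ↦ (e a i : ℝ) ^ 2) (fun _ _ ↦ sq_nonneg _)
    (Finset.mem_univ i)
  nlinarith

lemma theta_pos (J : (FractionalIdeal (𝓞 K)⁰ K)ˣ) {y : InfinitePlace K → ℝ} (hy : ∀ w, 0 < y w) :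
    0 < theta J y :=
  (summable_exp_qform J hy).tsum_pos (fun _ ↦ (Real.exp_pos _).le) ⟨0, FractionalIdeal.zero_mem _⟩
    (Real.exp_pos _)

lemma theta_anti (J : (FractionalIdeal (𝓞 K)⁰ K)ˣ) {y z : InfinitePlace K → ℝ}
    (hy : ∀ w, 0 < y w) (hyz : ∀ w, y w ≤ z w) : theta J z ≤ theta J y :=
  (summable_exp_qform J fun w ↦ (hy w).trans_le (hyz w)).tsum_le_tsum
    (fun a ↦ Real.exp_le_exp.mpr (by
      have := mul_le_mul_of_nonneg_left (qform_mono hyz (a : K)) Real.pi_pos.le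
      linarith)) (summable_exp_qform J hy)

lemma continuousOn_theta (J : (FractionalIdeal (𝓞 K)⁰ K)ˣ) :
    ContinuousOn (theta J) {y | ∀ w, 0 < y w} := by
  intro y hy
  refine ContinuousAt.continuousWithinAt ?_
  have hU : IsOpen {z : InfinitePlace K → ℝ | ∀ w, y w / 2 < z w} := by
    simp only [Set.ofPred_forall]
    exact isOpen_iInter_of_finite fun w ↦ isOpen_lt continuous_const (continuous_apply w)
  have hc : ContinuousOn (theta J) {z | ∀ w, y w / 2 < z w} := by
    refine continuousOn_tsum (u := fun a : Elts J ↦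
      Real.exp (-Real.pi * qform (fun w ↦ y w / 2) a)) (fun a ↦ ?_)
      (summable_exp_qform J fun w ↦ half_pos (hy w)) fun a z hz ↦ ?_
    · exact (Real.continuous_exp.comp (continuous_const.mul (continuous_qform _))).continuousOn
    · rw [Real.norm_eq_abs, Real.abs_exp, Real.exp_le_exp]
      have := mul_le_mul_of_nonneg_left (qform_mono (fun w ↦ (hz w).le) (a : K)) Real.pi_pos.le
      linarith
  exact hc.continuousAt (hU.mem_nhds fun w ↦ half_lt_self (hy w))

lemma theta_sub_one (J : (FractionalIdeal (𝓞 K)⁰ K)ˣ) {y : InfinitePlace K → ℝ}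
    (hy : ∀ w, 0 < y w) :
    theta J y - 1 = ∑' a : {a : Elts J // (a : K) ≠ 0},
      Real.exp (-Real.pi * qform y (a : K)) := by
  have h := (summable_exp_qform J hy).tsum_subtype_add_tsum_subtype_compl
    {(⟨0, FractionalIdeal.zero_mem _⟩ : Elts J)}
  rw [tsum_singleton (f := fun a : Elts J ↦ Real.exp (-Real.pi * qform y a))] at h
  rw [theta, ← h]
  simp only [qform_zero, mul_zero, Real.exp_zero, add_sub_cancel_left]
  exact (Equiv.subtypeEquivRight fun a : Elts J ↦ by simp [Subtype.ext_iff]).tsum_eq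
    (fun a : {a : Elts J // (a : K) ≠ 0} ↦ Real.exp (-Real.pi * qform y (a : K)))

lemma theta_sub_one_nonneg (J : (FractionalIdeal (𝓞 K)⁰ K)ˣ) {y : InfinitePlace K → ℝ}
    (hy : ∀ w, 0 < y w) : 0 ≤ theta J y - 1 := by
  rw [theta_sub_one J hy]
  exact tsum_nonneg fun _ ↦ (Real.exp_pos _).le

lemma exists_theta_sub_one_le (J : (FractionalIdeal (𝓞 K)⁰ K)ˣ) {c : ℝ} (hc : 0 < c) :
    ∃ A q : ℝ, 0 < q ∧ ∀ t : ℝ, 1 ≤ t → ∀ y : InfinitePlace K → ℝ, (∀ w, c * t ≤ y w) →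
      theta J y - 1 ≤ A * Real.exp (-q * t) := by
  obtain ⟨q, hq, h⟩ := exists_le_qform_one J
  have hs : Summable fun a : {a : Elts J // (a : K) ≠ 0} ↦
      Real.exp (-Real.pi * qform (fun _ ↦ c * 1) (a : K)) :=
    (summable_exp_qform J (y := fun _ ↦ c * 1) fun w ↦ by simpa).subtype _
  refine ⟨(∑' a : {a : Elts J // (a : K) ≠ 0},
      Real.exp (-Real.pi * qform (fun _ ↦ c * 1) (a : K))) * Real.exp (Real.pi * c * q),
      Real.pi * c * q, by positivity, fun t ht y hy ↦ ?_⟩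
  have hy0 : ∀ w, 0 < y w := fun w ↦ lt_of_lt_of_le (by positivity) (hy w)
  rw [theta_sub_one J hy0, mul_assoc, ← Real.exp_add, ← tsum_mul_right]
  refine Summable.tsum_le_tsum (fun a ↦ ?_) ((summable_exp_qform J hy0).subtype _)
    (hs.mul_right _)
  rw [← Real.exp_add, Real.exp_le_exp]
  have h1 := qform_mono (z := y) (y := fun w ↦ c * t) hy (a : K)
  have h3 : qform (fun _ : InfinitePlace K ↦ c * t) (a : K) =
      (c * t) * qform (fun _ ↦ 1) (a : K) := by
    rw [← qform_const_mul]; simp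
  rw [qform_const_mul]
  rw [h3] at h1
  have h2 := h a.1 a.2
  have h4 := mul_le_mul_of_nonneg_left h2 (show 0 ≤ Real.pi * c * (t - 1) by
    have : 0 ≤ t - 1 := by linarith
    positivity)
  have h5 := mul_le_mul_of_nonneg_left h1 Real.pi_pos.le
  linarith

/-- Multiplication by a unit. -/
lemma theta_unit_mul (J : (FractionalIdeal (𝓞 K)⁰ K)ˣ) (y : InfinitePlace K → ℝ) (u : (𝓞 K)ˣ) :
    theta J (fun w ↦ y w * w (u : K) ^ 2) = theta J y := by
  let e : Elts J ≃ Elts J :=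
    MulAction.toPerm (α := (𝓞 K)ˣ)
      (β := ((J : FractionalIdeal (𝓞 K)⁰ K) : Submodule (𝓞 K) K)) u
  have := e.tsum_eq fun a ↦ Real.exp (-Real.pi * qform y a)
  rw [theta, theta, ← this]
  refine tsum_congr fun a ↦ ?_
  rw [← qform_mul]
  rfl

lemma dualUnit_dualUnit (J : (FractionalIdeal (𝓞 K)⁰ K)ˣ) : dualUnit (dualUnit J) = J :=
  Units.ext (FractionalIdeal.dual_dual ℤ ℚ _)

/-- The absolute discriminant of a fractional ideal. -/
def adisc (J : (FractionalIdeal (𝓞 K)⁰ K)ˣ) : ℝ :=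
  |(discr K : ℝ)| * (FractionalIdeal.absNorm (J : FractionalIdeal (𝓞 K)⁰ K) : ℝ) ^ 2

lemma absNorm_pos (J : (FractionalIdeal (𝓞 K)⁰ K)ˣ) :
    0 < (FractionalIdeal.absNorm (J : FractionalIdeal (𝓞 K)⁰ K) : ℝ) := by
  have h1 := FractionalIdeal.absNorm_nonneg (J : FractionalIdeal (𝓞 K)⁰ K)
  have h2 : FractionalIdeal.absNorm (J : FractionalIdeal (𝓞 K)⁰ K) ≠ 0 :=
    fun h ↦ J.ne_zero (FractionalIdeal.absNorm_eq_zero_iff.mp h)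
  exact_mod_cast h1.lt_of_ne' h2

lemma adisc_pos (J : (FractionalIdeal (𝓞 K)⁰ K)ˣ) : 0 < adisc J := by
  have := absNorm_pos J
  have : (discr K : ℝ) ≠ 0 := by exact_mod_cast discr_ne_zero K
  unfold adisc; positivity

lemma adisc_dualUnit (J : (FractionalIdeal (𝓞 K)⁰ K)ˣ) : adisc (dualUnit J) = (adisc J)⁻¹ := by
  have h1 := theta_eq J (y := fun _ ↦ 1) (by simp)
  have h2 := theta_eq (dualUnit J) (y := fun _ ↦ 1) (by simp)
  rw [dualUnit_dualUnit] at h2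
  simp only [one_pow, Finset.prod_const_one, mul_one, inv_one] at h1 h2
  rw [h2, ← mul_assoc] at h1
  have h3 := (mul_eq_right₀ (theta_pos J (y := fun _ ↦ 1) (by simp)).ne').mp h1.symm
  change (√(adisc J))⁻¹ * (√(adisc (dualUnit J)))⁻¹ = 1 at h3
  rw [← mul_inv, ← Real.sqrt_mul (adisc_pos J).le, inv_eq_one, Real.sqrt_eq_one] at h3
  exact eq_inv_of_mul_eq_one_right h3

end LargeStrip

namespace LargeStrip

open scoped nonZeroDivisors
open NumberField.Units NumberField.Units.dirichletUnitTheorem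

variable {K : Type*} [Field K] [NumberField K]

/-- The extension of a vector of `logSpace K` to a vector indexed by all the infinite places whose
coordinates sum to zero. -/
def ell (ξ : logSpace K) (w : InfinitePlace K) : ℝ :=
  if h : w = w₀ then -∑ v, ξ v else ξ ⟨w, h⟩

lemma ell_w₀ (ξ : logSpace K) : ell ξ w₀ = -∑ v, ξ v := by simp [ell]

lemma ell_of_ne (ξ : logSpace K) (w : {w : InfinitePlace K // w ≠ w₀}) : ell ξ w = ξ w := by
  simp [ell, w.2]

lemma ell_add (ξ η : logSpace K) (w : InfinitePlace K) : ell (ξ + η) w = ell ξ w + ell η w := by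
  unfold ell
  split_ifs
  · simp [Finset.sum_add_distrib]; ring
  · rfl

lemma ell_neg (ξ : logSpace K) (w : InfinitePlace K) : ell (-ξ) w = -ell ξ w := by
  unfold ell
  split_ifs <;> simp

lemma sum_ell (ξ : logSpace K) : ∑ w, ell ξ w = 0 := by
  rw [Fintype.sum_eq_add_sum_subtype_ne _ w₀, ell_w₀]
  simp [ell_of_ne]

lemma ell_logEmbedding (u : (𝓞 K)ˣ) (w : InfinitePlace K) :
    ell (logEmbedding K (Additive.ofMul u)) w = w.mult * Real.log (w (u : K)) := by
  by_cases h : w = w₀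
  · rw [h, ell_w₀, sum_logEmbedding_component]; ring
  · exact ell_of_ne _ ⟨w, h⟩

lemma continuous_ell (w : InfinitePlace K) : Continuous fun ξ : logSpace K ↦ ell ξ w := by
  unfold ell
  split_ifs <;> fun_prop

/-- The point of the positive orthant with parameters `t` and `ξ`. -/
def orth (t : ℝ) (ξ : logSpace K) (w : InfinitePlace K) : ℝ :=
  t * Real.exp (2 * ell ξ w / w.mult)

lemma orth_pos {t : ℝ} (ht : 0 < t) (ξ : logSpace K) (w : InfinitePlace K) : 0 < orth t ξ w :=
  mul_pos ht (Real.exp_pos _)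

lemma prod_orth (t : ℝ) (ξ : logSpace K) :
    ∏ w, orth t ξ w ^ w.mult = t ^ Module.finrank ℚ K := by
  simp only [orth, mul_pow, Finset.prod_mul_distrib, ← Real.exp_nat_mul]
  rw [Finset.prod_pow_eq_pow_sum, InfinitePlace.sum_mult_eq, ← Real.exp_sum]
  have : ∀ w : InfinitePlace K, (w.mult : ℝ) * (2 * ell ξ w / w.mult) = 2 * ell ξ w := fun w ↦ by
    have := InfinitePlace.mult_coe_ne_zero (w := w)
    field_simp
  simp_rw [this, ← Finset.mul_sum, sum_ell, mul_zero, Real.exp_zero, mul_one]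

lemma inv_orth (t : ℝ) (ξ : logSpace K) : (fun w ↦ (orth t ξ w)⁻¹) = orth t⁻¹ (-ξ) := by
  ext w
  rw [orth, orth, mul_inv, ← Real.exp_neg, ell_neg]
  congr 2; ring

lemma orth_add_logEmbedding (t : ℝ) (ξ : logSpace K) (u : (𝓞 K)ˣ) :
    orth t (logEmbedding K (Additive.ofMul u) + ξ) = fun w ↦ orth t ξ w * w (u : K) ^ 2 := by
  ext w
  have h0 := InfinitePlace.mult_coe_ne_zero (w := w)
  have hp : 0 < w (u : K) := Units.pos_at_place u w
  rw [orth, orth, ell_add, ell_logEmbedding, mul_assoc, ← Real.exp_log (pow_pos hp 2),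
    ← Real.exp_add, Real.log_pow]
  congr 2
  field_simp
  push_cast
  ring

lemma continuous_orth (t : ℝ) : Continuous fun ξ : logSpace K ↦ orth t ξ :=
  continuous_pi fun w ↦ by
    have := continuous_ell w
    unfold orth
    fun_prop

variable (K) in
/-- A fundamental domain for the unit lattice. -/
def fundDom : Set (logSpace K) :=
  ZSpan.fundamentalDomain ((basisUnitLattice K).ofZLatticeBasis ℝ (unitLattice K))

instance : VAddInvariantMeasure (unitLattice K) (logSpace K) volume :=
  inferInstanceAs <| VAddInvariantMeasure (unitLattice K).toAddSubgroup (logSpace K) volume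

lemma isAddFundamentalDomain_fundDom :
    IsAddFundamentalDomain (unitLattice K) (fundDom K) volume :=
  ZLattice.isAddFundamentalDomain _ _

lemma isAddFundamentalDomain_neg_fundDom :
    IsAddFundamentalDomain (unitLattice K) (Neg.neg ⁻¹' fundDom K) volume :=
  isAddFundamentalDomain_fundDom.preimage_of_equiv
    (Measure.measurePreserving_neg volume).quasiMeasurePreserving
    (Equiv.neg (unitLattice K)).bijective fun g x ↦ by
      change -(((-g : unitLattice K) : logSpace K) + x) = g + -x
      simp [add_comm]

lemma isBounded_fundDom : Bornology.IsBounded (fundDom K) := ZSpan.fundamentalDomain_isBounded _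

lemma volume_fundDom_lt_top : volume (fundDom K) < ⊤ := isBounded_fundDom.measure_lt_top

lemma exists_orth_ge : ∃ c > 0, ∀ ξ ∈ fundDom K, ∀ t > 0, ∀ w, c * t ≤ orth t ξ w := by
  have h (w : InfinitePlace K) : ∃ c > 0, ∀ ξ ∈ fundDom K, c ≤ Real.exp (2 * ell ξ w / w.mult) := by
    have hc := isBounded_fundDom (K := K).isCompact_closure
    obtain ⟨m, hm⟩ := (hc.image (continuous_ell w)).bddBelow
    refine ⟨Real.exp (2 * m / w.mult), Real.exp_pos _, fun ξ hξ ↦ ?_⟩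
    have := hm ⟨ξ, subset_closure hξ, rfl⟩
    gcongr
  choose c hc h using h
  obtain ⟨w', hw'⟩ := Finite.exists_min c
  refine ⟨c w', hc w', fun ξ hξ t ht w ↦ ?_⟩
  rw [orth, mul_comm]
  exact mul_le_mul_of_nonneg_left ((hw' w).trans (h w ξ hξ)) ht.le

lemma unitLattice_induction {p : logSpace K → Prop}
    (h : ∀ u : (𝓞 K)ˣ, p (logEmbedding K (Additive.ofMul u))) (x : unitLattice K) : p x := by
  obtain ⟨x, ⟨u, -, rfl⟩⟩ := x
  exact h u.toMul

lemma theta_vadd (J : (FractionalIdeal (𝓞 K)⁰ K)ˣ) (t : ℝ) (g : unitLattice K) (ξ : logSpace K) :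
    theta J (orth t (g +ᵥ ξ)) = theta J (orth t ξ) :=
  unitLattice_induction (p := fun g ↦ theta J (orth t (g + ξ)) = theta J (orth t ξ))
    (fun u ↦ by rw [orth_add_logEmbedding, theta_unit_mul]) g

lemma continuous_theta_orth (J : (FractionalIdeal (𝓞 K)⁰ K)ˣ) {t : ℝ} (ht : 0 < t) :
    Continuous fun ξ : logSpace K ↦ theta J (orth t ξ) :=
  (continuousOn_theta J).comp_continuous (continuous_orth t) fun ξ w ↦ orth_pos ht ξ w

lemma integrableOn_theta_orth (J : (FractionalIdeal (𝓞 K)⁰ K)ˣ) {t : ℝ} (ht : 0 < t) :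
    IntegrableOn (fun ξ ↦ theta J (orth t ξ)) (fundDom K) :=
  ((continuous_theta_orth J ht).locallyIntegrable.integrableOn_isCompact
    isBounded_fundDom.isCompact_closure).mono_set subset_closure

/-- The theta integral over a fundamental domain for the units. -/
def thetaInt (J : (FractionalIdeal (𝓞 K)⁰ K)ˣ) (t : ℝ) : ℝ :=
  ∫ ξ in fundDom K, theta J (orth t ξ)

lemma thetaInt_eq (J : (FractionalIdeal (𝓞 K)⁰ K)ˣ) {t : ℝ} (ht : 0 < t) :
    thetaInt J t = (√(adisc J * t ^ Module.finrank ℚ K))⁻¹ * thetaInt (dualUnit J) t⁻¹ := by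
  have h1 : ∀ ξ : logSpace K, theta J (orth t ξ) =
      (√(adisc J * t ^ Module.finrank ℚ K))⁻¹ * theta (dualUnit J) (orth t⁻¹ (-ξ)) := fun ξ ↦ by
    rw [theta_eq J fun w ↦ orth_pos ht ξ w, prod_orth, inv_orth, adisc]
  have h2 := (isAddFundamentalDomain_neg_fundDom (K := K)).setIntegral_eq
    isAddFundamentalDomain_fundDom (f := fun ξ ↦ theta (dualUnit J) (orth t⁻¹ ξ))
    (theta_vadd (dualUnit J) t⁻¹)
  have h3 := (Measure.measurePreserving_neg
    (volume : Measure (logSpace K))).setIntegral_preimage_emb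
    (MeasurableEquiv.neg _).measurableEmbedding
    (fun ξ ↦ theta (dualUnit J) (orth t⁻¹ ξ)) (Neg.neg ⁻¹' fundDom K)
  simp only [thetaInt, h1]
  rw [integral_const_mul, ← h2, ← h3]
  congr 3
  ext ξ; simp

lemma thetaInt_anti (J : (FractionalIdeal (𝓞 K)⁰ K)ˣ) : AntitoneOn (thetaInt J) (Set.Ioi 0) :=
  fun _ hs _ ht hst ↦ setIntegral_mono (integrableOn_theta_orth J ht) (integrableOn_theta_orth J hs)
    fun ξ ↦ theta_anti J (fun w ↦ orth_pos hs ξ w) fun _ ↦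
      mul_le_mul_of_nonneg_right hst (Real.exp_pos _).le

variable (K) in
/-- The volume of the fundamental domain of the unit lattice. -/
def unitVol : ℝ := volume.real (fundDom K)

lemma unitVol_pos : 0 < unitVol K :=
  ENNReal.toReal_pos (ZSpan.measure_fundamentalDomain_ne_zero _) volume_fundDom_lt_top.ne

lemma thetaInt_sub (J : (FractionalIdeal (𝓞 K)⁰ K)ˣ) {t : ℝ} (ht : 0 < t) :
    thetaInt J t - unitVol K = ∫ ξ in fundDom K, (theta J (orth t ξ) - 1) := by
  rw [integral_sub (integrableOn_theta_orth J ht)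
    (integrableOn_const volume_fundDom_lt_top.ne)]
  simp [thetaInt, unitVol]

lemma exists_thetaInt_sub_le (J : (FractionalIdeal (𝓞 K)⁰ K)ˣ) :
    ∃ A q : ℝ, 0 < q ∧ ∀ t : ℝ, 1 ≤ t →
      |thetaInt J t - unitVol K| ≤ A * Real.exp (-q * t) := by
  obtain ⟨c, hc, h⟩ := exists_orth_ge (K := K)
  obtain ⟨A, q, hq, h'⟩ := exists_theta_sub_one_le J hc
  refine ⟨A * unitVol K, q, hq, fun t ht ↦ ?_⟩
  have ht0 : 0 < t := one_pos.trans_le ht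
  rw [thetaInt_sub J ht0]
  rw [mul_right_comm, ← Real.norm_eq_abs]
  refine norm_setIntegral_le_of_norm_le_const volume_fundDom_lt_top fun ξ hξ ↦ ?_
  rw [Real.norm_of_nonneg (theta_sub_one_nonneg J fun w ↦ orth_pos ht0 ξ w)]
  exact h' t ht _ (h ξ hξ t ht0)

/-- The normalised theta integral. -/
def thetaN (J : (FractionalIdeal (𝓞 K)⁰ K)ˣ) (t : ℝ) : ℝ :=
  thetaInt J (adisc J ^ (-(1 / Module.finrank ℚ K : ℝ)) * t)

lemma thetaN_one_div (J : (FractionalIdeal (𝓞 K)⁰ K)ˣ) {t : ℝ} (ht : 0 < t) :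
    thetaN J (1 / t) = t ^ (Module.finrank ℚ K / 2 : ℝ) * thetaN (dualUnit J) t := by
  have hd : (Module.finrank ℚ K : ℝ) ≠ 0 := by exact_mod_cast Module.finrank_pos.ne'
  have ha := adisc_pos J
  have hc := Real.rpow_pos_of_pos ha (-(1 / Module.finrank ℚ K : ℝ))
  rw [thetaN, thetaN, thetaInt_eq J (by positivity), adisc_dualUnit]
  congr 1
  · rw [mul_pow, ← Real.rpow_natCast, ← Real.rpow_mul ha.le, ← mul_assoc]
    have : -(1 / (Module.finrank ℚ K : ℝ)) * Module.finrank ℚ K = -1 := by field_simp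
    rw [this, Real.rpow_neg_one, mul_inv_cancel₀ ha.ne', one_mul, one_div, inv_pow, Real.sqrt_inv,
      inv_inv, Real.sqrt_eq_rpow, ← Real.rpow_natCast, ← Real.rpow_mul ht.le]
    congr 1; ring
  · rw [mul_inv, one_div t, inv_inv, Real.inv_rpow ha.le, Real.rpow_neg ha.le]

lemma thetaN_anti (J : (FractionalIdeal (𝓞 K)⁰ K)ˣ) : AntitoneOn (thetaN J) (Set.Ioi 0) :=
  fun s hs t ht hst ↦ by
    have hc := Real.rpow_pos_of_pos (adisc_pos J) (-(1 / Module.finrank ℚ K : ℝ))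
    exact thetaInt_anti J (mul_pos hc hs) (mul_pos hc ht) (by gcongr)

lemma isBigO_thetaN_sub (J : (FractionalIdeal (𝓞 K)⁰ K)ˣ) (r : ℝ) :
    (fun t ↦ thetaN J t - unitVol K) =O[atTop] (· ^ r) := by
  obtain ⟨A, q, hq, h⟩ := exists_thetaInt_sub_le J
  have hc := Real.rpow_pos_of_pos (adisc_pos J) (-(1 / Module.finrank ℚ K : ℝ))
  set c := adisc J ^ (-(1 / Module.finrank ℚ K : ℝ)) with hcd
  refine Asymptotics.IsBigO.trans (g := fun t ↦ Real.exp (-(q * c) * t)) ?_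
    (isLittleO_exp_neg_mul_rpow_atTop (by positivity) r).isBigO
  refine Asymptotics.IsBigO.of_bound A ?_
  filter_upwards [eventually_ge_atTop c⁻¹] with t ht
  have h1 : 1 ≤ c * t := by rwa [inv_le_iff_one_le_mul₀' hc] at ht
  refine (h (c * t) h1).trans_eq ?_
  rw [Real.norm_eq_abs, Real.abs_exp]
  congr 2; ring

end LargeStrip

namespace LargeStrip

open scoped nonZeroDivisors ENNReal
open NumberField.Units NumberField.Units.dirichletUnitTheorem

variable {K : Type*} [Field K] [NumberField K]

variable (K) in
/-- Logarithmic coordinates on the positive orthant. -/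
def logCoord (p : ℝ × logSpace K) (w : InfinitePlace K) : ℝ := p.1 + 2 * ell p.2 w / w.mult

lemma continuous_logCoord : Continuous (logCoord K) :=
  continuous_pi fun w ↦ by
    have := (continuous_ell w).comp (continuous_snd (X := ℝ) (Y := logSpace K))
    unfold logCoord
    fun_prop

lemma logCoord_logEmbedding_add (τ : ℝ) (ξ : logSpace K) (u : (𝓞 K)ˣ) (w : InfinitePlace K) :
    logCoord K (τ, logEmbedding K (Additive.ofMul u) + ξ) w =
      logCoord K (τ, ξ) w + 2 * Real.log (w (u : K)) := by
  have h0 := InfinitePlace.mult_coe_ne_zero (w := w)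
  simp only [logCoord, ell_add, ell_logEmbedding]
  field_simp
  ring

/-- The density of the completed zeta function in logarithmic coordinates. -/
def dens (s : ℝ) (x : InfinitePlace K → ℝ) : ℝ :=
  Real.exp (∑ w, (s / 2 * (w.mult * x w) - Real.pi * w.mult * Real.exp (x w)))

lemma continuous_dens (s : ℝ) : Continuous (dens (K := K) s) := by unfold dens; fun_prop

/-- The translation vector attached to an element of the field. -/
def logVec (c : ℝ) (a : K) (w : InfinitePlace K) : ℝ := Real.log c + 2 * Real.log (w a)

lemma sum_logVec (c : ℝ) {a : K} (ha : a ≠ 0) :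
    ∑ w : InfinitePlace K, w.mult * logVec c a w =
      Module.finrank ℚ K * Real.log c + 2 * Real.log |(Algebra.norm ℚ a : ℝ)| := by
  have h : Real.log |(Algebra.norm ℚ a : ℝ)| = ∑ w : InfinitePlace K, w.mult * Real.log (w a) := by
    have := InfinitePlace.prod_eq_abs_norm a
    rw [Rat.cast_abs] at this
    rw [← this, Real.log_prod fun w _ ↦ pow_ne_zero _ (by simpa using ha)]
    simp [Real.log_pow]
  simp only [h, logVec, mul_add, Finset.sum_add_distrib, Finset.mul_sum, ← Finset.sum_mul]
  rw [← InfinitePlace.sum_mult_eq (K := K)]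
  push_cast
  congr 1
  exact Finset.sum_congr rfl fun w _ ↦ by ring

lemma sum_logCoord (p : ℝ × logSpace K) :
    ∑ w : InfinitePlace K, w.mult * logCoord K p w = Module.finrank ℚ K * p.1 := by
  have (w : InfinitePlace K) : w.mult * logCoord K p w = w.mult * p.1 + 2 * ell p.2 w := by
    have h0 := InfinitePlace.mult_coe_ne_zero (w := w)
    simp only [logCoord]
    field_simp
  simp_rw [this, Finset.sum_add_distrib, ← Finset.mul_sum, sum_ell, ← Finset.sum_mul]
  rw [← InfinitePlace.sum_mult_eq (K := K)]
  push_cast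
  ring

lemma exp_mul_exp_qform {c s : ℝ} (hc : 0 < c) {a : K} (ha : a ≠ 0) (τ : ℝ) (ξ : logSpace K) :
    Real.exp (Module.finrank ℚ K * s / 2 * τ) *
      Real.exp (-Real.pi * qform (orth (c * Real.exp τ) ξ) a) =
    c ^ (-(Module.finrank ℚ K * s / 2)) * |(Algebra.norm ℚ a : ℝ)| ^ (-s) *
      dens s (logCoord K (τ, ξ) + logVec c a) := by
  have hN : 0 < |(Algebra.norm ℚ a : ℝ)| := by
    rw [abs_pos]; exact_mod_cast Algebra.norm_ne_zero_iff.mpr ha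
  rw [← Real.exp_add, Real.rpow_def_of_pos hc, Real.rpow_def_of_pos hN, ← Real.exp_add, dens,
    ← Real.exp_add]
  congr 1
  rw [Finset.sum_sub_distrib, ← Finset.mul_sum]
  simp only [Pi.add_apply, mul_add, Finset.sum_add_distrib, sum_logCoord, sum_logVec c ha]
  have : ∑ w : InfinitePlace K, Real.pi * w.mult * Real.exp (logCoord K (τ, ξ) w + logVec c a w) =
      Real.pi * qform (orth (c * Real.exp τ) ξ) a := by
    rw [qform, Finset.mul_sum]
    refine Finset.sum_congr rfl fun w _ ↦ ?_
    have hw : 0 < w a := InfinitePlace.pos_iff.mpr ha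
    rw [orth, logCoord, logVec, Real.exp_add, Real.exp_add, Real.exp_add, Real.exp_log hc,
      two_mul (Real.log _), Real.exp_add, Real.exp_log hw]
    ring
  rw [this]
  ring

instance (J : (FractionalIdeal (𝓞 K)⁰ K)ˣ) : Countable (Elts J) := by
  obtain ⟨e, -⟩ := exists_coordinates J (y := fun _ ↦ 1) (by simp)
  exact e.injective.countable

lemma lintegral_Ioi_eq (g : ℝ → ℝ≥0∞) :
    ∫⁻ t in Set.Ioi 0, g t = ∫⁻ τ : ℝ, ENNReal.ofReal (Real.exp τ) * g (Real.exp τ) := by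
  have := lintegral_image_eq_lintegral_abs_deriv_mul (s := Set.univ) MeasurableSet.univ
    (fun x _ ↦ (Real.hasDerivAt_exp x).hasDerivWithinAt) Real.exp_injective.injOn g
  rw [Set.image_univ, Real.range_exp] at this
  simpa using this

lemma lintegral_thetaN_sub (J : (FractionalIdeal (𝓞 K)⁰ K)ˣ) (s : ℝ) :
    ∫⁻ t in Set.Ioi (0 : ℝ), ENNReal.ofReal
        (t ^ (Module.finrank ℚ K * s / 2 - 1) * (thetaN J t - unitVol K)) =
      ∑' a : {a : Elts J // (a : K) ≠ 0},
        ENNReal.ofReal (adisc J ^ (s / 2) * |(Algebra.norm ℚ (a : K) : ℝ)| ^ (-s)) *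
        ∫⁻ τ : ℝ, ∫⁻ ξ in fundDom K, ENNReal.ofReal (dens s (logCoord K (τ, ξ) +
          logVec (adisc J ^ (-(1 / Module.finrank ℚ K : ℝ))) (a : K))) := by
  have hd : (Module.finrank ℚ K : ℝ) ≠ 0 := by exact_mod_cast Module.finrank_pos.ne'
  have hJ := adisc_pos J
  have hc := Real.rpow_pos_of_pos hJ (-(1 / Module.finrank ℚ K : ℝ))
  have hcs : (adisc J ^ (-(1 / Module.finrank ℚ K : ℝ))) ^ (-(Module.finrank ℚ K * s / 2)) =
      adisc J ^ (s / 2) := by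
    rw [← Real.rpow_mul hJ.le]; congr 1; field_simp
  set c := adisc J ^ (-(1 / Module.finrank ℚ K : ℝ)) with hcd
  have hmeas (a : K) : Measurable fun p : ℝ × logSpace K ↦
      ENNReal.ofReal (dens s (logCoord K p + logVec c a)) := by
    have := (continuous_dens (K := K) s).comp
      ((continuous_logCoord (K := K)).add (continuous_const (y := logVec c a)))
    exact (ENNReal.continuous_ofReal.comp this).measurable
  have key (τ : ℝ) : ENNReal.ofReal (Real.exp τ) * ENNReal.ofReal
      (Real.exp τ ^ (Module.finrank ℚ K * s / 2 - 1) * (thetaN J (Real.exp τ) - unitVol K)) =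
      ∑' a : {a : Elts J // (a : K) ≠ 0},
        ENNReal.ofReal (adisc J ^ (s / 2) * |(Algebra.norm ℚ (a : K) : ℝ)| ^ (-s)) *
        ∫⁻ ξ in fundDom K, ENNReal.ofReal (dens s (logCoord K (τ, ξ) + logVec c (a : K))) := by
    have hτ : 0 < c * Real.exp τ := by positivity
    rw [← ENNReal.ofReal_mul (Real.exp_pos _).le, ← mul_assoc]
    have e1 : Real.exp τ * Real.exp τ ^ (Module.finrank ℚ K * s / 2 - 1) =
        Real.exp (Module.finrank ℚ K * s / 2 * τ) := by
      rw [← Real.exp_mul, ← Real.exp_add]; congr 1; ring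
    rw [e1, thetaN, thetaInt_sub J hτ, ← integral_const_mul, ofReal_integral_eq_lintegral_ofReal]
    · have e2 (ξ : logSpace K) : ENNReal.ofReal (Real.exp (Module.finrank ℚ K * s / 2 * τ) *
          (theta J (orth (c * Real.exp τ) ξ) - 1)) = ∑' a : {a : Elts J // (a : K) ≠ 0},
          ENNReal.ofReal (adisc J ^ (s / 2) * |(Algebra.norm ℚ (a : K) : ℝ)| ^ (-s)) *
          ENNReal.ofReal (dens s (logCoord K (τ, ξ) + logVec c (a : K))) := by
        have hs : Summable fun a : {a : Elts J // (a : K) ≠ 0} ↦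
            Real.exp (Module.finrank ℚ K * s / 2 * τ) *
              Real.exp (-Real.pi * qform (orth (c * Real.exp τ) ξ) (a : K)) :=
          ((summable_exp_qform J fun w ↦ orth_pos hτ ξ w).subtype _).mul_left _
        rw [theta_sub_one J fun w ↦ orth_pos hτ ξ w, ← tsum_mul_left,
          ENNReal.ofReal_tsum_of_nonneg (fun _ ↦ (mul_pos (Real.exp_pos _) (Real.exp_pos _)).le) hs]
        refine tsum_congr fun a ↦ ?_
        rw [← hcs, ← ENNReal.ofReal_mul (by positivity), exp_mul_exp_qform hc a.2]
      have hm (a : {a : Elts J // (a : K) ≠ 0}) : Measurable fun ξ : logSpace K ↦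
          ENNReal.ofReal (dens s (logCoord K (τ, ξ) + logVec c (a : K))) :=
        (hmeas _).comp measurable_prodMk_left
      simp_rw [e2]
      rw [lintegral_tsum fun a ↦ (hm a).aemeasurable.const_mul _]
      exact tsum_congr fun a ↦ lintegral_const_mul _ (hm a)
    · exact (((integrableOn_theta_orth J hτ)).sub
        (integrableOn_const volume_fundDom_lt_top.ne)).const_mul _
    · exact ae_of_all _ fun ξ ↦ mul_nonneg (Real.exp_pos _).le
        (theta_sub_one_nonneg J fun w ↦ orth_pos hτ ξ w)
  rw [lintegral_Ioi_eq]
  simp_rw [key]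
  rw [lintegral_tsum fun a ↦ ((hmeas _).lintegral_prod_right').aemeasurable.const_mul _]
  exact tsum_congr fun a ↦ lintegral_const_mul _ (hmeas _).lintegral_prod_right'

lemma tsum_units_logEmbedding (g : logSpace K → ℝ≥0∞) :
    ∑' u : (𝓞 K)ˣ, g (logEmbedding K (Additive.ofMul u)) =
      (torsionOrder K : ℝ≥0∞) * ∑' x : unitLattice K, g x := by
  let f : (𝓞 K)ˣ → unitLattice K := fun u ↦
    logEmbeddingEquiv K (Additive.ofMul (QuotientGroup.mk u))
  have hf : ∀ u, (f u : logSpace K) = logEmbedding K (Additive.ofMul u) := fun u ↦ by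
    simp only [f, logEmbeddingEquiv_apply]
  rw [← (Equiv.sigmaFiberEquiv f).tsum_eq, ENNReal.tsum_sigma', ← ENNReal.tsum_mul_left]
  refine tsum_congr fun x ↦ ?_
  have h1 : ∀ u : {u // f u = x}, g (logEmbedding K (Additive.ofMul
      (Equiv.sigmaFiberEquiv f ⟨x, u⟩))) = g x := fun u ↦ by
    rw [Equiv.sigmaFiberEquiv_apply, ← hf, u.2]
  simp_rw [h1]
  obtain ⟨u₀, rfl⟩ : ∃ u₀, f u₀ = x := by
    obtain ⟨q, rfl⟩ := (logEmbeddingEquiv K).surjective x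
    obtain ⟨u, hu⟩ := QuotientGroup.mk_surjective q.toMul
    exact ⟨u, by simp only [f, hu]; rfl⟩
  have e : {u // f u = f u₀} ≃ torsion K :=
    { toFun := fun u ↦ ⟨u.1 * u₀⁻¹, by
        rw [← logEmbedding_eq_zero_iff, ofMul_mul, map_add, ofMul_inv, map_neg, ← hf, ← hf, u.2,
          add_neg_cancel]⟩
      invFun := fun z ↦ ⟨z.1 * u₀, by
        rw [← Subtype.coe_inj, hf, hf, ofMul_mul, map_add, logEmbedding_eq_zero_iff.mpr z.2,
          zero_add]⟩
      left_inv := fun u ↦ by simp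
      right_inv := fun u ↦ by simp }
  have := Fintype.ofFinite (torsion K)
  rw [← e.symm.tsum_eq, tsum_fintype, Finset.sum_const, Finset.card_univ, nsmul_eq_mul,
    torsionOrder, Nat.card_eq_fintype_card]

lemma tsum_units_lintegral_dens (c s : ℝ) {a : K} (ha : a ≠ 0) (τ : ℝ) :
    ∑' u : (𝓞 K)ˣ, ∫⁻ ξ in fundDom K, ENNReal.ofReal (dens s (logCoord K (τ, ξ) +
        logVec c ((u : K) * a))) =
      (torsionOrder K : ℝ≥0∞) *
        ∫⁻ ξ, ENNReal.ofReal (dens s (logCoord K (τ, ξ) + logVec c a)) := by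
  have h (u : (𝓞 K)ˣ) (ξ : logSpace K) : logCoord K (τ, ξ) + logVec c ((u : K) * a) =
      logCoord K (τ, logEmbedding K (Additive.ofMul u) + ξ) + logVec c a := by
    ext w
    have h1 : w (u : K) ≠ 0 := (Units.pos_at_place u w).ne'
    have h2 : w a ≠ 0 := by simpa using ha
    rw [Pi.add_apply, Pi.add_apply, logCoord_logEmbedding_add, logVec, logVec, map_mul,
      Real.log_mul h1 h2]
    ring
  simp_rw [h]
  rw [tsum_units_logEmbedding (fun x ↦ ∫⁻ ξ in fundDom K,
    ENNReal.ofReal (dens s (logCoord K (τ, x + ξ) + logVec c a))),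
    isAddFundamentalDomain_fundDom.lintegral_eq_tsum''
    (fun ξ ↦ ENNReal.ofReal (dens s (logCoord K (τ, ξ) + logVec c a)))]
  rfl

end LargeStrip

namespace LargeStrip

open scoped nonZeroDivisors ENNReal
open NumberField.Units NumberField.Units.dirichletUnitTheorem

variable {K : Type*} [Field K] [NumberField K]

variable (K) in
lemma exists_lintegral_logCoord : ∃ κ : ℝ, 0 < κ ∧ ∀ f : (InfinitePlace K → ℝ) → ℝ≥0∞,
    Measurable f → ∫⁻ τ : ℝ, ∫⁻ ξ : logSpace K, f (logCoord K (τ, ξ)) =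
      ENNReal.ofReal κ * ∫⁻ x, f x := by
  let L : ℝ × logSpace K →ₗ[ℝ] (InfinitePlace K → ℝ) :=
    { toFun := logCoord K
      map_add' := fun p q ↦ by ext w; simp only [logCoord, Pi.add_apply, Prod.snd_add,
        Prod.fst_add, ell_add]; ring
      map_smul' := fun c p ↦ by
        ext w
        have : ell (c • p.2) w = c * ell p.2 w := by
          unfold ell
          split_ifs
          · simp [Finset.mul_sum]
          · rfl
        simp only [logCoord, Pi.smul_apply, Prod.smul_snd, Prod.smul_fst, this, smul_eq_mul,
          RingHom.id_apply]
        ring }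
  have hinj : Function.Injective L := by
    rw [← LinearMap.ker_eq_bot, LinearMap.ker_eq_bot']
    rintro ⟨τ, ξ⟩ h
    have hw (w : InfinitePlace K) : logCoord K (τ, ξ) w = 0 := congrFun h w
    have hd : (Module.finrank ℚ K : ℝ) ≠ 0 := by exact_mod_cast Module.finrank_pos.ne'
    have h1 := sum_logCoord (τ, ξ)
    simp only [hw, mul_zero, Finset.sum_const_zero, zero_eq_mul, hd, false_or] at h1
    refine Prod.ext h1 (funext fun v ↦ ?_)
    have h2 := hw v
    have h0 := InfinitePlace.mult_coe_ne_zero (w := v.1)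
    rw [logCoord, h1, ell_of_ne] at h2
    simpa [h0] using h2
  have hrank : Module.finrank ℝ (ℝ × logSpace K) = Module.finrank ℝ (InfinitePlace K → ℝ) := by
    rw [Module.finrank_prod, NumberField.Units.finrank_eq_rank, Module.finrank_self,
      Module.finrank_fintype_fun_eq_card, rank]
    have := Fintype.card_pos (α := InfinitePlace K)
    omega
  let e : (ℝ × logSpace K) ≃L[ℝ] (InfinitePlace K → ℝ) :=
    (LinearEquiv.ofInjectiveOfFinrankEq L hinj hrank).toContinuousLinearEquiv
  have he (p) : e p = logCoord K p := rfl
  have : (volume : Measure (ℝ × logSpace K)).IsAddHaarMeasure :=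
    Measure.prod.instIsAddHaarMeasure volume volume
  have : (Measure.map e volume).IsAddHaarMeasure := e.isAddHaarMeasure_map volume
  have hm := Measure.isAddLeftInvariant_eq_smul (Measure.map e volume)
    (volume : Measure (InfinitePlace K → ℝ))
  refine ⟨Measure.addHaarScalarFactor (Measure.map e volume) volume, ?_, fun f hf ↦ ?_⟩
  · exact_mod_cast Measure.addHaarScalarFactor_pos_of_isAddHaarMeasure _ _
  · rw [← lintegral_prod (fun p ↦ f (logCoord K p))
      (hf.comp continuous_logCoord.measurable).aemeasurable, ← Measure.volume_eq_prod,
      ENNReal.ofReal_coe_nnreal, ← smul_eq_mul, ← lintegral_smul_measure]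
    change _ = ∫⁻ x, f x ∂(Measure.addHaarScalarFactor (Measure.map e volume) volume • volume)
    rw [← hm, lintegral_map hf e.continuous.measurable]
    rfl

lemma integral_exp_mul_sub {a r : ℝ} (ha : 0 < a) (hr : 0 < r) :
    Integrable (fun x : ℝ ↦ Real.exp (a * x - r * Real.exp x)) ∧
    ∫ x : ℝ, Real.exp (a * x - r * Real.exp x) = r ^ (-a) * Real.Gamma a := by
  have h0 : Set.Ioi (0 : ℝ) = Real.exp '' Set.univ := by rw [Set.image_univ, Real.range_exp]
  have h1 (x : ℝ) : |Real.exp x| • (Real.exp x ^ (a - 1) * Real.exp (-(r * Real.exp x))) =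
      Real.exp (a * x - r * Real.exp x) := by
    rw [abs_of_pos (Real.exp_pos x), ← Real.exp_mul, ← Real.exp_add, smul_eq_mul, ← Real.exp_add]
    congr 1
    ring
  have hd : ∀ x ∈ Set.univ, HasDerivWithinAt Real.exp (Real.exp x) Set.univ x :=
    fun x _ ↦ (Real.hasDerivAt_exp x).hasDerivWithinAt
  have h2 : IntegrableOn (fun t : ℝ ↦ t ^ (a - 1) * Real.exp (-(r * t))) (Set.Ioi 0) := by
    simpa using integrableOn_rpow_mul_exp_neg_mul_rpow (p := 1) (s := a - 1) (b := r)
      (by linarith) one_pos hr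
  constructor
  · rw [h0, integrableOn_image_iff_integrableOn_abs_deriv_smul MeasurableSet.univ hd
      Real.exp_injective.injOn] at h2
    simpa only [h1, integrableOn_univ] using h2
  · have h3 := Real.integral_rpow_mul_exp_neg_mul_Ioi ha hr
    rw [h0, integral_image_eq_integral_abs_deriv_smul MeasurableSet.univ hd
      Real.exp_injective.injOn] at h3
    simp only [h1, setIntegral_univ] at h3
    rw [h3, one_div, Real.inv_rpow hr.le, Real.rpow_neg hr.le]

/-- The archimedean factor of the completed zeta function. -/
lemma lintegral_dens {s : ℝ} (hs : 0 < s) :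
    ∫⁻ x, ENNReal.ofReal (dens (K := K) s x) = ENNReal.ofReal (∏ w : InfinitePlace K,
      ((Real.pi * w.mult) ^ (-(s / 2 * w.mult)) * Real.Gamma (s / 2 * w.mult))) := by
  have hp (w : InfinitePlace K) : 0 < (w.mult : ℝ) := by exact_mod_cast w.mult_pos
  have h (w : InfinitePlace K) := integral_exp_mul_sub (a := s / 2 * w.mult)
    (r := Real.pi * w.mult) (by have := hp w; positivity) (by have := hp w; positivity)
  let g (w : InfinitePlace K) (x : ℝ) : ℝ :=
    Real.exp (s / 2 * w.mult * x - Real.pi * w.mult * Real.exp x)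
  have hd : dens (K := K) s = fun x ↦ ∏ w, g w (x w) := by
    ext x
    rw [dens, Real.exp_sum]
    exact Finset.prod_congr rfl fun w _ ↦ by rw [← mul_assoc]
  have hint : Integrable (fun x : InfinitePlace K → ℝ ↦ ∏ w, g w (x w)) :=
    Integrable.fintype_prod fun w ↦ (h w).1
  rw [hd, ← ofReal_integral_eq_lintegral_ofReal hint
    (ae_of_all _ fun x ↦ Finset.prod_nonneg fun w _ ↦ (Real.exp_pos _).le),
    integral_fintype_prod_volume_eq_prod g]
  exact congrArg _ (Finset.prod_congr rfl fun w _ ↦ (h w).2)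

end LargeStrip

namespace LargeStrip

open scoped nonZeroDivisors ENNReal
open NumberField.Units NumberField.Units.dirichletUnitTheorem FractionalIdeal

variable {K : Type*} [Field K] [NumberField K]

lemma classGroup_mk_eq_one_iff {J : (FractionalIdeal (𝓞 K)⁰ K)ˣ} :
    ClassGroup.mk K J = 1 ↔ ∃ x : K, x ≠ 0 ∧ spanSingleton (𝓞 K)⁰ x = J := by
  rw [ClassGroup.mk_eq_one_iff]
  constructor
  · rintro ⟨x, hx⟩
    have h : spanSingleton (𝓞 K)⁰ x = J := by
      rw [← coeToSubmodule_inj, coe_spanSingleton]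
      exact hx.symm
    refine ⟨x, ?_, h⟩
    rintro rfl
    exact J.ne_zero (by rw [← h, spanSingleton_zero])
  · rintro ⟨x, -, hx⟩
    exact ⟨x, by rw [← hx, coe_spanSingleton]⟩

lemma mem_of_mul_eq {J : (FractionalIdeal (𝓞 K)⁰ K)ˣ} {I : Ideal (𝓞 K)} {a : K}
    (h : (I : FractionalIdeal (𝓞 K)⁰ K) * J = spanSingleton (𝓞 K)⁰ a) :
    a ∈ (J : FractionalIdeal (𝓞 K)⁰ K) := by
  rw [← spanSingleton_le_iff_mem (S := (𝓞 K)⁰), ← h]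
  exact (mul_le_mul_left coeIdeal_le_one _).trans_eq (one_mul _)

/-- The nonzero elements of representatives of the ideal classes, grouped by the integral ideals
they define. -/
lemma tsum_elts_eq_tsum_ideals {J : ClassGroup (𝓞 K) → (FractionalIdeal (𝓞 K)⁰ K)ˣ}
    (hJ : Function.Bijective fun c ↦ ClassGroup.mk K (J c)) (F : ClassGroup (𝓞 K) → K → ℝ≥0∞)
    (G : {I : Ideal (𝓞 K) // I ≠ ⊥} → ℝ≥0∞)
    (h : ∀ c a, a ≠ 0 → ∀ I : {I : Ideal (𝓞 K) // I ≠ ⊥},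
      ((I : Ideal (𝓞 K)) : FractionalIdeal (𝓞 K)⁰ K) * (J c : FractionalIdeal (𝓞 K)⁰ K) =
        spanSingleton (𝓞 K)⁰ a →
      ∑' u : (𝓞 K)ˣ, F c ((u : K) * a) = G I) :
    ∑' c, ∑' a : {a : Elts (J c) // (a : K) ≠ 0}, F c (a : K) = ∑' I, G I := by
  have hΦ : ∀ x : Σ c, {a : Elts (J c) // (a : K) ≠ 0}, ∃ I : {I : Ideal (𝓞 K) // I ≠ ⊥},
      ((I : Ideal (𝓞 K)) : FractionalIdeal (𝓞 K)⁰ K) * J x.1 =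
        spanSingleton (𝓞 K)⁰ (x.2 : K) := by
    rintro ⟨c, ⟨a, ha⟩, ha0⟩
    have h1 : spanSingleton (𝓞 K)⁰ a * ((J c)⁻¹ : (FractionalIdeal (𝓞 K)⁰ K)ˣ) ≤ 1 := by
      rw [← (J c).mul_inv]
      exact mul_le_mul_left (spanSingleton_le_iff_mem.mpr ha) _
    obtain ⟨I, hI⟩ := le_one_iff_exists_coeIdeal.mp h1
    have h2 : (I : FractionalIdeal (𝓞 K)⁰ K) * J c = spanSingleton (𝓞 K)⁰ a := by
      rw [hI, Units.inv_mul_cancel_right]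
    refine ⟨⟨I, ?_⟩, h2⟩
    rintro rfl
    rw [coeIdeal_bot, zero_mul] at h2
    exact ha0 (spanSingleton_eq_zero_iff.mp h2.symm)
  choose Φ hΦ using hΦ
  have hinj {I I' : {I : Ideal (𝓞 K) // I ≠ ⊥}} (c : ClassGroup (𝓞 K))
      (h : ((I : Ideal (𝓞 K)) : FractionalIdeal (𝓞 K)⁰ K) * J c = (I' : Ideal (𝓞 K)) * J c) :
      I = I' :=
    Subtype.ext (coeIdeal_injective ((J c).isUnit.mul_right_cancel h))
  have hcls {I : {I : Ideal (𝓞 K) // I ≠ ⊥}} {c : ClassGroup (𝓞 K)} {a : K} (ha : a ≠ 0)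
      (h : ((I : Ideal (𝓞 K)) : FractionalIdeal (𝓞 K)⁰ K) * J c = spanSingleton (𝓞 K)⁰ a) :
      ClassGroup.mk K (Units.mk0 _ (coeIdeal_ne_zero.mpr I.2)) * ClassGroup.mk K (J c) = 1 := by
    rw [← map_mul, classGroup_mk_eq_one_iff]
    exact ⟨a, ha, h.symm⟩
  rw [← ENNReal.tsum_sigma' (fun x : Σ c, {a : Elts (J c) // (a : K) ≠ 0} ↦ F x.1 (x.2 : K)),
    ← (Equiv.sigmaFiberEquiv Φ).tsum_eq, ENNReal.tsum_sigma']
  refine tsum_congr fun I ↦ ?_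
  obtain ⟨c, hc⟩ := hJ.2 (ClassGroup.mk K (Units.mk0 _ (coeIdeal_ne_zero.mpr I.2)))⁻¹
  obtain ⟨a, ha, hIa⟩ : ∃ a : K, a ≠ 0 ∧ spanSingleton (𝓞 K)⁰ a =
      ((I : Ideal (𝓞 K)) : FractionalIdeal (𝓞 K)⁰ K) * J c := by
    have : ClassGroup.mk K (Units.mk0 _ (coeIdeal_ne_zero.mpr I.2) * J c) = 1 := by
      rw [map_mul]; simp only at hc; rw [hc, mul_inv_cancel]
    exact classGroup_mk_eq_one_iff.mp this
  rw [← h c a ha I hIa.symm]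
  have hua (u : (𝓞 K)ˣ) : spanSingleton (𝓞 K)⁰ ((u : K) * a) = spanSingleton (𝓞 K)⁰ a := by
    rw [eq_comm, spanSingleton_eq_spanSingleton]
    exact ⟨u, rfl⟩
  have hu0 (u : (𝓞 K)ˣ) : (u : K) ≠ 0 := Units.coe_ne_zero u
  let f : (𝓞 K)ˣ → {x : Σ c, {a : Elts (J c) // (a : K) ≠ 0} // Φ x = I} := fun u ↦
    ⟨⟨c, ⟨(u : K) * a, mem_of_mul_eq (hIa.symm.trans (hua u).symm)⟩, mul_ne_zero (hu0 u) ha⟩,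
      hinj c ((hΦ _).trans ((hua u).trans hIa))⟩
  have hf : Function.Bijective f := by
    constructor
    · intro u v huv
      have h1 : (⟨c, ⟨(u : K) * a, _⟩, _⟩ : Σ c, {a : Elts (J c) // (a : K) ≠ 0}) =
          ⟨c, ⟨(v : K) * a, _⟩, _⟩ := congrArg Subtype.val huv
      simp only [Sigma.mk.injEq, heq_eq_eq, true_and, Subtype.mk.injEq] at h1
      exact Units.coe_injective K (mul_right_cancel₀ ha h1)
    · rintro ⟨⟨c', ⟨b, hb⟩, hb0⟩, hx⟩
      have h1 := hΦ ⟨c', ⟨b, hb⟩, hb0⟩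
      rw [hx] at h1
      obtain rfl : c = c' := hJ.1 (mul_left_cancel ((hcls ha hIa.symm).trans (hcls hb0 h1).symm))
      obtain ⟨u, hu⟩ := spanSingleton_eq_spanSingleton.mp (hIa.trans h1)
      refine ⟨u, Subtype.ext ?_⟩
      simp only [f, Sigma.mk.injEq, heq_eq_eq, true_and, Subtype.mk.injEq]
      exact hu
  rw [← (Equiv.ofBijective f hf).tsum_eq]
  rfl

variable (K) in
/-- The archimedean factor of the completed zeta function. -/
def archFactor (s : ℝ) : ℝ :=
  |(discr K : ℝ)| ^ (s / 2) * ∏ w : InfinitePlace K,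
      ((Real.pi * w.mult) ^ (-(s / 2 * w.mult)) * Real.Gamma (s / 2 * w.mult))

lemma archFactor_pos {s : ℝ} (hs : 0 < s) : 0 < archFactor K s := by
  have hΔ : (discr K : ℝ) ≠ 0 := by exact_mod_cast discr_ne_zero K
  refine mul_pos (Real.rpow_pos_of_pos (abs_pos.mpr hΔ) _) (Finset.prod_pos fun w _ ↦ ?_)
  have hw : 0 < (w.mult : ℝ) := by exact_mod_cast w.mult_pos
  exact mul_pos (Real.rpow_pos_of_pos (by positivity) _) (Real.Gamma_pos_of_pos (by positivity))

variable (K) in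
lemma exists_sum_lintegral_thetaN : ∃ κ : ℝ, 0 < κ ∧
    ∀ J : ClassGroup (𝓞 K) → (FractionalIdeal (𝓞 K)⁰ K)ˣ,
    (Function.Bijective fun c ↦ ClassGroup.mk K (J c)) → ∀ s : ℝ, 0 < s →
    ∑' c, ∫⁻ t in Set.Ioi (0 : ℝ), ENNReal.ofReal
        (t ^ (Module.finrank ℚ K * s / 2 - 1) * (thetaN (J c) t - unitVol K)) =
      ENNReal.ofReal (κ * archFactor K s) * ∑' I : {I : Ideal (𝓞 K) // I ≠ ⊥},
        ENNReal.ofReal ((Ideal.absNorm (I : Ideal (𝓞 K)) : ℝ) ^ (-s)) := by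
  obtain ⟨κ, hκ, hfub⟩ := exists_lintegral_logCoord K
  refine ⟨torsionOrder K * κ, mul_pos (by exact_mod_cast (torsionOrder_pos K)) hκ,
    fun J hJ s hs ↦ ?_⟩
  simp_rw [lintegral_thetaN_sub, ← ENNReal.tsum_mul_left]
  refine tsum_elts_eq_tsum_ideals hJ (fun c a ↦
    ENNReal.ofReal (adisc (J c) ^ (s / 2) * |(Algebra.norm ℚ a : ℝ)| ^ (-s)) *
        ∫⁻ τ : ℝ, ∫⁻ ξ in fundDom K, ENNReal.ofReal (dens s (logCoord K (τ, ξ) +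
          logVec (adisc (J c) ^ (-(1 / Module.finrank ℚ K : ℝ))) a))) _ fun c a ha I hI ↦ ?_
  set v := adisc (J c) ^ (-(1 / Module.finrank ℚ K : ℝ)) with hv
  have hN (u : (𝓞 K)ˣ) : |(Algebra.norm ℚ ((u : K) * a) : ℝ)| = |(Algebra.norm ℚ a : ℝ)| := by
    rw [map_mul, Rat.cast_mul, abs_mul]
    have : |(Algebra.norm ℚ (u : K) : ℝ)| = 1 := by
      rw [← Rat.cast_abs]
      exact_mod_cast NumberField.Units.norm K u
    rw [this, one_mul]
  have hmeas (b : K) : Measurable fun p : ℝ × logSpace K ↦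
      ENNReal.ofReal (dens s (logCoord K p + logVec v b)) := by
    have := (continuous_dens (K := K) s).comp
      ((continuous_logCoord (K := K)).add (continuous_const (y := logVec v b)))
    exact (ENNReal.continuous_ofReal.comp this).measurable
  simp_rw [hN]
  have hm (u : (𝓞 K)ˣ) : Measurable fun τ : ℝ ↦ ∫⁻ ξ in fundDom K, ENNReal.ofReal
      (dens s (logCoord K (τ, ξ) + logVec v ((u : K) * a))) := (hmeas _).lintegral_prod_right'
  have hm' : Measurable fun τ : ℝ ↦ ∫⁻ ξ, ENNReal.ofReal
      (dens s (logCoord K (τ, ξ) + logVec v a)) := (hmeas _).lintegral_prod_right'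
  have hmd : Measurable fun x : InfinitePlace K → ℝ ↦ ENNReal.ofReal (dens s x) :=
    (ENNReal.continuous_ofReal.comp (continuous_dens s)).measurable
  have : Countable (𝓞 K)ˣ := Function.Injective.countable
    (β := Elts (1 : (FractionalIdeal (𝓞 K)⁰ K)ˣ))
    (f := fun u ↦ ⟨(u : K), (mem_one_iff _).mpr ⟨u, rfl⟩⟩)
    fun u v huv ↦ Units.coe_injective K (Subtype.mk.inj huv)
  rw [ENNReal.tsum_mul_left, ← lintegral_tsum fun u ↦ (hm u).aemeasurable]
  simp_rw [tsum_units_lintegral_dens v s ha]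
  rw [lintegral_const_mul _ hm',
    hfub (fun x ↦ ENNReal.ofReal (dens s (x + logVec v a)))
      (hmd.comp (measurable_id.add_const _)),
    lintegral_add_right_eq_self (fun x ↦ ENNReal.ofReal (dens s x)), lintegral_dens hs]
  have hI' : (Ideal.absNorm (I : Ideal (𝓞 K)) : ℝ) *
      (FractionalIdeal.absNorm (J c : FractionalIdeal (𝓞 K)⁰ K) : ℝ) =
        |(Algebra.norm ℚ a : ℝ)| := by
    have := congrArg FractionalIdeal.absNorm hI
    rw [map_mul, coeIdeal_absNorm, absNorm_span_singleton] at this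
    rw [← Rat.cast_abs, ← this]
    push_cast
    rfl
  have hIpos : 0 < (Ideal.absNorm (I : Ideal (𝓞 K)) : ℝ) := by
    exact_mod_cast Nat.pos_of_ne_zero (Ideal.absNorm_eq_zero_iff.not.mpr I.2)
  have hJpos := absNorm_pos (J c)
  have h1 : adisc (J c) ^ (s / 2) * |(Algebra.norm ℚ a : ℝ)| ^ (-s) =
      |(discr K : ℝ)| ^ (s / 2) * (Ideal.absNorm (I : Ideal (𝓞 K)) : ℝ) ^ (-s) := by
    rw [← hI', adisc, Real.mul_rpow (abs_nonneg _) (by positivity),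
      Real.mul_rpow hIpos.le hJpos.le, ← Real.rpow_natCast, ← Real.rpow_mul hJpos.le]
    push_cast
    rw [mul_div_cancel₀ _ two_ne_zero, Real.rpow_neg hJpos.le]
    field_simp
  have hA := archFactor_pos (K := K) hs
  rw [h1, ← ENNReal.ofReal_natCast, ← ENNReal.ofReal_mul hκ.le,
    ← ENNReal.ofReal_mul (by positivity), ← ENNReal.ofReal_mul (by positivity),
    ← ENNReal.ofReal_mul (by positivity)]
  congr 1
  rw [archFactor]
  ring

end LargeStrip

namespace LargeStrip

open scoped nonZeroDivisors ENNReal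
open NumberField.Units NumberField.Units.dirichletUnitTheorem FractionalIdeal

variable {K : Type*} [Field K] [NumberField K]

lemma thetaN_sub_nonneg (J : (FractionalIdeal (𝓞 K)⁰ K)ˣ) {t : ℝ} (ht : 0 < t) :
    0 ≤ thetaN J t - unitVol K := by
  have h : 0 < adisc J ^ (-(1 / Module.finrank ℚ K : ℝ)) * t :=
    mul_pos (Real.rpow_pos_of_pos (adisc_pos J) _) ht
  rw [thetaN, thetaInt_sub J h]
  exact integral_nonneg fun ξ ↦ theta_sub_one_nonneg J fun w ↦ orth_pos h ξ w

/-- The theta function of a family of fractional ideals. -/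
def thetaSum (J : ClassGroup (𝓞 K) → (FractionalIdeal (𝓞 K)⁰ K)ˣ) (t : ℝ) : ℂ :=
  ∑ c, (thetaN (J c) t : ℂ)

variable (K) in
/-- The constant term of `thetaSum`. -/
def thetaConst : ℂ := ∑ _c : ClassGroup (𝓞 K), (unitVol K : ℂ)

lemma thetaConst_ne_zero : thetaConst K ≠ 0 := by
  have := (unitVol_pos (K := K)).ne'
  simp [thetaConst, this]

lemma thetaSum_sub (J : ClassGroup (𝓞 K) → (FractionalIdeal (𝓞 K)⁰ K)ˣ) (t : ℝ) :
    thetaSum J t - thetaConst K = ∑ c, ((thetaN (J c) t - unitVol K : ℝ) : ℂ) := by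
  simp [thetaSum, thetaConst]

/-- The Mellin pair of a family of fractional ideals. -/
def thetaPair (J : ClassGroup (𝓞 K) → (FractionalIdeal (𝓞 K)⁰ K)ˣ) : WeakFEPair ℂ :=
  have hint (J : ClassGroup (𝓞 K) → (FractionalIdeal (𝓞 K)⁰ K)ˣ) :
      LocallyIntegrableOn (thetaSum J) (Set.Ioi 0) := by
    have h (c : ClassGroup (𝓞 K)) : LocallyIntegrableOn (fun t ↦ (thetaN (J c) t : ℂ))
        (Set.Ioi 0) := by
      rw [locallyIntegrableOn_iff isOpen_Ioi.isLocallyClosed]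
      intro k hk hkc
      exact (((thetaN_anti (J c)).mono hk).integrableOn_isCompact hkc).ofReal
    rw [locallyIntegrableOn_iff isOpen_Ioi.isLocallyClosed]
    intro k hk hkc
    exact integrable_finsetSum _ fun c _ ↦
      (locallyIntegrableOn_iff isOpen_Ioi.isLocallyClosed).mp (h c) k hk hkc
  have htop (J : ClassGroup (𝓞 K) → (FractionalIdeal (𝓞 K)⁰ K)ˣ) (r : ℝ) :
      (thetaSum J · - thetaConst K) =O[atTop] (· ^ r) := by
    simp_rw [thetaSum_sub]
    exact Asymptotics.IsBigO.fun_sum fun c _ ↦ (Asymptotics.IsBigO.of_norm_left (by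
      simpa only [Complex.norm_real] using (isBigO_thetaN_sub (J c) r).norm_left))
  { f := thetaSum J
    g := thetaSum fun c ↦ dualUnit (J c)
    k := Module.finrank ℚ K / 2
    ε := 1
    f₀ := thetaConst K
    g₀ := thetaConst K
    hf_int := hint _
    hg_int := hint _
    hk := half_pos (by exact_mod_cast Module.finrank_pos)
    hε := one_ne_zero
    h_feq := fun x hx ↦ by
      simp only [thetaSum, thetaN_one_div _ (Set.mem_Ioi.mp hx), one_mul, smul_eq_mul,
        Finset.mul_sum, Complex.ofReal_mul]
    hf_top := htop _
    hg_top := htop _ }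

variable (K) in
lemma exists_mellin_eq : ∃ κ : ℝ, 0 < κ ∧
    ∀ J : ClassGroup (𝓞 K) → (FractionalIdeal (𝓞 K)⁰ K)ˣ,
    (Function.Bijective fun c ↦ ClassGroup.mk K (J c)) → ∀ s : ℝ, 0 < s → ∀ L : ℂ,
    HasMellin (thetaSum J · - thetaConst K) (Module.finrank ℚ K * s / 2 : ℝ) L →
    (Summable fun I : {I : Ideal (𝓞 K) // I ≠ ⊥} ↦
      (Ideal.absNorm (I : Ideal (𝓞 K)) : ℝ) ^ (-s)) ∧
    L = (κ * archFactor K s * ∑' I : {I : Ideal (𝓞 K) // I ≠ ⊥},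
        (Ideal.absNorm (I : Ideal (𝓞 K)) : ℝ) ^ (-s) : ℝ) := by
  obtain ⟨κ, hκ, h⟩ := exists_sum_lintegral_thetaN K
  refine ⟨κ, hκ, fun J hJ s hs L hL ↦ ?_⟩
  specialize h J hJ s hs
  set w := Module.finrank ℚ K * s / 2 with hw
  let g (t : ℝ) : ℝ := ∑ c, t ^ (w - 1) * (thetaN (J c) t - unitVol K)
  have hg0 {t : ℝ} (ht : t ∈ Set.Ioi (0 : ℝ)) (c : ClassGroup (𝓞 K)) :
      0 ≤ t ^ (w - 1) * (thetaN (J c) t - unitVol K) :=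
    mul_nonneg (Real.rpow_nonneg (le_of_lt ht) _) (thetaN_sub_nonneg (J c) ht)
  have hg : Set.EqOn (fun t : ℝ ↦ (t : ℂ) ^ ((w : ℂ) - 1) • (thetaSum J t - thetaConst K))
      (fun t ↦ (g t : ℂ)) (Set.Ioi 0) := fun t ht ↦ by
    simp only [thetaSum_sub, smul_eq_mul, g, Finset.mul_sum, Complex.ofReal_sum,
      Complex.ofReal_mul, Complex.ofReal_cpow (le_of_lt (Set.mem_Ioi.mp ht)), Complex.ofReal_sub,
      Complex.ofReal_one]
  have hgint : IntegrableOn g (Set.Ioi 0) := by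
    have := (integrableOn_congr_fun hg measurableSet_Ioi).mp hL.1
    exact this.re
  have hLg : L = ((∫ t in Set.Ioi 0, g t : ℝ) : ℂ) := by
    rw [← hL.2, mellin, setIntegral_congr_fun measurableSet_Ioi hg]
    exact integral_ofReal
  have hmeas (c : ClassGroup (𝓞 K)) : AEMeasurable (fun t ↦ ENNReal.ofReal
      (t ^ (w - 1) * (thetaN (J c) t - unitVol K))) (volume.restrict (Set.Ioi 0)) := by
    refine ENNReal.measurable_ofReal.comp_aemeasurable (AEMeasurable.mul ?_ ?_)
    · exact (measurable_id.pow_const _).aemeasurable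
    · exact ((aemeasurable_restrict_of_antitoneOn measurableSet_Ioi
        (thetaN_anti (J c))).sub_const _)
  have h1 : ENNReal.ofReal (∫ t in Set.Ioi 0, g t) =
      ∑' c, ∫⁻ t in Set.Ioi (0 : ℝ), ENNReal.ofReal
        (t ^ (w - 1) * (thetaN (J c) t - unitVol K)) := by
    rw [ofReal_integral_eq_lintegral_ofReal hgint
      ((ae_restrict_mem measurableSet_Ioi).mono fun t ht ↦ Finset.sum_nonneg fun c _ ↦ hg0 ht c),
      tsum_fintype, ← lintegral_finsetSum' _ fun c _ ↦ hmeas c]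
    exact setLIntegral_congr_fun measurableSet_Ioi fun t ht ↦
      ENNReal.ofReal_sum_of_nonneg fun c _ ↦ hg0 ht c
  rw [h] at h1
  have hA := mul_pos hκ (archFactor_pos (K := K) hs)
  have hsum : Summable fun I : {I : Ideal (𝓞 K) // I ≠ ⊥} ↦
      (Ideal.absNorm (I : Ideal (𝓞 K)) : ℝ) ^ (-s) := by
    have h2 : ∑' I : {I : Ideal (𝓞 K) // I ≠ ⊥},
        ENNReal.ofReal ((Ideal.absNorm (I : Ideal (𝓞 K)) : ℝ) ^ (-s)) ≠ ⊤ := fun h3 ↦ by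
      rw [h3, ENNReal.mul_top (ENNReal.ofReal_pos.mpr hA).ne'] at h1
      exact ENNReal.ofReal_ne_top h1
    have h4 := ENNReal.summable_toReal h2
    refine h4.congr fun I ↦ ENNReal.toReal_ofReal (Real.rpow_nonneg (Nat.cast_nonneg _) _)
  refine ⟨hsum, ?_⟩
  rw [hLg]
  congr 1
  rw [← ENNReal.ofReal_tsum_of_nonneg (fun _ ↦ Real.rpow_nonneg (Nat.cast_nonneg _) _) hsum,
    ← ENNReal.ofReal_mul hA.le] at h1
  refine (ENNReal.ofReal_eq_ofReal_iff (setIntegral_nonneg measurableSet_Ioi fun t ht ↦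
    Finset.sum_nonneg fun c _ ↦ hg0 ht c) (mul_nonneg hA.le (tsum_nonneg fun _ ↦
      Real.rpow_nonneg (Nat.cast_nonneg _) _))).mp h1

end LargeStrip

namespace LargeStrip

open scoped nonZeroDivisors ENNReal
open NumberField.Units NumberField.Units.dirichletUnitTheorem FractionalIdeal

section Mellin

lemma exists_norm_mellin_le {f : ℝ → ℂ} (hf : ∀ s, MellinConvergent f s) (a b : ℝ) :
    ∃ M : ℝ, ∀ s : ℂ, a ≤ s.re → s.re ≤ b → ‖mellin f s‖ ≤ M := by
  have hn (s : ℂ) {t : ℝ} (ht : t ∈ Set.Ioi (0 : ℝ)) :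
      ‖(t : ℂ) ^ (s - 1) • f t‖ = t ^ (s.re - 1) * ‖f t‖ := by
    rw [norm_smul, Complex.norm_cpow_eq_rpow_re_of_pos ht, Complex.sub_re, Complex.one_re]
  have hi (c : ℝ) : IntegrableOn (fun t : ℝ ↦ t ^ (c - 1) * ‖f t‖) (Set.Ioi 0) := by
    have := (hf c).norm
    refine (integrableOn_congr_fun (fun t ht ↦ ?_) measurableSet_Ioi).mp this
    simpa using hn c ht
  refine ⟨∫ t in Set.Ioi (0 : ℝ), (t ^ (a - 1) * ‖f t‖ + t ^ (b - 1) * ‖f t‖), fun s ha hb ↦ ?_⟩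
  refine norm_integral_le_of_norm_le ((hi a).add (hi b))
    ((ae_restrict_mem measurableSet_Ioi).mono fun t ht ↦ ?_)
  have ht0 : (0 : ℝ) < t := ht
  rw [hn s ht, ← add_mul]
  refine mul_le_mul_of_nonneg_right ?_ (norm_nonneg _)
  rcases le_total 1 t with h | h
  · exact (Real.rpow_le_rpow_of_exponent_le h (by linarith)).trans
      (le_add_of_nonneg_left (Real.rpow_nonneg ht0.le _))
  · exact (Real.rpow_le_rpow_of_exponent_ge ht0 h (by linarith)).trans
      (le_add_of_nonneg_right (Real.rpow_nonneg ht0.le _))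

end Mellin

section Uniqueness

lemma frequently_ofReal {p : ℂ → Prop} (h : ∀ x : ℝ, 1 < x → p x) : ∃ᶠ z in 𝓝[≠] (2 : ℂ), p z := by
  have h1 : Tendsto (fun x : ℝ ↦ (x : ℂ)) (𝓝[>] 2) (𝓝[≠] 2) := by
    refine tendsto_nhdsWithin_iff.mpr ⟨?_, ?_⟩
    · exact (Complex.continuous_ofReal.tendsto' 2 2 (by simp)).mono_left nhdsWithin_le_nhds
    · filter_upwards [self_mem_nhdsWithin] with x hx
      simpa using (Complex.ofReal_injective.ne (Set.mem_Ioi.mp hx).ne')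
  refine h1.frequently (Eventually.frequently ?_)
  filter_upwards [self_mem_nhdsWithin] with x hx
  exact h x (by linarith [Set.mem_Ioi.mp hx])

lemma eqOn_of_eq_ofReal {f g : ℂ → ℂ} {S : Set ℂ} (hS : S.Countable) (hc : IsClosed S)
    (h2 : (2 : ℂ) ∉ S) (hf : DifferentiableOn ℂ f Sᶜ) (hg : DifferentiableOn ℂ g Sᶜ)
    (h : ∀ x : ℝ, 1 < x → f x = g x) : Set.EqOn f g Sᶜ :=
  (hf.analyticOnNhd hc.isOpen_compl).eqOn_of_preconnected_of_frequently_eq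
    (hg.analyticOnNhd hc.isOpen_compl)
    (hS.isConnected_compl_of_one_lt_rank (by simp)).isPreconnected h2
    (frequently_ofReal h)

end Uniqueness

variable {K : Type} [Field K] [NumberField K]

variable (K) in
/-- The reciprocal of the archimedean factor of the completed zeta function, an entire function. -/
def archInv (s : ℂ) : ℂ :=
  ((|(discr K : ℝ)| : ℝ) : ℂ) ^ (-(s / 2)) * ∏ w : InfinitePlace K,
      ((Real.pi * w.mult : ℝ) ^ (s / 2 * w.mult) * (Complex.Gamma (s / 2 * w.mult))⁻¹)

lemma differentiable_archInv : Differentiable ℂ (archInv K) := by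
  have hΔ : ((|(discr K : ℝ)| : ℝ) : ℂ) ≠ 0 := by
    simpa using discr_ne_zero K
  refine Differentiable.mul (fun s ↦ ?_) (Differentiable.fun_finsetProd fun w _ ↦ ?_)
  · exact (differentiableAt_id.div_const 2).neg.const_cpow (Or.inl hΔ)
  · have hw : ((Real.pi * w.mult : ℝ) : ℂ) ≠ 0 := by
      have : 0 < (w.mult : ℝ) := by exact_mod_cast w.mult_pos
      exact_mod_cast (by positivity : Real.pi * w.mult ≠ 0)
    have hd : Differentiable ℂ fun s : ℂ ↦ s / 2 * w.mult := by fun_prop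
    exact Differentiable.mul (fun s ↦ (hd s).const_cpow (Or.inl hw))
      (Complex.differentiable_one_div_Gamma.comp hd)

lemma archInv_ofReal (s : ℝ) : archInv K s = ((archFactor K s)⁻¹ : ℝ) := by
  rw [archFactor, mul_inv, ← Real.rpow_neg (abs_nonneg _), ← Finset.prod_inv_distrib, archInv,
    Complex.ofReal_mul, Complex.ofReal_cpow (abs_nonneg _), Complex.ofReal_prod]
  push_cast
  congr 1
  refine Finset.prod_congr rfl fun w _ ↦ ?_
  have hw : 0 < (w.mult : ℝ) := by exact_mod_cast w.mult_pos
  rw [mul_inv, ← Complex.ofReal_inv, ← Real.rpow_neg (by positivity), neg_neg,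
    Complex.ofReal_cpow (by positivity), ← Complex.Gamma_ofReal]
  push_cast
  rfl

lemma dedekindZeta_apply_ofReal {Z : ℂ → ℂ} (hZ : IsDedekindZeta K Z) {s : ℝ} (hs : 1 < s) :
    Z s = ((∑' I : {I : Ideal (𝓞 K) // I ≠ ⊥},
        (Ideal.absNorm (I : Ideal (𝓞 K)) : ℝ) ^ (-s) : ℝ) : ℂ) := by
  rw [hZ.2 s (by simpa using hs), Complex.ofReal_tsum]
  refine tsum_congr fun I ↦ ?_
  rw [Complex.ofReal_cpow (Nat.cast_nonneg _)]
  push_cast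
  rfl

variable (K) in
lemma exists_representatives : ∃ J : ClassGroup (𝓞 K) → (FractionalIdeal (𝓞 K)⁰ K)ˣ,
    (Function.Bijective fun c ↦ ClassGroup.mk K (J c)) ∧
    Function.Bijective fun c ↦ ClassGroup.mk K (dualUnit (J c)) := by
  have hsurj (c : ClassGroup (𝓞 K)) : ∃ J : (FractionalIdeal (𝓞 K)⁰ K)ˣ, ClassGroup.mk K J = c := by
    obtain ⟨I, rfl⟩ := ClassGroup.mk0_surjective c
    exact ⟨FractionalIdeal.mk0 K I, ClassGroup.mk_mk0 K I⟩
  choose J hJ using hsurj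
  refine ⟨J, by simp only [hJ]; exact Function.bijective_id, ?_⟩
  have hd (c : ClassGroup (𝓞 K)) : dualUnit (J c) = dualUnit 1 * (J c)⁻¹ := by
    ext1
    rw [Units.val_mul, Units.val_inv_eq_inv_val]
    exact FractionalIdeal.dual_eq_mul_inv ℤ ℚ _
  simp only [hd, map_mul, map_inv, hJ]
  exact (Equiv.mulLeft (ClassGroup.mk K (dualUnit 1))).bijective.comp (Equiv.inv _).bijective

/-- The completed zeta function, from a suitable Mellin pair. -/
lemma exists_completed_of_pair {Z : ℂ → ℂ} (hZ : IsDedekindZeta K Z) (P : WeakFEPair ℂ)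
    {d κ : ℝ} {θ : ℂ} (hd0 : 0 < d) (hκ : 0 < κ) (hkR : P.k = d / 2) (hf₀ : P.f₀ = θ)
    (hg₀ : P.g₀ = θ) (hε : P.ε = 1) (hθ : θ ≠ 0)
    (h1 : ∀ s : ℝ, 1 < s → P.Λ (d * s / 2 : ℝ) =
      (κ * archFactor K s * ∑' I : {I : Ideal (𝓞 K) // I ≠ ⊥},
        (Ideal.absNorm (I : Ideal (𝓞 K)) : ℝ) ^ (-s) : ℝ))
    (h2 : ∀ s : ℝ, 1 < s → P.symm.Λ (d * s / 2 : ℝ) =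
      (κ * archFactor K s * ∑' I : {I : Ideal (𝓞 K) // I ≠ ⊥},
        (Ideal.absNorm (I : Ideal (𝓞 K)) : ℝ) ^ (-s) : ℝ)) :
    ∃ (Λ : ℂ → ℂ) (c : ℂ), c ≠ 0 ∧ Differentiable ℂ Λ ∧ (∀ s, Λ (1 - s) = Λ s) ∧
      (∀ a b : ℝ, ∃ M : ℝ, ∀ s : ℂ, a ≤ s.re → s.re ≤ b → ‖Λ s‖ ≤ M) ∧
      ∀ s, s ≠ 0 → s ≠ 1 → Z s = (Λ s - c / s - c / (1 - s)) * archInv K s := by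
  have hd0' : (d : ℂ) ≠ 0 := by exact_mod_cast hd0.ne'
  have hk : (P.k : ℂ) = d / 2 := by simp [hkR]
  have hΛΛ : P.Λ₀ = P.symm.Λ₀ := by
    have h3 : Set.EqOn (fun s : ℂ ↦ P.Λ₀ (d * s / 2)) (fun s : ℂ ↦ P.symm.Λ₀ (d * s / 2)) ∅ᶜ := by
      refine eqOn_of_eq_ofReal Set.countable_empty isClosed_empty (by simp)
        (P.differentiable_Λ₀.comp (by fun_prop)).differentiableOn
        (P.symm.differentiable_Λ₀.comp (by fun_prop)).differentiableOn fun s hs ↦ ?_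
      have h4 : P.Λ ((d * s / 2 : ℝ) : ℂ) = P.symm.Λ ((d * s / 2 : ℝ) : ℂ) :=
        (h1 s hs).trans (h2 s hs).symm
      push_cast at h4
      simp only [P.Λ₀_eq, P.symm_Λ₀_eq, h4, hf₀, hg₀, hε, inv_one]
    ext s
    have := h3 (x := 2 * s / d) (by simp)
    simpa [mul_div_cancel₀ _ hd0', field] using this
  have hfe (s : ℂ) : P.Λ₀ (d * (1 - s) / 2) = P.Λ₀ (d * s / 2) := by
    have := P.functional_equation₀ (d * s / 2)
    rw [← hΛΛ, hε, one_smul, hk] at this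
    rw [← this]
    congr 1
    ring
  refine ⟨fun s ↦ (κ : ℂ)⁻¹ * P.Λ₀ (d * s / 2),
    (κ : ℂ)⁻¹ * (2 * θ / d), ?_, ?_, ?_, ?_, ?_⟩
  · have : (κ : ℂ) ≠ 0 := by exact_mod_cast hκ.ne'
    exact mul_ne_zero (inv_ne_zero this) (div_ne_zero (mul_ne_zero two_ne_zero hθ) hd0')
  · exact (P.differentiable_Λ₀.comp (by fun_prop)).const_mul _
  · intro s
    simp only [hfe]
  · intro a b
    obtain ⟨M, hM⟩ := exists_norm_mellin_le
      (fun s ↦ (P.isStrongFEPair_toStrongFEPair.hasMellin s).1) (d * a / 2) (d * b / 2)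
    refine ⟨‖(κ : ℂ)⁻¹‖ * M, fun s ha hb ↦ ?_⟩
    rw [norm_mul]
    have hsre : (d * s / 2 : ℂ).re = d * s.re / 2 := by
      rw [mul_div_assoc, Complex.re_ofReal_mul, Complex.div_ofNat_re, mul_div_assoc]
    refine mul_le_mul_of_nonneg_left (hM _ ?_ ?_) (norm_nonneg _) <;> rw [hsre] <;> gcongr
  · have h5 : Set.EqOn Z (fun s ↦ ((κ : ℂ)⁻¹ * P.Λ₀ (d * s / 2) -
        (κ : ℂ)⁻¹ * (2 * θ / d) / s - (κ : ℂ)⁻¹ * (2 * θ / d) / (1 - s)) *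
        archInv K s) {0, 1}ᶜ := by
      have hmem {s : ℂ} (hs : s ∈ ({0, 1} : Set ℂ)ᶜ) : s ≠ 0 ∧ s ≠ 1 := by simpa using hs
      refine eqOn_of_eq_ofReal (by simp) (Set.toFinite _).isClosed (by simp)
        (fun s hs ↦ (hZ.1 s (hmem hs).2).differentiableWithinAt) (fun s hs ↦ ?_) fun s hs ↦ ?_
      · have := sub_ne_zero.mpr (hmem hs).2.symm
        refine DifferentiableAt.differentiableWithinAt (.mul (.sub (.sub ?_ ?_) ?_)
          differentiable_archInv.differentiableAt)
        · exact (P.differentiable_Λ₀.comp (by fun_prop)).differentiableAt.const_mul _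
        · exact (differentiableAt_const _).div differentiableAt_id (hmem hs).1
        · exact (differentiableAt_const _).div (by fun_prop) this
      · have hA := archFactor_pos (K := K) (s := s) (by linarith)
        have h6 := P.Λ₀_eq ((d * s / 2 : ℝ) : ℂ)
        rw [h1 s hs, hf₀, hg₀, hε, hk] at h6
        push_cast at h6
        rw [archInv_ofReal, dedekindZeta_apply_ofReal hZ hs, h6]
        have e1 : (1 - s : ℂ) ≠ 0 := sub_ne_zero.mpr (by exact_mod_cast hs.ne)
        have e2 : (s : ℂ) ≠ 0 := by exact_mod_cast (by linarith : s ≠ 0)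
        have e3 : (d / 2 - d * s / 2 : ℂ) = d * (1 - s) / 2 := by ring
        have e4 : (κ : ℂ) ≠ 0 := by exact_mod_cast hκ.ne'
        have e5 : (archFactor K s : ℂ) ≠ 0 := by exact_mod_cast hA.ne'
        rw [e3]
        push_cast
        simp only [smul_eq_mul]
        field_simp
        ring
    exact fun s h0 h1 ↦ h5 (by simp [h0, h1])

/-- Summability of the Dirichlet series, analytic continuation and functional equation. -/
theorem exists_completed {Z : ℂ → ℂ} (hZ : IsDedekindZeta K Z) :
    (∀ s : ℝ, 1 < s → Summable fun I : {I : Ideal (𝓞 K) // I ≠ ⊥} ↦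
      (Ideal.absNorm (I : Ideal (𝓞 K)) : ℝ) ^ (-s)) ∧
    ∃ (Λ : ℂ → ℂ) (c : ℂ), c ≠ 0 ∧ Differentiable ℂ Λ ∧ (∀ s, Λ (1 - s) = Λ s) ∧
      (∀ a b : ℝ, ∃ M : ℝ, ∀ s : ℂ, a ≤ s.re → s.re ≤ b → ‖Λ s‖ ≤ M) ∧
      ∀ s, s ≠ 0 → s ≠ 1 → Z s = (Λ s - c / s - c / (1 - s)) * archInv K s := by
  obtain ⟨J, hJ, hJ'⟩ := exists_representatives K
  obtain ⟨κ, hκ, H⟩ := exists_mellin_eq K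
  have hd0 : (0 : ℝ) < Module.finrank ℚ K :=
    Nat.cast_pos.mpr (Module.finrank_pos (R := ℚ) (M := K))
  have hk : (thetaPair J).k = Module.finrank ℚ K / 2 := rfl
  have hre {s : ℝ} (hs : 1 < s) :
      (thetaPair J).k < ((Module.finrank ℚ K * s / 2 : ℝ) : ℂ).re := by
    rw [hk, Complex.ofReal_re]; nlinarith
  have h1 (s : ℝ) (hs : 1 < s) := H J hJ s (by linarith) _ ((thetaPair J).hasMellin (hre hs))
  have h2 (s : ℝ) (hs : 1 < s) := H _ hJ' s (by linarith) _ ((thetaPair J).symm.hasMellin (hre hs))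
  exact ⟨fun s hs ↦ (h1 s hs).1, exists_completed_of_pair hZ (thetaPair J) hd0 hκ hk rfl rfl rfl
    thetaConst_ne_zero
    (fun s hs ↦ (h1 s hs).2) fun s hs ↦ (h2 s hs).2⟩

end LargeStrip

namespace LargeStrip

section Gamma

lemma norm_div_norm_add_le {x b τ : ℝ} (hx : 0 < x) (hb : 0 ≤ b) (hτ : 0 ≤ τ) {s : ℂ}
    (hre : s.re = x) (him : |s.im| = b) :
    ‖s‖ / ‖s + τ‖ ≤ (x + b) / (x + b + τ) * Real.exp (τ * (b / (x + b) ^ 2)) := by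
  have hs : ‖s‖ ^ 2 = x ^ 2 + b ^ 2 := by
    rw [Complex.sq_norm, Complex.normSq_apply, hre, ← sq, ← sq, ← sq_abs s.im, him]
  have hs' : ‖s + τ‖ ^ 2 = (x + τ) ^ 2 + b ^ 2 := by
    rw [Complex.sq_norm, Complex.normSq_apply]
    simp only [add_re, ofReal_re, add_im, ofReal_im, add_zero, hre]
    rw [← sq, ← sq, ← sq_abs s.im, him]
  have hpos : 0 < ‖s + τ‖ := by
    have : 0 < ‖s + τ‖ ^ 2 := by rw [hs']; positivity
    exact lt_of_le_of_ne (norm_nonneg _) fun h ↦ by simp [← h] at this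
  refine (sq_le_sq₀ (by positivity) (by positivity)).mp ?_
  rw [div_pow, mul_pow, div_pow, hs, hs', ← Real.exp_nat_mul]
  have h1 : 1 + 2 * (τ * b / (x + b) ^ 2) ≤ Real.exp ((2 : ℕ) * (τ * (b / (x + b) ^ 2))) := by
    have := Real.add_one_le_exp ((2 : ℕ) * (τ * (b / (x + b) ^ 2)))
    push_cast at this ⊢
    rw [mul_div_assoc]
    linarith
  refine le_trans ?_ (mul_le_mul_of_nonneg_left h1 (by positivity))
  have h2 : (x + b) ^ 2 / (x + b + τ) ^ 2 * (1 + 2 * (τ * b / (x + b) ^ 2)) =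
      ((x + b) ^ 2 + 2 * τ * b) / (x + b + τ) ^ 2 := by
    have : x + b ≠ 0 := by positivity
    field_simp
  rw [h2, div_le_div_iff₀ (by positivity) (by positivity)]
  have h3 : ((x + b) ^ 2 + 2 * τ * b) * ((x + τ) ^ 2 + b ^ 2) - (x ^ 2 + b ^ 2) * (x + b + τ) ^ 2 =
      4 * τ * b * x ^ 2 + 6 * τ ^ 2 * b * x + 2 * τ ^ 3 * b := by ring
  have h4 : 0 ≤ 4 * τ * b * x ^ 2 + 6 * τ ^ 2 * b * x + 2 * τ ^ 3 * b := by positivity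
  linarith

lemma sum_div_sq_le {b y : ℝ} (hb : 0 ≤ b) (hy : 0 < y) (hby : b ≤ y) (n : ℕ) :
    ∑ j ∈ Finset.range n, b / (y + j) ^ 2 ≤ 1 + 1 / y := by
  have h (n : ℕ) : ∑ j ∈ Finset.range n, b / (y + j) ^ 2 ≤
      (1 + 1 / y) * b * (1 / y - 1 / (y + n)) := by
    induction n with
    | zero => simp
    | succ n ih =>
      rw [Finset.sum_range_succ]
      have h1 : b / (y + n) ^ 2 ≤ (1 + 1 / y) * b * (1 / (y + n) - 1 / (y + (n + 1 : ℕ))) := by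
        have h2 : (1 + 1 / y) * b * (1 / (y + n) - 1 / (y + (n + 1 : ℕ))) - b / (y + n) ^ 2 =
            b * n / (y * (y + n) ^ 2 * (y + n + 1)) := by
          push_cast
          have h3 : y + (n + 1 : ℝ) ≠ 0 := by positivity
          have h4 : y + (n : ℝ) ≠ 0 := by positivity
          have h5 : y + n + 1 ≠ 0 := by positivity
          rw [show y + (n + 1 : ℝ) = y + n + 1 by ring]
          field_simp
          ring
        have h6 : 0 ≤ b * n / (y * (y + n) ^ 2 * (y + n + 1)) := by positivity
        linarith
      calc _ ≤ _ := add_le_add ih h1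
        _ = _ := by ring
  have h1 : 0 ≤ 1 / (y + n) := by positivity
  have h2 : 1 / (y + n) ≤ 1 / y := one_div_le_one_div_of_le hy (by simp)
  calc _ ≤ (1 + 1 / y) * b * (1 / y - 1 / (y + n)) := h n
    _ ≤ (1 + 1 / y) * y * (1 / y) := by
      gcongr; linarith
    _ = 1 + 1 / y := by field_simp

lemma norm_GammaSeq {s : ℂ} {n : ℕ} (hn : n ≠ 0) :
    ‖Complex.GammaSeq s n‖ =
      (n : ℝ) ^ s.re * n.factorial / ∏ j ∈ Finset.range (n + 1), ‖s + j‖ := by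
  rw [Complex.GammaSeq, norm_div, norm_mul, norm_prod, Complex.norm_natCast,
    Complex.norm_natCast_cpow_of_pos (Nat.pos_of_ne_zero hn)]

lemma norm_GammaSeq_add_le {s : ℂ} (hs : 0 < s.re) {τ : ℝ} (hτ : 0 ≤ τ) {n : ℕ} (hn : n ≠ 0) :
    ‖Complex.GammaSeq (s + τ) n‖ ≤ ‖Complex.GammaSeq s n‖ *
      (Real.GammaSeq (s.re + |s.im| + τ) n / Real.GammaSeq (s.re + |s.im|) n) *
      Real.exp (τ * (1 + 1 / (s.re + |s.im|))) := by
  set y := s.re + |s.im| with hy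
  have hy0 : 0 < y := by positivity
  have hn0 : (0 : ℝ) < n := by positivity
  have hnorm (j : ℕ) : 0 < ‖s + j‖ := norm_pos_iff.mpr fun h ↦ by
    have := congrArg Complex.re h
    simp at this
    linarith [(Nat.cast_nonneg j : (0 : ℝ) ≤ j)]
  have h1 : (∏ j ∈ Finset.range (n + 1), ‖s + j‖) / ∏ j ∈ Finset.range (n + 1), ‖s + τ + j‖ ≤
      (∏ j ∈ Finset.range (n + 1), (y + j)) / (∏ j ∈ Finset.range (n + 1), (y + τ + j)) *
      Real.exp (τ * (1 + 1 / y)) := by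
    calc (∏ j ∈ Finset.range (n + 1), ‖s + j‖) / ∏ j ∈ Finset.range (n + 1), ‖s + τ + j‖
        = ∏ j ∈ Finset.range (n + 1), (‖s + j‖ / ‖s + j + τ‖) := by
          rw [Finset.prod_div_distrib]
          congr 1
          exact Finset.prod_congr rfl fun j _ ↦ by rw [add_right_comm]
      _ ≤ ∏ j ∈ Finset.range (n + 1), ((y + j) / (y + τ + j) *
          Real.exp (τ * (|s.im| / (y + j) ^ 2))) := by
          refine Finset.prod_le_prod (fun j _ ↦ by positivity) fun j _ ↦ ?_
          have := norm_div_norm_add_le (x := s.re + j) (b := |s.im|) (s := s + j) (by positivity)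
            (abs_nonneg _) hτ (by simp) (by simp)
          rwa [show s.re + j + |s.im| = y + j by rw [hy]; ring, add_right_comm y] at this
      _ = (∏ j ∈ Finset.range (n + 1), (y + j)) / (∏ j ∈ Finset.range (n + 1), (y + τ + j)) *
          Real.exp (τ * ∑ j ∈ Finset.range (n + 1), |s.im| / (y + j) ^ 2) := by
          rw [Finset.prod_mul_distrib, Finset.prod_div_distrib, ← Real.exp_sum, Finset.mul_sum]
      _ ≤ _ := by
          gcongr
          exact sum_div_sq_le (abs_nonneg _) hy0 (by linarith) _
  have hp1 : 0 < ∏ j ∈ Finset.range (n + 1), ‖s + j‖ := Finset.prod_pos fun j _ ↦ hnorm j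
  have hp2 : 0 < ∏ j ∈ Finset.range (n + 1), (y + j) := Finset.prod_pos fun j _ ↦ by positivity
  have hp3 : 0 < ∏ j ∈ Finset.range (n + 1), (y + τ + j) :=
    Finset.prod_pos fun j _ ↦ by positivity
  have hfac : (0 : ℝ) < n.factorial := by positivity
  rw [norm_GammaSeq hn, norm_GammaSeq hn, Real.GammaSeq, Real.GammaSeq, Real.rpow_add hn0 y]
  simp only [Complex.add_re, Complex.ofReal_re]
  rw [Real.rpow_add hn0]
  have e1 : (n : ℝ) ^ s.re * n ^ τ * n.factorial / ∏ j ∈ Finset.range (n + 1), ‖s + τ + j‖ =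
      (n : ℝ) ^ s.re * n ^ τ * n.factorial / (∏ j ∈ Finset.range (n + 1), ‖s + j‖) *
      ((∏ j ∈ Finset.range (n + 1), ‖s + j‖) / ∏ j ∈ Finset.range (n + 1), ‖s + τ + j‖) := by
    field_simp
  rw [e1]
  refine (mul_le_mul_of_nonneg_left h1 (by positivity)).trans (le_of_eq ?_)
  field_simp

/-- Upper bound for the growth of the Gamma function on horizontal lines. -/
lemma norm_Gamma_add_le {s : ℂ} (hs : 0 < s.re) {τ : ℝ} (hτ : 0 ≤ τ) (hτ1 : τ ≤ 1) :
    ‖Complex.Gamma (s + τ)‖ ≤ ‖Complex.Gamma s‖ * (s.re + |s.im|) ^ τ *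
      Real.exp (τ * (1 + 1 / (s.re + |s.im|))) := by
  set y := s.re + |s.im| with hy
  have hy0 : 0 < y := by positivity
  have h1 : Real.Gamma (y + τ) / Real.Gamma y ≤ y ^ τ := by
    rw [div_le_iff₀ (Real.Gamma_pos_of_pos hy0)]
    rcases hτ.eq_or_lt with rfl | h0
    · simp
    rcases hτ1.eq_or_lt with rfl | h1
    · rw [Real.rpow_one, Real.Gamma_add_one hy0.ne']
    have := Real.Gamma_mul_add_mul_le_rpow_Gamma_mul_rpow_Gamma hy0 (t := y + 1) (by linarith)
      (a := 1 - τ) (b := τ) (by linarith) h0 (by ring)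
    rw [show (1 - τ) * y + τ * (y + 1) = y + τ by ring, Real.Gamma_add_one hy0.ne',
      Real.mul_rpow hy0.le (Real.Gamma_pos_of_pos hy0).le] at this
    refine this.trans (le_of_eq ?_)
    rw [mul_left_comm, ← Real.rpow_add (Real.Gamma_pos_of_pos hy0), sub_add_cancel, Real.rpow_one]
  have h2 := le_of_tendsto_of_tendsto ((Complex.GammaSeq_tendsto_Gamma (s + τ)).norm)
    ((((Complex.GammaSeq_tendsto_Gamma s).norm).mul
      ((Real.GammaSeq_tendsto_Gamma (y + τ)).div (Real.GammaSeq_tendsto_Gamma y)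
        (Real.Gamma_pos_of_pos hy0).ne')).mul_const (Real.exp (τ * (1 + 1 / y))))
    (by filter_upwards [eventually_ne_atTop 0] with n hn using norm_GammaSeq_add_le hs hτ hn)
  refine h2.trans ?_
  gcongr

/-- Lower bound for the growth of the Gamma function on horizontal lines. -/
lemma norm_Gamma_le_norm_Gamma_add {s : ℂ} (hs : 0 < s.re) {τ : ℝ} (hτ : 0 ≤ τ) :
    ‖Complex.Gamma s‖ * Real.Gamma (s.re + τ) ≤ Real.Gamma s.re * ‖Complex.Gamma (s + τ)‖ := by
  rcases hτ.eq_or_lt with rfl | h0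
  · simp [mul_comm]
  have h1 := Complex.Gamma_mul_Gamma_eq_betaIntegral hs (t := (τ : ℂ)) (by simpa using h0)
  have h2 := Complex.Gamma_mul_Gamma_eq_betaIntegral (s := (s.re : ℂ)) (by simpa using hs)
    (t := (τ : ℂ)) (by simpa using h0)
  have hτΓ := Real.Gamma_pos_of_pos h0
  have h3 : ‖Complex.betaIntegral s τ‖ ≤ ‖Complex.betaIntegral s.re τ‖ := by
    have h4 : Complex.betaIntegral s.re τ =
        ((∫ x : ℝ in (0)..1, x ^ (s.re - 1) * (1 - x) ^ (τ - 1) : ℝ) : ℂ) := by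
      rw [Complex.betaIntegral, ← intervalIntegral.integral_ofReal]
      refine intervalIntegral.integral_congr fun x hx ↦ ?_
      rw [Set.uIcc_of_le zero_le_one] at hx
      rw [Complex.ofReal_mul, Complex.ofReal_cpow hx.1, Complex.ofReal_cpow (by linarith [hx.2])]
      push_cast
      rfl
    have h5 : IntervalIntegrable (fun x : ℝ ↦ x ^ (s.re - 1) * (1 - x) ^ (τ - 1)) volume 0 1 := by
      have := (Complex.betaIntegral_convergent (u := (s.re : ℂ)) (v := (τ : ℂ)) (by simpa using hs)
        (by simpa using h0)).norm
      refine this.congr_uIoo fun x hx ↦ ?_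
      rw [Set.uIoo_of_le zero_le_one] at hx
      beta_reduce
      rw [norm_mul, Complex.norm_cpow_eq_rpow_re_of_pos hx.1, ← Complex.ofReal_one,
        ← Complex.ofReal_sub 1 x, Complex.norm_cpow_eq_rpow_re_of_pos (by linarith [hx.2])]
      simp
    rw [h4, Complex.norm_real]
    refine le_trans ?_ (le_abs_self _)
    refine intervalIntegral.norm_integral_le_of_norm_le zero_le_one ?_ h5
    filter_upwards [compl_mem_ae_iff.mpr (measure_singleton (1 : ℝ))] with x hx1 hx
    have hx1 : x < 1 := lt_of_le_of_ne hx.2 hx1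
    rw [norm_mul, Complex.norm_cpow_eq_rpow_re_of_pos hx.1, ← Complex.ofReal_one,
      ← Complex.ofReal_sub, Complex.norm_cpow_eq_rpow_re_of_pos (by linarith)]
    simp
  have h4 := congrArg norm h1
  have h5 := congrArg norm h2
  rw [← Complex.ofReal_add] at h5
  simp only [norm_mul, Complex.Gamma_ofReal, Complex.norm_real, Real.norm_eq_abs,
    abs_of_pos hτΓ, abs_of_pos (Real.Gamma_pos_of_pos hs),
    abs_of_pos (Real.Gamma_pos_of_pos (add_pos hs h0))] at h4 h5
  refine le_of_mul_le_mul_right ?_ hτΓ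
  calc _ = (‖Complex.Gamma s‖ * Real.Gamma τ) * Real.Gamma (s.re + τ) := by ring
    _ ≤ ‖Complex.Gamma (s + τ)‖ * (Real.Gamma (s.re + τ) * ‖Complex.betaIntegral s.re τ‖) := by
      rw [h4]
      have := Real.Gamma_pos_of_pos (add_pos hs h0)
      nlinarith [mul_le_mul_of_nonneg_left h3
        (mul_nonneg (norm_nonneg (Complex.Gamma (s + τ))) this.le)]
    _ = _ := by rw [← h5]; ring

end Gamma

end LargeStrip

namespace LargeStrip

section Gamma

lemma norm_Gamma_le_Gamma_re {s : ℂ} (hs : 0 < s.re) : ‖Complex.Gamma s‖ ≤ Real.Gamma s.re := by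
  rw [Complex.Gamma_eq_integral hs, Real.Gamma_eq_integral hs, Complex.GammaIntegral]
  refine (norm_integral_le_integral_norm _).trans (le_of_eq ?_)
  refine setIntegral_congr_fun measurableSet_Ioi fun x hx ↦ ?_
  rw [norm_mul, Complex.norm_cpow_eq_rpow_re_of_pos hx, Complex.norm_real, Real.norm_eq_abs,
    Real.abs_exp]
  simp

lemma norm_sin_le_exp (z : ℂ) : ‖Complex.sin z‖ ≤ Real.exp |z.im| := by
  rw [Complex.sin, norm_div, norm_mul, Complex.norm_I, mul_one, Complex.norm_ofNat,
    div_le_iff₀ two_pos]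
  refine (norm_sub_le _ _).trans ?_
  have h1 : (-z * I).re ≤ |z.im| := by simpa using le_abs_self _
  have h2 : (z * I).re ≤ |z.im| := by simpa using neg_le_abs _
  rw [Complex.norm_exp, Complex.norm_exp, mul_two]
  exact add_le_add (Real.exp_le_exp.mpr h1) (Real.exp_le_exp.mpr h2)

lemma exists_Gamma_bounds {a b : ℝ} (ha : 0 < a) :
    ∃ c C : ℝ, 0 < c ∧ 0 < C ∧ ∀ x, a ≤ x → x ≤ b → c ≤ Real.Gamma x ∧ Real.Gamma x ≤ C := by
  rcases lt_or_ge b a with hab | hab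
  · exact ⟨1, 1, one_pos, one_pos, fun x h1 h2 ↦ by linarith⟩
  have hcont : ContinuousOn Real.Gamma (Set.Icc a b) := fun x hx ↦
    (Real.differentiableAt_Gamma fun m h ↦ by
      have := (Nat.cast_nonneg m : (0 : ℝ) ≤ m)
      linarith [hx.1]).continuousAt.continuousWithinAt
  obtain ⟨x₀, hx₀, hmin⟩ := isCompact_Icc.exists_isMinOn (Set.nonempty_Icc.mpr hab) hcont
  obtain ⟨x₁, hx₁, hmax⟩ := isCompact_Icc.exists_isMaxOn (Set.nonempty_Icc.mpr hab) hcont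
  exact ⟨_, _, Real.Gamma_pos_of_pos (ha.trans_le hx₀.1),
    Real.Gamma_pos_of_pos (ha.trans_le hx₁.1), fun x h1 h2 ↦ ⟨hmin ⟨h1, h2⟩, hmax ⟨h1, h2⟩⟩⟩

lemma exists_norm_Gamma_le : ∃ D : ℝ, 0 < D ∧ ∀ (z : ℂ) (τ : ℝ), -1 ≤ z.re → z.re ≤ 1 →
    0 ≤ τ → τ ≤ 3 → 1 / 2 ≤ |z.im| → ‖Complex.Gamma z‖ ≤ D * ‖Complex.Gamma (z + τ)‖ := by
  obtain ⟨c, C, hc, hC, h⟩ := exists_Gamma_bounds (b := 6) one_pos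
  refine ⟨49 * C / c, by positivity, fun z τ h1 h2 h3 h4 h5 ↦ ?_⟩
  have hstep (w : ℂ) (hw : w.im ≠ 0) :
      Complex.Gamma (w + 2) = (w + 1) * (w * Complex.Gamma w) := by
    have e1 : w ≠ 0 := fun h ↦ hw (by simp [h])
    have e2 : w + 1 ≠ 0 := fun h ↦ hw (by simpa using congrArg Complex.im h)
    rw [← Complex.Gamma_add_one _ e1, ← Complex.Gamma_add_one _ e2, add_assoc, one_add_one_eq_two]
  have him : z.im ≠ 0 := fun h ↦ by norm_num [h] at h5
  have h6 := norm_Gamma_le_norm_Gamma_add (s := z + 2) (by simp; linarith) h3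
  rw [add_right_comm, hstep z him, hstep (z + τ) (by simpa using him), norm_mul, norm_mul, norm_mul,
    norm_mul] at h6
  simp only [add_re, re_ofNat] at h6
  have h7 := (h (z.re + 2 + τ) (by linarith) (by linarith)).1
  have h8 := (h (z.re + 2) (by linarith) (by linarith)).2
  have hz : 1 / 2 ≤ ‖z‖ := h5.trans (Complex.abs_im_le_norm z)
  have hz1 : 1 / 2 ≤ ‖z + 1‖ := h5.trans (by simpa using Complex.abs_im_le_norm (z + 1))
  have hτ : ‖(τ : ℂ)‖ = τ := by rw [Complex.norm_real, Real.norm_of_nonneg h3]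
  have h9 : ‖z + τ‖ ≤ 7 * ‖z‖ := (norm_add_le _ _).trans (by linarith)
  have h10 : ‖z + τ + 1‖ ≤ 7 * ‖z + 1‖ := by
    rw [add_right_comm]
    exact (norm_add_le _ _).trans (by linarith)
  set g := ‖Complex.Gamma z‖
  set g' := ‖Complex.Gamma (z + τ)‖
  have hg' : 0 ≤ g' := norm_nonneg _
  have hp : 0 < ‖z + 1‖ * ‖z‖ := by positivity
  have h11 : ‖z + 1‖ * ‖z‖ * (g * c) ≤ ‖z + 1‖ * ‖z‖ * (49 * C * g') := by
    calc _ = ‖z + 1‖ * (‖z‖ * g) * c := by ring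
      _ ≤ ‖z + 1‖ * (‖z‖ * g) * Real.Gamma (z.re + 2 + τ) := by gcongr
      _ ≤ _ := h6
      _ ≤ C * ((7 * ‖z + 1‖) * ((7 * ‖z‖) * g')) := by gcongr
      _ = _ := by ring
  have h12 := le_of_mul_le_mul_left h11 hp
  rw [div_mul_eq_mul_div, le_div_iff₀ hc]
  exact h12

lemma exists_inv_norm_Gamma_le (A : ℝ) : ∃ C : ℝ, 0 ≤ C ∧ ∀ z : ℂ, 1 / 8 ≤ z.re → z.re ≤ A →
    ‖Complex.Gamma z‖⁻¹ ≤ Real.exp (C * (1 + |z.im|)) := by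
  obtain ⟨c, C, hc, hC, h⟩ := exists_Gamma_bounds (a := 1 / 8) (b := A) (by norm_num)
  set B := Real.Gamma (1 / 8) / c * (Real.Gamma (7 / 8) / Real.pi) with hB
  have hB0 : 0 < B := by
    have := Real.Gamma_pos_of_pos (s := 1 / 8) (by norm_num)
    have := Real.Gamma_pos_of_pos (s := 7 / 8) (by norm_num)
    positivity
  refine ⟨|Real.log B| + Real.pi, by positivity, fun z h1 h2 ↦ ?_⟩
  set z₀ : ℂ := ⟨1 / 8, z.im⟩ with hz₀
  have h3 : z = z₀ + (z.re - 1 / 8 : ℝ) := by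
    apply Complex.ext <;> simp [hz₀]
  have h4 := norm_Gamma_le_norm_Gamma_add (s := z₀) (by norm_num [hz₀]) (τ := z.re - 1 / 8)
    (by linarith)
  rw [← h3, show z₀.re + (z.re - 1 / 8) = z.re by simp [hz₀]] at h4
  have hΓz : 0 < ‖Complex.Gamma z‖ :=
    norm_pos_iff.mpr (Complex.Gamma_ne_zero_of_re_pos (by linarith))
  have hΓz₀ : Complex.Gamma z₀ ≠ 0 := Complex.Gamma_ne_zero_of_re_pos (by norm_num [hz₀])
  have hΓz₀' : 0 < ‖Complex.Gamma z₀‖ := norm_pos_iff.mpr hΓz₀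
  have h5 : ‖Complex.Gamma z₀‖⁻¹ ≤ Real.Gamma (7 / 8) / Real.pi * Real.exp (Real.pi * |z.im|) := by
    have h6 := Complex.Gamma_mul_Gamma_one_sub z₀
    have h7 : (Complex.Gamma z₀)⁻¹ = Complex.Gamma (1 - z₀) * Complex.sin (Real.pi * z₀) /
        Real.pi := by
      have hpi : (Real.pi : ℂ) ≠ 0 := by exact_mod_cast Real.pi_ne_zero
      have hsin : Complex.sin (Real.pi * z₀) ≠ 0 := fun h0 ↦ by
        rw [h0, div_zero] at h6
        exact mul_ne_zero hΓz₀ (Complex.Gamma_ne_zero_of_re_pos (by norm_num [hz₀])) h6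
      rw [eq_div_iff hsin] at h6
      rw [inv_eq_iff_eq_inv, inv_div, eq_div_iff, ← mul_assoc, h6]
      exact mul_ne_zero (Complex.Gamma_ne_zero_of_re_pos (by norm_num [hz₀])) hsin
    rw [← norm_inv, h7, norm_div, norm_mul, Complex.norm_real, Real.norm_of_nonneg Real.pi_pos.le,
      div_mul_eq_mul_div]
    gcongr
    · refine (norm_Gamma_le_Gamma_re (by norm_num [hz₀])).trans (le_of_eq ?_)
      norm_num [hz₀]
    · refine (norm_sin_le_exp _).trans (le_of_eq ?_)
      rw [Complex.im_ofReal_mul, abs_mul, abs_of_pos Real.pi_pos]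
  have h8 : ‖Complex.Gamma z‖⁻¹ ≤ Real.Gamma (1 / 8) / c * ‖Complex.Gamma z₀‖⁻¹ := by
    have h9 := (h z.re h1 h2).1
    rw [inv_le_iff_one_le_mul₀ hΓz, div_mul_eq_mul_div, div_mul_eq_mul_div, one_le_div hc,
      mul_right_comm, ← div_eq_mul_inv, le_div_iff₀ hΓz₀', mul_comm]
    refine le_trans ?_ h4
    gcongr
  calc _ ≤ _ := h8
    _ ≤ Real.Gamma (1 / 8) / c *
        (Real.Gamma (7 / 8) / Real.pi * Real.exp (Real.pi * |z.im|)) := by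
      have := Real.Gamma_pos_of_pos (s := 1 / 8) (by norm_num)
      gcongr
    _ = Real.exp (Real.log B + Real.pi * |z.im|) := by
      rw [Real.exp_add, Real.exp_log hB0, hB]; ring
    _ ≤ _ := by
      refine Real.exp_le_exp.mpr ?_
      have := le_abs_self (Real.log B)
      nlinarith [abs_nonneg (Real.log B), abs_nonneg z.im, Real.pi_pos,
        mul_nonneg (abs_nonneg (Real.log B)) (abs_nonneg z.im)]

end Gamma

end LargeStrip

namespace LargeStrip

section ArchInv

variable {K : Type} [Field K] [NumberField K]

lemma one_le_abs_discr : 1 ≤ |(discr K : ℝ)| := by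
  exact_mod_cast Int.one_le_abs (discr_ne_zero K)

lemma mult_le_two {K : Type} [Field K] (w : InfinitePlace K) : (w.mult : ℝ) ≤ 2 := by
  have : w.mult ≤ 2 := by rw [InfinitePlace.mult]; split <;> norm_num
  exact_mod_cast this

lemma one_le_pi_mul_mult {K : Type} [Field K] (w : InfinitePlace K) : 1 ≤ Real.pi * w.mult := by
  nlinarith [Real.pi_gt_three, w.one_le_mult]

lemma re_half_mul (s : ℂ) (m : ℕ) : (s / 2 * m).re = s.re / 2 * m := by
  rw [← Complex.ofReal_natCast, Complex.re_mul_ofReal, Complex.div_ofNat_re]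

lemma im_half_mul (s : ℂ) (m : ℕ) : (s / 2 * m).im = s.im / 2 * m := by
  rw [← Complex.ofReal_natCast, Complex.im_mul_ofReal, Complex.div_ofNat_im]

lemma norm_archInv (s : ℂ) : ‖archInv K s‖ = |(discr K : ℝ)| ^ (-(s.re / 2)) *
    ∏ w : InfinitePlace K, ((Real.pi * w.mult) ^ (s.re / 2 * w.mult) *
      ‖Complex.Gamma (s / 2 * w.mult)‖⁻¹) := by
  rw [archInv, norm_mul, norm_prod, Complex.norm_cpow_eq_rpow_re_of_pos
    (by linarith [one_le_abs_discr (K := K)])]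
  congr 1
  · rw [Complex.neg_re, Complex.div_ofNat_re]
  · refine Finset.prod_congr rfl fun w _ ↦ ?_
    rw [norm_mul, norm_inv, Complex.norm_cpow_eq_rpow_re_of_pos
      (by linarith [one_le_pi_mul_mult w]), re_half_mul]

lemma discr_rpow_le {x y : ℝ} (h : x ≤ y) :
    |(discr K : ℝ)| ^ x ≤ |(discr K : ℝ)| ^ y :=
  Real.rpow_le_rpow_of_exponent_le one_le_abs_discr h

lemma half_mul_add (s : ℂ) (x : ℝ) (m : ℕ) :
    (s + x) / 2 * m = s / 2 * m + (x / 2 * m : ℝ) := by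
  push_cast
  ring

variable (K) in
lemma exists_norm_archInv_le_reflect : ∃ C A : ℝ, 0 < C ∧ 0 ≤ A ∧ ∀ s : ℂ, 1 / 4 ≤ s.re →
    s.re ≤ 1 / 2 → ‖archInv K s‖ ≤ C * (|s.im| + 2) ^ (A * (1 / 2 - s.re)) *
      ‖archInv K (s + (1 - 2 * s.re : ℝ))‖ := by
  have hΔ := one_le_abs_discr (K := K)
  refine ⟨|(discr K : ℝ)| * ∏ _w : InfinitePlace K, Real.exp 9,
    ∑ _w : InfinitePlace K, 2, by positivity, by positivity, fun s h1 h2 ↦ ?_⟩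
  rw [norm_archInv, norm_archInv, Finset.sum_mul, Real.rpow_sum_of_pos (by positivity)]
  have hre : (s + (1 - 2 * s.re : ℝ)).re = 1 - s.re := by
    rw [Complex.add_re, Complex.ofReal_re]; ring
  rw [hre]
  have hdisc : |(discr K : ℝ)| ^ (-(s.re / 2)) ≤
      |(discr K : ℝ)| * |(discr K : ℝ)| ^ (-((1 - s.re) / 2)) := by
    rw [← Real.rpow_one_add' (abs_nonneg _) (by linarith)]
    exact discr_rpow_le (by linarith)
  have hfac (w : InfinitePlace K) : (Real.pi * w.mult) ^ (s.re / 2 * w.mult) *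
      ‖Complex.Gamma (s / 2 * w.mult)‖⁻¹ ≤ Real.exp 9 * (|s.im| + 2) ^ (2 * (1 / 2 - s.re)) *
      ((Real.pi * w.mult) ^ ((1 - s.re) / 2 * w.mult) *
      ‖Complex.Gamma ((s + (1 - 2 * s.re : ℝ)) / 2 * w.mult)‖⁻¹) := by
    have hm1 := w.one_le_mult
    have hm2 := mult_le_two w
    have hpi := one_le_pi_mul_mult w
    set m : ℝ := (w.mult : ℝ)
    set τ : ℝ := (1 - 2 * s.re) / 2 * m
    have hτ0 : 0 ≤ τ := mul_nonneg (by linarith) (by linarith)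
    have hτ1 : τ ≤ 2 * (1 / 2 - s.re) := by
      calc τ ≤ (1 - 2 * s.re) / 2 * 2 := mul_le_mul_of_nonneg_left hm2 (by linarith)
        _ = _ := by ring
    have hτ2 : τ ≤ 1 := hτ1.trans (by linarith)
    have hzre : 1 / 8 ≤ (s / 2 * w.mult).re := by
      rw [re_half_mul]
      calc (1 / 8 : ℝ) ≤ s.re / 2 * 1 := by linarith
        _ ≤ _ := mul_le_mul_of_nonneg_left hm1 (by linarith)
    have hy : (s / 2 * w.mult).re + |(s / 2 * w.mult).im| ≤ |s.im| + 2 := by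
      rw [re_half_mul, im_half_mul, abs_mul, abs_div, abs_two,
        abs_of_pos (by linarith : 0 < (w.mult : ℝ))]
      have e1 : s.re / 2 * m ≤ s.re / 2 * 2 := mul_le_mul_of_nonneg_left hm2 (by linarith)
      have e2 : |s.im| / 2 * m ≤ |s.im| / 2 * 2 := mul_le_mul_of_nonneg_left hm2 (by positivity)
      linarith
    have h3 := norm_Gamma_add_le (s := s / 2 * w.mult) (by linarith) hτ0 hτ2
    rw [← half_mul_add] at h3
    have hy8 : 1 / 8 ≤ (s / 2 * w.mult).re + |(s / 2 * w.mult).im| :=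
      hzre.trans (le_add_of_nonneg_right (abs_nonneg _))
    set y := (s / 2 * w.mult).re + |(s / 2 * w.mult).im|
    have h4 : y ^ τ ≤ (|s.im| + 2) ^ (2 * (1 / 2 - s.re)) :=
      (Real.rpow_le_rpow (by linarith) hy hτ0).trans
        (Real.rpow_le_rpow_of_exponent_le (by linarith [abs_nonneg s.im]) hτ1)
    have h5 : Real.exp (τ * (1 + 1 / y)) ≤ Real.exp 9 := by
      refine Real.exp_le_exp.mpr ?_
      have e1 : 1 / y ≤ 8 := by
        rw [div_le_iff₀ (by linarith)]; linarith
      have e2 : 0 ≤ 1 / y := by positivity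
      nlinarith
    have hΓ : 0 < ‖Complex.Gamma (s / 2 * w.mult)‖ :=
      norm_pos_iff.mpr (Complex.Gamma_ne_zero_of_re_pos (by linarith))
    have hΓ' : 0 < ‖Complex.Gamma ((s + (1 - 2 * s.re : ℝ)) / 2 * w.mult)‖ := by
      refine norm_pos_iff.mpr (Complex.Gamma_ne_zero_of_re_pos ?_)
      rw [re_half_mul, hre]
      exact mul_pos (by linarith) (by linarith)
    have h6 : (Real.pi * m) ^ (s.re / 2 * m) ≤ (Real.pi * m) ^ ((1 - s.re) / 2 * m) :=
      Real.rpow_le_rpow_of_exponent_le hpi (by gcongr; linarith)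
    have h7 : ‖Complex.Gamma (s / 2 * w.mult)‖⁻¹ ≤ Real.exp 9 *
        (|s.im| + 2) ^ (2 * (1 / 2 - s.re)) *
        ‖Complex.Gamma ((s + (1 - 2 * s.re : ℝ)) / 2 * w.mult)‖⁻¹ := by
      rw [inv_le_iff_one_le_mul₀ hΓ, mul_right_comm, ← div_eq_mul_inv, one_le_div hΓ']
      calc _ ≤ _ := h3
        _ ≤ ‖Complex.Gamma (s / 2 * w.mult)‖ * (|s.im| + 2) ^ (2 * (1 / 2 - s.re)) *
          Real.exp 9 := by gcongr
        _ = _ := by ring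
    calc _ ≤ (Real.pi * m) ^ ((1 - s.re) / 2 * m) * (Real.exp 9 *
        (|s.im| + 2) ^ (2 * (1 / 2 - s.re)) *
        ‖Complex.Gamma ((s + (1 - 2 * s.re : ℝ)) / 2 * w.mult)‖⁻¹) := by gcongr
      _ = _ := by ring
  calc _ ≤ (|(discr K : ℝ)| * |(discr K : ℝ)| ^ (-((1 - s.re) / 2))) * ∏ w : InfinitePlace K,
        (Real.exp 9 * (|s.im| + 2) ^ (2 * (1 / 2 - s.re)) *
        ((Real.pi * w.mult) ^ ((1 - s.re) / 2 * w.mult) *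
        ‖Complex.Gamma ((s + (1 - 2 * s.re : ℝ)) / 2 * w.mult)‖⁻¹)) := by
        have hpi (w : InfinitePlace K) := one_le_pi_mul_mult w
        exact mul_le_mul hdisc (Finset.prod_le_prod (fun w _ ↦ by have := hpi w; positivity)
          fun w _ ↦ hfac w) (Finset.prod_nonneg fun w _ ↦ by have := hpi w; positivity)
          (by positivity)
    _ = _ := by
        rw [Finset.prod_mul_distrib, Finset.prod_mul_distrib]
        ring

variable (K) in
lemma exists_norm_archInv_reflect_le : ∃ C : ℝ, 0 < C ∧ ∀ s : ℂ, -1 ≤ s.re → s.re ≤ 1 / 2 →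
    1 ≤ |s.im| → ‖archInv K (s + (1 - 2 * s.re : ℝ))‖ ≤ C * ‖archInv K s‖ := by
  obtain ⟨D, hD, hΓ⟩ := exists_norm_Gamma_le
  refine ⟨∏ w : InfinitePlace K, (D * (Real.pi * w.mult) ^ (3 : ℝ)), Finset.prod_pos fun w _ ↦ ?_,
    fun s h1 h2 h3 ↦ ?_⟩
  · have := one_le_pi_mul_mult w
    positivity
  rw [norm_archInv, norm_archInv]
  have hre : (s + (1 - 2 * s.re : ℝ)).re = 1 - s.re := by
    rw [Complex.add_re, Complex.ofReal_re]; ring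
  rw [hre]
  have hfac (w : InfinitePlace K) : (Real.pi * w.mult) ^ ((1 - s.re) / 2 * w.mult) *
      ‖Complex.Gamma ((s + (1 - 2 * s.re : ℝ)) / 2 * w.mult)‖⁻¹ ≤
      D * (Real.pi * w.mult) ^ (3 : ℝ) * ((Real.pi * w.mult) ^ (s.re / 2 * w.mult) *
      ‖Complex.Gamma (s / 2 * w.mult)‖⁻¹) := by
    have hm1 := w.one_le_mult
    have hm2 := mult_le_two w
    have hpi := one_le_pi_mul_mult w
    have h4 : 1 / 2 ≤ |(s / 2 * w.mult).im| := by
      rw [im_half_mul, abs_mul, abs_div, abs_two, abs_of_pos (by linarith : 0 < (w.mult : ℝ))]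
      calc (1 / 2 : ℝ) ≤ |s.im| / 2 * 1 := by linarith
        _ ≤ _ := mul_le_mul_of_nonneg_left hm1 (by positivity)
    have h5 := hΓ (s / 2 * w.mult) ((1 - 2 * s.re) / 2 * w.mult)
      (by rw [re_half_mul]; nlinarith) (by rw [re_half_mul]; nlinarith)
      (mul_nonneg (by linarith) (by linarith)) (by nlinarith) h4
    rw [← half_mul_add] at h5
    have hne {z : ℂ} (hz : 1 / 2 ≤ |z.im|) : 0 < ‖Complex.Gamma z‖ := by
      refine norm_pos_iff.mpr (Complex.Gamma_ne_zero fun k hk ↦ ?_)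
      norm_num [hk] at hz
    have hΓ1 := hne h4
    have hΓ2 : 0 < ‖Complex.Gamma ((s + (1 - 2 * s.re : ℝ)) / 2 * w.mult)‖ := hne (by
      rwa [half_mul_add, Complex.add_im, Complex.ofReal_im, add_zero])
    have h6 : ‖Complex.Gamma ((s + (1 - 2 * s.re : ℝ)) / 2 * w.mult)‖⁻¹ ≤
        D * ‖Complex.Gamma (s / 2 * w.mult)‖⁻¹ := by
      rwa [inv_le_iff_one_le_mul₀ hΓ2, mul_right_comm, ← div_eq_mul_inv, one_le_div hΓ1]
    have h7 : (Real.pi * w.mult) ^ ((1 - s.re) / 2 * w.mult) ≤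
        (Real.pi * w.mult) ^ (3 : ℝ) * (Real.pi * w.mult) ^ (s.re / 2 * w.mult) := by
      rw [← Real.rpow_add (by linarith)]
      exact Real.rpow_le_rpow_of_exponent_le hpi (by nlinarith)
    calc _ ≤ (Real.pi * w.mult) ^ (3 : ℝ) * (Real.pi * w.mult) ^ (s.re / 2 * w.mult) *
        (D * ‖Complex.Gamma (s / 2 * w.mult)‖⁻¹) := by gcongr
      _ = _ := by ring
  calc _ ≤ |(discr K : ℝ)| ^ (-(s.re / 2)) * ∏ w : InfinitePlace K,
        (D * (Real.pi * w.mult) ^ (3 : ℝ) * ((Real.pi * w.mult) ^ (s.re / 2 * w.mult) *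
        ‖Complex.Gamma (s / 2 * w.mult)‖⁻¹)) := by
        have hpi (w : InfinitePlace K) := one_le_pi_mul_mult w
        exact mul_le_mul (discr_rpow_le (by linarith))
          (Finset.prod_le_prod (fun w _ ↦ by have := hpi w; positivity) fun w _ ↦ hfac w)
          (Finset.prod_nonneg fun w _ ↦ by have := hpi w; positivity) (by positivity)
    _ = _ := by
        rw [Finset.prod_mul_distrib]
        ring

variable (K) in
lemma exists_norm_archInv_le (A : ℝ) : ∃ C : ℝ, 0 ≤ C ∧ ∀ s : ℂ, 1 / 4 ≤ s.re → s.re ≤ A →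
    ‖archInv K s‖ ≤ Real.exp (C * (1 + |s.im|)) := by
  obtain ⟨C, hC, h⟩ := exists_inv_norm_Gamma_le A
  refine ⟨∑ w : InfinitePlace K, (|Real.log (Real.pi * w.mult)| * |A| + C), by positivity,
    fun s h1 h2 ↦ ?_⟩
  rw [norm_archInv, Finset.sum_mul, Real.exp_sum]
  have h3 : |(discr K : ℝ)| ^ (-(s.re / 2)) ≤ 1 :=
    Real.rpow_le_one_of_one_le_of_nonpos one_le_abs_discr (by linarith)
  rw [← one_mul (∏ w : InfinitePlace K, Real.exp _)]
  gcongr with w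
  have hm1 := w.one_le_mult
  have hm2 := mult_le_two w
  have hpi := one_le_pi_mul_mult w
  have h4 := h (s / 2 * w.mult) (by rw [re_half_mul]; nlinarith) (by rw [re_half_mul]; nlinarith)
  have h5 : |(s / 2 * w.mult).im| ≤ |s.im| := by
    rw [im_half_mul, abs_mul, abs_div, abs_two, abs_of_pos (by linarith : 0 < (w.mult : ℝ))]
    nlinarith [abs_nonneg s.im]
  rw [Real.rpow_def_of_pos (by linarith)]
  calc _ ≤ Real.exp (Real.log (Real.pi * w.mult) * (s.re / 2 * w.mult)) *
        Real.exp (C * (1 + |(s / 2 * w.mult).im|)) := by gcongr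
    _ = Real.exp (Real.log (Real.pi * w.mult) * (s.re / 2 * w.mult) +
        C * (1 + |(s / 2 * w.mult).im|)) := (Real.exp_add _ _).symm
    _ ≤ _ := by
      refine Real.exp_le_exp.mpr ?_
      have h6 : Real.log (Real.pi * w.mult) * (s.re / 2 * w.mult) ≤
          |Real.log (Real.pi * w.mult)| * |A| := by
        refine mul_le_mul (le_abs_self _) ?_ (by positivity) (abs_nonneg _)
        have := le_abs_self A
        nlinarith
      have h7 : C * (1 + |(s / 2 * w.mult).im|) ≤ C * (1 + |s.im|) := by gcongr
      have h8 : 0 ≤ |Real.log (Real.pi * w.mult)| * |A| := by positivity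
      nlinarith [mul_nonneg h8 (abs_nonneg s.im)]

end ArchInv

end LargeStrip

namespace LargeStrip

open scoped ComplexConjugate

variable {K : Type} [Field K] [NumberField K]

/-- The completed zeta function, multiplied by `s (s - 1)`. -/
lemma exists_entire_completion {Z : ℂ → ℂ} (hZ : IsDedekindZeta K Z) :
    ∃ W : ℂ → ℂ, Differentiable ℂ W ∧ W 1 ≠ 0 ∧ (∀ s, ‖W (1 - conj s)‖ = ‖W s‖) ∧
      (∀ A : ℝ, ∃ M : ℝ, 0 ≤ M ∧ ∀ s : ℂ, 0 ≤ s.re → s.re ≤ A →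
        ‖W s‖ ≤ M * (‖s‖ * ‖s - 1‖ + 1)) ∧
      ∀ s, s ≠ 0 → s ≠ 1 → Z s = W s * archInv K s / (s * (s - 1)) := by
  obtain ⟨-, Λ, c, hc, hΛ, hfe, hM, hΛZ⟩ := exists_completed hZ
  set W : ℂ → ℂ := fun s ↦ s * (s - 1) * Λ s + c
  have hW : Differentiable ℂ W := by fun_prop
  have hZW (s : ℂ) (h0 : s ≠ 0) (h1 : s ≠ 1) : Z s = W s * archInv K s / (s * (s - 1)) := by
    have h1' := sub_ne_zero.mpr h1
    have h1'' := sub_ne_zero.mpr h1.symm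
    rw [hΛZ s h0 h1]
    simp only [W]
    field_simp
    ring
  have hconj (s : ℂ) : W (conj s) = conj (W s) := by
    have h : Set.EqOn W (conj ∘ W ∘ conj) ∅ᶜ := by
      refine eqOn_of_eq_ofReal Set.countable_empty isClosed_empty (by simp) hW.differentiableOn
        (fun s _ ↦ DifferentiableAt.differentiableWithinAt ?_) fun x hx ↦ ?_
      · simpa using (hW (conj s)).conj_conj
      have h1 : (x : ℂ) ≠ 1 := by exact_mod_cast hx.ne'
      have h0 : (x : ℂ) ≠ 0 := by exact_mod_cast (by linarith : x ≠ 0)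
      have h2 := hZW x h0 h1
      have hA : ((archFactor K x)⁻¹ : ℝ) ≠ 0 := (inv_pos.mpr (archFactor_pos (by linarith))).ne'
      have hA' : (((archFactor K x)⁻¹ : ℝ) : ℂ) ≠ 0 := by exact_mod_cast hA
      have h3 : W x = Z x * (x * (x - 1)) / ((archFactor K x)⁻¹ : ℝ) := by
        rw [h2, archInv_ofReal, div_mul_cancel₀ _ (mul_ne_zero h0 (sub_ne_zero.mpr h1)),
          mul_div_cancel_right₀ _ hA']
      rw [Function.comp_apply, Function.comp_apply, Complex.conj_ofReal, h3,
        dedekindZeta_apply_ofReal hZ hx, map_div₀, map_mul, map_mul, map_sub, map_one]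
      simp only [Complex.conj_ofReal]
    have := h (x := conj s) (by simp)
    simpa using this
  refine ⟨W, hW, by simpa [W] using hc, fun s ↦ ?_, fun A ↦ ?_, hZW⟩
  · have h : W (1 - conj s) = W (conj s) := by
      simp only [W, hfe]
      ring
    rw [h, hconj, RCLike.norm_conj]
  · obtain ⟨M, hM⟩ := hM 0 A
    refine ⟨max |M| ‖c‖, by positivity, fun s h0 h1 ↦ ?_⟩
    calc ‖W s‖ ≤ ‖s * (s - 1) * Λ s‖ + ‖c‖ := norm_add_le _ _
      _ = ‖s‖ * ‖s - 1‖ * ‖Λ s‖ + ‖c‖ := by rw [norm_mul, norm_mul]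
      _ ≤ ‖s‖ * ‖s - 1‖ * max |M| ‖c‖ + max |M| ‖c‖ := by
        gcongr
        · exact (hM s h0 h1).trans ((le_abs_self M).trans (le_max_left _ _))
        · exact le_max_right _ _
      _ = _ := by ring

lemma norm_one_sub_conj_le {s : ℂ} (h : 1 / 4 ≤ s.re) :
    ‖1 - conj s‖ ≤ 3 * ‖s‖ ∧ ‖1 - conj s + 2‖ ≤ 3 * ‖s + 2‖ := by
  simp only [← sq_le_sq₀ (norm_nonneg _) (mul_nonneg zero_le_three (norm_nonneg _)), mul_pow,
    Complex.sq_norm, Complex.normSq_apply, Complex.sub_re, Complex.sub_im, Complex.add_re,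
    Complex.add_im, Complex.conj_re, Complex.conj_im, Complex.one_re, Complex.one_im,
    Complex.re_ofNat, Complex.im_ofNat]
  constructor <;> nlinarith [sq_nonneg s.im]

lemma norm_one_sub_conj_mul (s : ℂ) : ‖(1 - conj s) * (1 - conj s - 1)‖ = ‖s * (s - 1)‖ := by
  rw [← RCLike.norm_conj (s * (s - 1)), map_mul, map_sub, map_one]
  congr 1
  ring

lemma add_reflect (s : ℂ) : s + (1 - 2 * s.re : ℝ) = 1 - conj s := by
  apply Complex.ext <;> simp
  ring

lemma norm_dedekindZeta_reflect_le {Z : ℂ → ℂ} (hZ : IsDedekindZeta K Z) :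
    ∃ C : ℝ, 0 < C ∧ ∀ s : ℂ, -1 ≤ s.re → s.re ≤ 1 / 2 → 1 ≤ |s.im| →
      ‖Z (s + (1 - 2 * s.re : ℝ))‖ ≤ C * ‖Z s‖ := by
  obtain ⟨C, hC, h⟩ := exists_norm_archInv_reflect_le K
  obtain ⟨W, -, -, hWfe, -, hZW⟩ := exists_entire_completion hZ
  refine ⟨C, hC, fun s h1 h2 h3 ↦ ?_⟩
  have hne (z : ℂ) (hz : 1 ≤ |z.im|) : z ≠ 0 ∧ z ≠ 1 := by
    constructor <;> rintro rfl <;> norm_num at hz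
  have hs := h s h1 h2 h3
  rw [add_reflect] at hs ⊢
  obtain ⟨e0, e1⟩ := hne s h3
  obtain ⟨e2, e3⟩ := hne (1 - conj s) (by simpa using h3)
  rw [hZW _ e0 e1, hZW _ e2 e3, norm_div, norm_div, norm_one_sub_conj_mul, norm_mul, norm_mul, hWfe,
    ← mul_div_assoc]
  gcongr ?_ / _
  calc _ ≤ ‖W s‖ * (C * ‖archInv K s‖) := by gcongr
    _ = _ := by rw [norm_mul]; ring

/-- The zeta function with its pole removed. -/
lemma exists_regularized {Z : ℂ → ℂ} (hZ : IsDedekindZeta K Z) : ∃ E : ℂ → ℂ,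
    DifferentiableOn ℂ E {s | 0 < s.re} ∧ E 1 ≠ 0 ∧
    (∀ s : ℂ, 0 < s.re → s ≠ 1 → Z s * ((s - 1) / (s + 2)) = E s) ∧
    (∀ A : ℝ, ∃ C : ℝ, 0 ≤ C ∧ ∀ s : ℂ, 1 / 4 ≤ s.re → s.re ≤ A →
      ‖E s‖ ≤ Real.exp (C * (1 + |s.im|))) ∧
    ∃ C A : ℝ, 0 < C ∧ 0 ≤ A ∧ ∀ s : ℂ, 1 / 4 ≤ s.re → s.re ≤ 1 / 2 →
      ‖E s‖ ≤ C * (|s.im| + 2) ^ (A * (1 / 2 - s.re)) * ‖E (s + (1 - 2 * s.re : ℝ))‖ := by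
  obtain ⟨W, hW, hW1, hWfe, hM, hZW⟩ := exists_entire_completion hZ
  have hne {s : ℂ} (hs : 0 < s.re) : s ≠ 0 ∧ s + 2 ≠ 0 := by
    constructor <;> intro h
    · simp [h] at hs
    · rw [eq_neg_of_add_eq_zero_left h] at hs
      norm_num at hs
  refine ⟨fun s ↦ W s * archInv K s / (s * (s + 2)), fun s hs ↦ ?_, ?_, fun s hs h1 ↦ ?_,
    fun A ↦ ?_, ?_⟩
  · exact ((hW s).mul (differentiable_archInv s)).differentiableWithinAt.div
      (by fun_prop) (mul_ne_zero (hne hs).1 (hne hs).2)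
  · have h1 := archInv_ofReal (K := K) 1
    have h2 : ((archFactor K 1)⁻¹ : ℝ) ≠ 0 := (inv_pos.mpr (archFactor_pos (by norm_num))).ne'
    rw [Complex.ofReal_one] at h1
    refine div_ne_zero (mul_ne_zero hW1 ?_) (by norm_num)
    rw [h1]
    exact_mod_cast h2
  · have h1' := sub_ne_zero.mpr h1
    rw [hZW s (hne hs).1 h1]
    have := (hne hs).1
    have := (hne hs).2
    field_simp
  · obtain ⟨M, hM0, hM⟩ := hM A
    obtain ⟨C, hC, h⟩ := exists_norm_archInv_le K A
    refine ⟨3 * M + C, by positivity, fun s h1 h2 ↦ ?_⟩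
    have h4 : 1 / 4 ≤ ‖s‖ := h1.trans (Complex.re_le_norm s)
    have h5 : 2 ≤ ‖s + 2‖ := by
      have := Complex.re_le_norm (s + 2)
      simp at this
      linarith
    have h6 : ‖s - 1‖ ≤ ‖s + 2‖ := by
      simp only [← sq_le_sq₀ (norm_nonneg _) (norm_nonneg _),
        Complex.sq_norm, Complex.normSq_apply, Complex.sub_re, Complex.sub_im, Complex.add_re,
        Complex.add_im, Complex.one_re, Complex.one_im, Complex.re_ofNat, Complex.im_ofNat]
      nlinarith
    rw [norm_div, norm_mul, norm_mul, div_le_iff₀ (by positivity)]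
    have h7 : M * (‖s‖ * ‖s - 1‖ + 1) ≤ 3 * M * (‖s‖ * ‖s + 2‖) := by
      have : ‖s‖ * ‖s - 1‖ + 1 ≤ 3 * (‖s‖ * ‖s + 2‖) := by nlinarith
      nlinarith
    calc _ ≤ (3 * M * (‖s‖ * ‖s + 2‖)) * Real.exp (C * (1 + |s.im|)) := by
          gcongr
          · exact (hM s (by linarith) h2).trans h7
          · exact h s h1 h2
      _ = (3 * M) * Real.exp (C * (1 + |s.im|)) * (‖s‖ * ‖s + 2‖) := by ring
      _ ≤ Real.exp (3 * M * (1 + |s.im|)) * Real.exp (C * (1 + |s.im|)) *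
          (‖s‖ * ‖s + 2‖) := by
          gcongr
          refine le_trans ?_ (Real.add_one_le_exp _)
          nlinarith [mul_nonneg hM0 (abs_nonneg s.im)]
      _ = _ := by rw [← Real.exp_add]; ring_nf
  · obtain ⟨C, A, hC, hA, h⟩ := exists_norm_archInv_le_reflect K
    refine ⟨9 * C, A, by positivity, hA, fun s h1 h2 ↦ ?_⟩
    have hs := h s h1 h2
    rw [add_reflect] at hs ⊢
    obtain ⟨h3, h4⟩ := norm_one_sub_conj_le h1
    have hs0 : 0 < s.re := by linarith
    have hs1 : 0 < (1 - conj s).re := by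
      rw [Complex.sub_re, Complex.conj_re, Complex.one_re]; linarith
    have p1 := norm_pos_iff.mpr (hne hs0).1
    have p2 := norm_pos_iff.mpr (hne hs0).2
    have p3 := norm_pos_iff.mpr (hne hs1).1
    have p4 := norm_pos_iff.mpr (hne hs1).2
    simp only [norm_div, norm_mul, hWfe]
    rw [div_le_iff₀ (by positivity), mul_div_assoc', div_mul_eq_mul_div,
      le_div_iff₀ (by positivity)]
    set R := (|s.im| + 2) ^ (A * (1 / 2 - s.re))
    have hR : 0 ≤ R := by positivity
    calc ‖W s‖ * ‖archInv K s‖ * (‖1 - conj s‖ * ‖1 - conj s + 2‖)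
        ≤ ‖W s‖ * (C * R * ‖archInv K (1 - conj s)‖) * ((3 * ‖s‖) * (3 * ‖s + 2‖)) := by gcongr
      _ = _ := by ring

end LargeStrip

namespace LargeStrip

variable {K : Type} [Field K] [NumberField K]

variable (K) in
/-- The nonzero ideals. -/
abbrev NzIdeal : Type := {I : Ideal (𝓞 K) // I ≠ ⊥}

variable (K) in
/-- Pairs `(P, k)`, representing the prime power `P ^ (k + 1)`. -/
abbrev PrimePow : Type := {P : Ideal (𝓞 K) // Prime P} × ℕ

/-- The prime power represented by a pair. -/
def PrimePow.ideal (p : PrimePow K) : Ideal (𝓞 K) := p.1.1 ^ (p.2 + 1)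

/-- The logarithm of the norm of the prime. -/
def PrimePow.logNorm (p : PrimePow K) : ℝ := Real.log (Ideal.absNorm p.1.1)

lemma one_le_absNorm {I : Ideal (𝓞 K)} (hI : I ≠ ⊥) : (1 : ℝ) ≤ Ideal.absNorm I := by
  exact_mod_cast Nat.one_le_iff_ne_zero.mpr (Ideal.absNorm_eq_zero_iff.not.mpr hI)

lemma PrimePow.logNorm_nonneg (p : PrimePow K) : 0 ≤ p.logNorm :=
  Real.log_nonneg (one_le_absNorm p.1.2.ne_zero)

lemma PrimePow.ideal_ne_bot {K : Type} [Field K] (p : PrimePow K) : p.ideal ≠ ⊥ :=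
  pow_ne_zero _ p.1.2.ne_zero

lemma hasSum_logNorm {I : Ideal (𝓞 K)} (hI : I ≠ ⊥) :
    HasSum (fun p : PrimePow K ↦ if p.ideal ∣ I then p.logNorm else 0)
      (Real.log (Ideal.absNorm I)) := by
  induction I using UniqueFactorizationMonoid.induction_on_prime with
  | h₁ => exact absurd rfl hI
  | h₂ I hu =>
    rw [Ideal.isUnit_iff.mp hu, Ideal.absNorm_top, Nat.cast_one, Real.log_one]
    convert! hasSum_zero using 2 with p
    rw [if_neg]
    intro h
    have := isUnit_of_dvd_unit h (Ideal.isUnit_iff.mpr rfl)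
    exact p.1.2.not_isUnit ((isUnit_pow_iff (Nat.succ_ne_zero _)).mp this)
  | h₃ J P hJ hP ih =>
    have h1 : 0 < (Ideal.absNorm P : ℝ) := by linarith [one_le_absNorm hP.ne_zero]
    have h2 : 0 < (Ideal.absNorm J : ℝ) := by linarith [one_le_absNorm hJ]
    rw [map_mul, Nat.cast_mul, Real.log_mul h1.ne' h2.ne']
    have hfin : FiniteMultiplicity P J := FiniteMultiplicity.of_prime_left hP hJ
    convert! (hasSum_ite_eq ((⟨P, hP⟩, multiplicity P J) : PrimePow K)
      (Real.log (Ideal.absNorm P))).add (ih hJ) using 2 with p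
    obtain ⟨⟨Q, hQ⟩, k⟩ := p
    simp only [PrimePow.ideal, PrimePow.logNorm, pow_dvd_iff_le_emultiplicity,
      emultiplicity_mul hQ, Prod.mk.injEq, Subtype.mk.injEq]
    by_cases h : Q = P
    · subst h
      rw [(FiniteMultiplicity.of_prime_left hQ hQ.ne_zero).emultiplicity_self,
        hfin.emultiplicity_eq_multiplicity]
      norm_cast
      rcases lt_trichotomy k (multiplicity Q J) with h | h | h
      · rw [if_pos (by omega), if_neg (by simp [h.ne]), if_pos (by omega), zero_add]
      · rw [if_pos (by omega), if_pos (by simp [h]), if_neg (by omega), add_zero]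
      · rw [if_neg (by omega), if_neg (by simp [h.ne']), if_neg (by omega), zero_add]
    · have : emultiplicity Q P = 0 := emultiplicity_eq_zero.mpr fun hd ↦
        h (associated_iff_eq.mp ((hQ.dvd_prime_iff_associated hP).mp hd))
      simp [this, h]

lemma norm_absNorm_cpow {I : Ideal (𝓞 K)} (hI : I ≠ ⊥) (s : ℂ) :
    ‖(Ideal.absNorm I : ℂ) ^ (-s)‖ = (Ideal.absNorm I : ℝ) ^ (-s.re) := by
  rw [← Complex.ofReal_natCast, Complex.norm_cpow_eq_rpow_re_of_pos
    (by linarith [one_le_absNorm hI]), Complex.neg_re]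

variable {Z : ℂ → ℂ}

lemma summable_dedekindZeta (hZ : IsDedekindZeta K Z) {s : ℂ} (hs : 1 < s.re) :
    Summable fun I : NzIdeal K ↦ (Ideal.absNorm I.1 : ℂ) ^ (-s) :=
  .of_norm (((exists_completed hZ).1 s.re hs).congr fun I ↦ (norm_absNorm_cpow I.2 s).symm)

lemma hasSum_neg_deriv (hZ : IsDedekindZeta K Z) {s : ℂ} (hs : 1 < s.re) :
    HasSum (fun I : NzIdeal K ↦ Real.log (Ideal.absNorm I.1) * (Ideal.absNorm I.1 : ℂ) ^ (-s))
      (-deriv Z s) := by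
  obtain ⟨σ, h1, hσ⟩ := exists_between hs
  have hne (I : NzIdeal K) : (Ideal.absNorm I.1 : ℂ) ≠ 0 := by
    have := one_le_absNorm I.2
    exact_mod_cast (by linarith : (Ideal.absNorm I.1 : ℝ) ≠ 0)
  have hd (I : NzIdeal K) (w : ℂ) : HasDerivAt (fun w ↦ (Ideal.absNorm I.1 : ℂ) ^ (-w))
      ((Ideal.absNorm I.1 : ℂ) ^ (-w) * Complex.log (Ideal.absNorm I.1 : ℂ) * -1) w :=
    (hasDerivAt_neg w).const_cpow (.inl (hne I))
  have hU : IsOpen {w : ℂ | σ < w.re} := isOpen_lt continuous_const Complex.continuous_re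
  have h2 := Complex.hasSum_deriv_of_summable_norm ((exists_completed hZ).1 σ h1)
    (fun I ↦ fun w _ ↦ (hd I w).differentiableAt.differentiableWithinAt) hU
    (fun I w hw ↦ (norm_absNorm_cpow I.2 w).trans_le
      (Real.rpow_le_rpow_of_exponent_le (one_le_absNorm I.2) (neg_le_neg hw.le))) hσ
  have h3 : Z =ᶠ[𝓝 s] fun w ↦ ∑' I : NzIdeal K, (Ideal.absNorm I.1 : ℂ) ^ (-w) := by
    filter_upwards [hU.mem_nhds hσ] with w hw using hZ.2 w (h1.trans hw)
  rw [h3.deriv_eq]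
  convert! h2.neg using 2 with I
  rw [(hd I s).deriv, ← Complex.natCast_log]
  ring

/-- The map `(I, p) ↦ (p I, p)`. -/
def mulPair (q : NzIdeal K × PrimePow K) : NzIdeal K × PrimePow K :=
  (⟨q.2.ideal * q.1.1, mul_ne_zero q.2.ideal_ne_bot q.1.2⟩, q.2)

lemma mulPair_injective : Function.Injective (mulPair (K := K)) := by
  rintro ⟨⟨I, hI⟩, p⟩ ⟨⟨J, hJ⟩, q⟩ h
  simp only [mulPair, Prod.mk.injEq, Subtype.mk.injEq] at h
  obtain ⟨h, rfl⟩ := h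
  simpa using mul_left_cancel₀ p.ideal_ne_bot h

lemma mem_range_mulPair {K : Type} [Field K] {q : NzIdeal K × PrimePow K} :
    q ∈ Set.range (mulPair (K := K)) ↔ q.2.ideal ∣ q.1.1 := by
  constructor
  · rintro ⟨q, rfl⟩
    exact dvd_mul_right _ _
  · obtain ⟨⟨I, hI⟩, p⟩ := q
    rintro ⟨J, h⟩
    replace h : I = p.ideal * J := h
    subst h
    exact ⟨(⟨J, right_ne_zero_of_mul hI⟩, p), rfl⟩

lemma absNorm_mulPair (q : NzIdeal K × PrimePow K) :
    Ideal.absNorm (mulPair q).1.1 = Ideal.absNorm q.2.ideal * Ideal.absNorm q.1.1 :=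
  map_mul _ _ _

/-- The logarithmic derivative of the Dedekind zeta function as a Dirichlet series. -/
lemma exists_hasSum_neg_deriv (hZ : IsDedekindZeta K Z) {s : ℂ} (hs : 1 < s.re) :
    ∃ D, HasSum (fun p : PrimePow K ↦ p.logNorm * (Ideal.absNorm p.ideal : ℂ) ^ (-s)) D ∧
      -deriv Z s = D * Z s := by
  set f : NzIdeal K × PrimePow K → ℂ := fun q ↦
    if q.2.ideal ∣ q.1.1 then q.2.logNorm * (Ideal.absNorm q.1.1 : ℂ) ^ (-s) else 0
  have hf (I : NzIdeal K) : HasSum (fun p ↦ f (I, p))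
      (Real.log (Ideal.absNorm I.1) * (Ideal.absNorm I.1 : ℂ) ^ (-s)) := by
    convert! ((Complex.hasSum_ofReal.mpr (hasSum_logNorm I.2)).mul_right
      ((Ideal.absNorm I.1 : ℂ) ^ (-s))) using 2 with p
    simp only [f]
    split <;> simp
  have hfn (I : NzIdeal K) : HasSum (fun p ↦ ‖f (I, p)‖)
      (Real.log (Ideal.absNorm I.1) * ‖(Ideal.absNorm I.1 : ℂ) ^ (-s)‖) := by
    convert! (hasSum_logNorm I.2).mul_right ‖(Ideal.absNorm I.1 : ℂ) ^ (-s)‖ using 2 with p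
    simp only [f]
    split
    · rw [norm_mul, Complex.norm_real, Real.norm_of_nonneg p.logNorm_nonneg]
    · simp
  have hfs : Summable f := by
    refine .of_norm ((summable_prod_of_nonneg fun _ ↦ norm_nonneg _).mpr
      ⟨fun I ↦ (hfn I).summable, ?_⟩)
    refine (hasSum_neg_deriv hZ hs).summable.norm.congr fun I ↦ ?_
    rw [(hfn I).tsum_eq, norm_mul, Complex.norm_real,
      Real.norm_of_nonneg (Real.log_nonneg (one_le_absNorm I.2))]
  have hfsum : HasSum f (-deriv Z s) := by
    rw [(hasSum_neg_deriv hZ hs).unique (hfs.hasSum.prod_fiberwise hf)]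
    exact hfs.hasSum
  have hg : f ∘ mulPair = fun q ↦ (Ideal.absNorm q.1.1 : ℂ) ^ (-s) *
      (q.2.logNorm * (Ideal.absNorm q.2.ideal : ℂ) ^ (-s)) := by
    ext q
    simp only [Function.comp_apply, f]
    rw [if_pos (mem_range_mulPair.mp ⟨q, rfl⟩), absNorm_mulPair, Nat.cast_mul,
      Complex.natCast_mul_natCast_cpow]
    simp only [mulPair]
    ring
  have hgsum : HasSum (f ∘ mulPair) (-deriv Z s) := by
    refine (mulPair_injective.hasSum_iff fun q hq ↦ ?_).mpr hfsum
    exact if_neg (mem_range_mulPair.not.mp hq)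
  rw [hg] at hgsum
  have h1 : Summable fun p : PrimePow K ↦ p.logNorm * (Ideal.absNorm p.ideal : ℂ) ^ (-s) := by
    have := hgsum.summable.prod_factor ⟨⊤, top_ne_bot⟩
    simpa using this
  refine ⟨_, h1.hasSum, ?_⟩
  have h2 := hgsum.prod_fiberwise fun I ↦ h1.hasSum.mul_left ((Ideal.absNorm I.1 : ℂ) ^ (-s))
  have h3 := (summable_dedekindZeta hZ hs).hasSum.mul_right
    (∑' p : PrimePow K, p.logNorm * (Ideal.absNorm p.ideal : ℂ) ^ (-s))
  rw [h2.unique h3, mul_comm, hZ.2 s hs]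

end LargeStrip

namespace LargeStrip

variable {K : Type} [Field K] [NumberField K] {Z : ℂ → ℂ}

lemma exists_norm_dedekindZeta_sub_one_le (hZ : IsDedekindZeta K Z) :
    ∃ C : ℝ, 0 ≤ C ∧ ∀ s : ℂ, 2 ≤ s.re → ‖Z s - 1‖ ≤ C * 2 ^ (-s.re) := by
  have h2 := (exists_completed hZ).1 2 one_lt_two
  refine ⟨(∑' I : NzIdeal K, (Ideal.absNorm I.1 : ℝ) ^ (-2 : ℝ)) * 2 ^ (2 : ℝ),
    mul_nonneg (tsum_nonneg fun I ↦ by positivity) (by positivity), fun s hs ↦ ?_⟩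
  have h1 : Z s - 1 = ∑' I : NzIdeal K,
      if I = ⟨⊤, top_ne_bot⟩ then 0 else (Ideal.absNorm I.1 : ℂ) ^ (-s) := by
    rw [hZ.2 s (by linarith), (summable_dedekindZeta hZ (by linarith)).tsum_eq_add_tsum_ite
      ⟨⊤, top_ne_bot⟩]
    simp
  rw [h1, mul_assoc, ← tsum_mul_right]
  refine tsum_of_norm_bounded (h2.mul_right _).hasSum fun I ↦ ?_
  split_ifs with hI
  · rw [norm_zero]; positivity
  · rw [norm_absNorm_cpow I.2]
    have h3 : 2 ≤ (Ideal.absNorm I.1 : ℝ) := by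
      have e1 := Ideal.absNorm_eq_zero_iff.not.mpr I.2
      have e2 := Ideal.absNorm_eq_one_iff.not.mpr fun h ↦ hI (Subtype.ext h)
      exact_mod_cast (by omega : 2 ≤ Ideal.absNorm I.1)
    have h4 : (Ideal.absNorm I.1 : ℝ) ^ (2 - s.re) ≤ 2 ^ (2 - s.re) :=
      Real.rpow_le_rpow_of_nonpos two_pos h3 (by linarith)
    calc (Ideal.absNorm I.1 : ℝ) ^ (-s.re)
        = (Ideal.absNorm I.1 : ℝ) ^ (-2 : ℝ) * (Ideal.absNorm I.1 : ℝ) ^ (2 - s.re) := by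
          rw [← Real.rpow_add (by linarith)]; ring_nf
      _ ≤ (Ideal.absNorm I.1 : ℝ) ^ (-2 : ℝ) * 2 ^ (2 - s.re) := by gcongr
      _ = _ := by rw [← Real.rpow_add two_pos]; ring_nf

lemma tendsto_dedekindZeta_atTop (hZ : IsDedekindZeta K Z) (y : ℝ) :
    Tendsto (fun σ : ℝ ↦ Z (σ + Complex.I * y)) atTop (𝓝 1) := by
  obtain ⟨C, -, hC⟩ := exists_norm_dedekindZeta_sub_one_le hZ
  rw [tendsto_iff_norm_sub_tendsto_zero]
  refine squeeze_zero' (.of_forall fun _ ↦ norm_nonneg _) (g := fun σ : ℝ ↦ C * 2 ^ (-σ)) ?_ ?_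
  · filter_upwards [eventually_ge_atTop 2] with σ hσ
    have hre : (σ + Complex.I * y : ℂ).re = σ := by simp
    simpa [hre] using hC (σ + Complex.I * y) (by rw [hre]; exact hσ)
  · simpa using ((tendsto_rpow_atBot_of_base_gt_one 2 one_lt_two).comp
      tendsto_neg_atTop_atBot).const_mul C

lemma three_four_one_re_nonneg {N : ℕ} (hN : N ≠ 0) (σ y : ℝ) :
    0 ≤ (3 * (N : ℂ) ^ (-(σ + Complex.I * (0 : ℝ) : ℂ)) +
      4 * (N : ℂ) ^ (-(σ + Complex.I * y : ℂ)) +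
      (N : ℂ) ^ (-(σ + Complex.I * (2 * y : ℝ) : ℂ))).re := by
  have hN' : (N : ℂ) ≠ 0 := by exact_mod_cast hN
  have h (x : ℝ) : ((N : ℂ) ^ (-(σ + Complex.I * x : ℂ))).re =
      Real.exp (-(Real.log N * σ)) * Real.cos (x * Real.log N) := by
    have h1 : (Real.log N : ℂ) * -(σ + Complex.I * x) =
        (-(Real.log N * σ) : ℝ) + (-(x * Real.log N) : ℝ) * Complex.I := by push_cast; ring
    rw [Complex.cpow_def_of_ne_zero hN', ← Complex.natCast_log, h1, Complex.exp_re,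
      Complex.add_re, Complex.add_im, Complex.ofReal_re, Complex.ofReal_im,
      Complex.re_ofReal_mul, Complex.im_ofReal_mul, Complex.I_re, Complex.I_im, mul_zero, mul_one,
      add_zero, zero_add, Real.cos_neg]
  have h3 (z : ℂ) : (3 * z).re = 3 * z.re := by simp
  have h4 (z : ℂ) : (4 * z).re = 4 * z.re := by simp
  rw [Complex.add_re, Complex.add_re, h3, h4, h, h, h, mul_assoc 2 y, Real.cos_two_mul, zero_mul,
    Real.cos_zero]
  have := mul_nonneg (Real.exp_pos (-(Real.log N * σ))).le
    (sq_nonneg (1 + Real.cos (y * Real.log N)))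
  linarith

/-- The product in the Hadamard–de la Vallée Poussin argument. -/
def hadamardProd (Z : ℂ → ℂ) (y σ : ℝ) : ℂ :=
  Z (σ + Complex.I * (0 : ℝ)) ^ 3 * Z (σ + Complex.I * y) ^ 4 * Z (σ + Complex.I * (2 * y : ℝ))

lemma exists_hasDerivAt_hadamardProd (hZ : IsDedekindZeta K Z) (y : ℝ) {σ : ℝ} (hσ : 1 < σ) :
    ∃ G : ℂ, 0 ≤ G.re ∧ HasDerivAt (hadamardProd Z y) (-(hadamardProd Z y σ * G)) σ := by
  have hre (x : ℝ) : 1 < (σ + Complex.I * x : ℂ).re := by simpa using hσ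
  have hd (x : ℝ) : HasDerivAt (fun σ : ℝ ↦ Z (σ + Complex.I * x))
      (deriv Z (σ + Complex.I * x)) σ := by
    have h1 : HasDerivAt (fun s : ℂ ↦ Z (s + Complex.I * x)) (deriv Z (σ + Complex.I * x)) σ := by
      refine HasDerivAt.comp_add_const (σ : ℂ) (Complex.I * x) (hZ.1 _ ?_).hasDerivAt
      intro h
      have := hre x
      rw [h] at this
      simp at this
    exact h1.comp_ofReal
  obtain ⟨D0, h0, e0⟩ := exists_hasSum_neg_deriv hZ (hre 0)
  obtain ⟨D1, h1, e1⟩ := exists_hasSum_neg_deriv hZ (hre y)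
  obtain ⟨D2, h2, e2⟩ := exists_hasSum_neg_deriv hZ (hre (2 * y))
  refine ⟨3 * D0 + 4 * D1 + D2, ?_, ?_⟩
  · have h3 := Complex.hasSum_re (((h0.mul_left 3).add (h1.mul_left 4)).add h2)
    refine h3.nonneg fun p ↦ ?_
    have h4 := mul_nonneg p.logNorm_nonneg (three_four_one_re_nonneg
      (Ideal.absNorm_eq_zero_iff.not.mpr p.ideal_ne_bot) σ y)
    rw [← Complex.re_ofReal_mul] at h4
    convert h4 using 2
    ring
  · have h3 := (((hd 0).pow 3).mul ((hd y).pow 4)).mul (hd (2 * y))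
    rw [neg_eq_iff_eq_neg] at e0 e1 e2
    rw [e0, e1, e2] at h3
    refine h3.congr_deriv ?_
    simp only [hadamardProd, Pi.pow_apply, Pi.mul_apply]
    push_cast
    ring

lemma one_le_norm_hadamardProd (hZ : IsDedekindZeta K Z) (y : ℝ) {σ : ℝ} (hσ : 1 < σ) :
    1 ≤ ‖hadamardProd Z y σ‖ := by
  have hanti : AntitoneOn (fun σ ↦ ‖hadamardProd Z y σ‖ ^ 2) (Set.Ioi 1) := by
    have hd {σ : ℝ} (hσ : 1 < σ) : ∃ d ≤ 0, HasDerivAt (fun σ ↦ ‖hadamardProd Z y σ‖ ^ 2) d σ := by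
      obtain ⟨G, hG, h⟩ := exists_hasDerivAt_hadamardProd hZ y hσ
      refine ⟨_, ?_, h.norm_sq⟩
      have h1 : hadamardProd Z y σ * G * (starRingEnd ℂ) (hadamardProd Z y σ) =
          (Complex.normSq (hadamardProd Z y σ) : ℝ) * G := by
        rw [← Complex.mul_conj]
        ring
      rw [inner_neg_right, Complex.inner, h1, Complex.re_ofReal_mul]
      nlinarith [mul_nonneg (Complex.normSq_nonneg (hadamardProd Z y σ)) hG]
    refine antitoneOn_of_deriv_nonpos (convex_Ioi 1) (fun σ hσ ↦ ?_) (fun σ hσ ↦ ?_) fun σ hσ ↦ ?_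
    · obtain ⟨d, -, h⟩ := hd hσ
      exact h.continuousAt.continuousWithinAt
    · rw [interior_Ioi] at hσ
      obtain ⟨d, -, h⟩ := hd hσ
      exact h.differentiableAt.differentiableWithinAt
    · rw [interior_Ioi] at hσ
      obtain ⟨d, h0, h⟩ := hd hσ
      exact h.deriv.trans_le h0
  have hlim : Tendsto (fun σ ↦ ‖hadamardProd Z y σ‖ ^ 2) atTop (𝓝 1) := by
    have h := ((((tendsto_dedekindZeta_atTop hZ 0).pow 3).mul
      ((tendsto_dedekindZeta_atTop hZ y).pow 4)).mul
      (tendsto_dedekindZeta_atTop hZ (2 * y))).norm.pow 2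
    simpa [hadamardProd] using h
  have h1 : 1 ≤ ‖hadamardProd Z y σ‖ ^ 2 := by
    refine le_of_tendsto hlim ?_
    filter_upwards [eventually_ge_atTop σ] with τ hτ using hanti hσ (hσ.trans_le hτ) hτ
  exact (one_le_sq_iff₀ (norm_nonneg _)).mp h1

/-- The Dedekind zeta function has no zeros with `1 ≤ re s`. -/
lemma dedekindZeta_ne_zero (hZ : IsDedekindZeta K Z) {s : ℂ} (hs : 1 ≤ s.re) (hs1 : s ≠ 1) :
    Z s ≠ 0 := by
  intro h0
  have hs_eq : (s.re + Complex.I * s.im : ℂ) = s := by rw [mul_comm, Complex.re_add_im]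
  rcases hs.lt_or_eq with hs' | hs'
  · have := one_le_norm_hadamardProd hZ s.im hs'
    rw [hadamardProd, hs_eq, h0] at this
    norm_num at this
  obtain ⟨E, hE, -, hZE, -⟩ := exists_regularized hZ
  rw [← hs', Complex.ofReal_one] at hs_eq
  set y := s.im
  have hy : y ≠ 0 := by
    rintro hy
    rw [hy, Complex.ofReal_zero, mul_zero, add_zero] at hs_eq
    exact hs1 hs_eq.symm
  have hd (x : ℝ) (hx : x ≠ 0) : HasDerivAt (fun σ : ℝ ↦ Z (σ + Complex.I * x))
      (deriv Z (1 + Complex.I * x)) 1 := by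
    have h1 : HasDerivAt (fun s : ℂ ↦ Z (s + Complex.I * x)) (deriv Z (1 + Complex.I * x))
        (1 : ℝ) := by
      rw [Complex.ofReal_one]
      refine HasDerivAt.comp_add_const (1 : ℂ) (Complex.I * x) (hZ.1 _ ?_).hasDerivAt
      simpa using hx
    exact h1.comp_ofReal
  have hlim1 : Tendsto (fun σ : ℝ ↦ ((σ - 1 : ℝ) : ℂ)⁻¹ * Z (σ + Complex.I * y)) (𝓝[>] 1)
      (𝓝 (deriv Z (1 + Complex.I * y))) := by
    have := (hasDerivAt_iff_tendsto_slope.mp (hd y hy)).mono_left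
      (nhdsGT_le_nhdsNE (1 : ℝ))
    refine this.congr fun σ ↦ ?_
    rw [slope_def_module, Complex.ofReal_one, hs_eq, h0, sub_zero, Complex.real_smul,
      Complex.ofReal_inv]
  have hlim2 : Tendsto (fun σ : ℝ ↦ ((σ - 1 : ℝ) : ℂ) * Z (σ + Complex.I * (0 : ℝ))) (𝓝[>] 1)
      (𝓝 (E 1 * (1 + 2))) := by
    have hEc : ContinuousAt (fun σ : ℝ ↦ E σ * (σ + 2)) 1 := by
      have h1 : ContinuousAt E ((1 : ℝ) : ℂ) := (hE.differentiableAt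
        ((isOpen_lt continuous_const Complex.continuous_re).mem_nhds (by simp))).continuousAt
      exact (ContinuousAt.comp (g := E) h1 Complex.continuous_ofReal.continuousAt).mul
        (by fun_prop)
    have := hEc.tendsto.mono_left (nhdsWithin_le_nhds (s := Set.Ioi 1))
    rw [Complex.ofReal_one] at this
    refine this.congr' ?_
    filter_upwards [self_mem_nhdsWithin] with σ hσ
    have hσ' : (1 : ℝ) < σ := hσ
    rw [← hZE σ (by simpa using by linarith) (by exact_mod_cast hσ'.ne')]
    have : (σ + 2 : ℂ) ≠ 0 := by exact_mod_cast (by linarith : σ + 2 ≠ 0)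
    push_cast
    field_simp
    rw [mul_zero, add_zero, mul_comm]
  have hlim3 : Tendsto (fun σ : ℝ ↦ Z (σ + Complex.I * (2 * y : ℝ))) (𝓝[>] 1)
      (𝓝 (Z (1 + Complex.I * (2 * y : ℝ)))) := by
    have := (hd (2 * y) (by positivity)).continuousAt.tendsto.mono_left
      (nhdsWithin_le_nhds (s := Set.Ioi 1))
    simpa using this
  have hlim4 : Tendsto (fun σ : ℝ ↦ ((σ - 1 : ℝ) : ℂ)) (𝓝[>] 1) (𝓝 0) := by
    have : Continuous fun σ : ℝ ↦ ((σ - 1 : ℝ) : ℂ) := by fun_prop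
    have := this.continuousAt.tendsto.mono_left (nhdsWithin_le_nhds (a := 1) (s := Set.Ioi 1))
    simpa using this
  have hlim := ((((hlim2.pow 3).mul (hlim1.pow 4)).mul hlim3).mul hlim4).norm
  rw [mul_zero, norm_zero] at hlim
  refine absurd (ge_of_tendsto hlim ?_) (by norm_num : ¬ (1 : ℝ) ≤ 0)
  filter_upwards [self_mem_nhdsWithin] with σ hσ
  have hσ' : (1 : ℝ) < σ := hσ
  refine (one_le_norm_hadamardProd hZ y hσ').trans_eq ?_
  have : (σ - 1 : ℂ) ≠ 0 := by exact_mod_cast (sub_pos.mpr hσ').ne'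
  rw [hadamardProd]
  congr 1
  push_cast
  field_simp

end LargeStrip

namespace LargeStrip

/-- The properties of a regularized zeta function needed for Littlewood's bounds. -/
structure IsRegularized (E : ℂ → ℂ) (σ₁ C A : ℝ) : Prop where
  two_le : 2 ≤ σ₁
  one_le : 1 ≤ C
  nonneg : 0 ≤ A
  differentiableOn : DifferentiableOn ℂ E {s | 0 < s.re}
  ne_zero : ∀ s, 1 / 2 < s.re → E s ≠ 0
  norm_sub_one_le : ∀ s, σ₁ - 1 ≤ s.re → ‖E s - 1‖ ≤ 3 / 4
  norm_le_exp : ∀ s, 1 / 4 ≤ s.re → ‖E s‖ ≤ Real.exp (C * (1 + |s.im|))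
  norm_le_reflect : ∀ s, 1 / 4 ≤ s.re → s.re ≤ 1 / 2 →
    ‖E s‖ ≤ C * (|s.im| + 2) ^ (A * (1 / 2 - s.re)) * ‖E (s + (1 - 2 * s.re : ℝ))‖

lemma exists_isRegularized {K : Type} [Field K] [NumberField K] {Z : ℂ → ℂ}
    (hZ : IsDedekindZeta K Z) (hRH : ZetaRH Z) : ∃ E σ₁ C A, IsRegularized E σ₁ C A ∧
      ∀ s : ℂ, 0 < s.re → s ≠ 1 → Z s * ((s - 1) / (s + 2)) = E s := by
  obtain ⟨E, hE, hE1, hZE, hcr, C₂, A, hC₂, hA, hfe⟩ := exists_regularized hZ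
  obtain ⟨C₀, hC₀, h1⟩ := exists_norm_dedekindZeta_sub_one_le hZ
  have h2 : Tendsto (fun σ : ℝ ↦ C₀ * 2 ^ (-σ)) atTop (𝓝 0) := by
    simpa using ((tendsto_rpow_atBot_of_base_gt_one 2 one_lt_two).comp
      tendsto_neg_atTop_atBot).const_mul C₀
  obtain ⟨σ₀, h3, h4⟩ := ((eventually_ge_atTop (12 : ℝ)).and
    (h2.eventually_le_const (by norm_num : (0 : ℝ) < 1 / 4))).exists
  have hnorm (s : ℂ) (hs : σ₀ ≤ s.re) : ‖E s - 1‖ ≤ 3 / 4 := by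
    have hs1 : s ≠ 1 := by
      rintro rfl
      norm_num at hs
      linarith
    have hs2 : s + 2 ≠ 0 := by
      intro h
      rw [eq_neg_of_add_eq_zero_left h] at hs
      norm_num at hs
      linarith
    have h5 : ‖Z s - 1‖ ≤ 1 / 4 := by
      refine (h1 s (by linarith)).trans (le_trans ?_ h4)
      gcongr
      norm_num
    have h6 : ‖3 / (s + 2)‖ ≤ 1 / 4 := by
      have := Complex.re_le_norm (s + 2)
      rw [Complex.add_re, Complex.re_ofNat] at this
      rw [norm_div, div_le_iff₀ (by linarith), Complex.norm_ofNat]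
      linarith
    have h7 : E s - 1 = (Z s - 1) - (Z s - 1) * (3 / (s + 2)) - 3 / (s + 2) := by
      rw [← hZE s (by linarith) hs1]
      field_simp
      ring
    calc ‖E s - 1‖ ≤ ‖Z s - 1‖ + ‖Z s - 1‖ * ‖3 / (s + 2)‖ + ‖3 / (s + 2)‖ := by
          rw [h7, ← norm_mul]
          exact (norm_sub_le _ _).trans (by gcongr; exact norm_sub_le _ _)
      _ ≤ 1 / 4 + 1 / 4 * (1 / 4) + 1 / 4 := by gcongr
      _ ≤ _ := by norm_num
  obtain ⟨C₁, hC₁, hcr⟩ := hcr σ₀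
  refine ⟨E, σ₀ + 1, 1 + C₁ + C₂, A, ⟨by linarith, by linarith, hA, hE, fun s hs ↦ ?_,
    fun s hs ↦ hnorm s (by linarith), fun s hs ↦ ?_, fun s h5 h6 ↦ ?_⟩, hZE⟩
  · rcases eq_or_ne s 1 with rfl | hs1
    · exact hE1
    rw [← hZE s (by linarith) hs1]
    refine mul_ne_zero ?_ (div_ne_zero (sub_ne_zero.mpr hs1) fun h ↦ ?_)
    · rcases le_or_gt 1 s.re with h | h
      · exact dedekindZeta_ne_zero hZ h hs1
      · exact fun h0 ↦ hs.ne' (hRH s h0 (by linarith) h)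
    · rw [eq_neg_of_add_eq_zero_left h] at hs
      norm_num at hs
  · rcases le_total s.re σ₀ with h | h
    · refine (hcr s hs h).trans (Real.exp_le_exp.mpr ?_)
      gcongr
      linarith
    · have h5 : ‖E s‖ ≤ 1 + 1 := by
        calc ‖E s‖ = ‖1 + (E s - 1)‖ := by ring_nf
          _ ≤ ‖(1 : ℂ)‖ + ‖E s - 1‖ := norm_add_le _ _
          _ ≤ _ := by rw [norm_one]; linarith [hnorm s h]
      refine h5.trans ((Real.add_one_le_exp 1).trans (Real.exp_le_exp.mpr ?_))
      nlinarith [abs_nonneg s.im]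
  · refine (hfe s h5 h6).trans ?_
    gcongr
    linarith

end LargeStrip

namespace LargeStrip

lemma exists_differentiableOn_log {U : Set ℂ} (hU : IsOpen U) (hc : Convex ℝ U)
    (hne : U.Nonempty) {E : ℂ → ℂ} (hE : DifferentiableOn ℂ E U) (h0 : ∀ s ∈ U, E s ≠ 0) :
    ∃ F, DifferentiableOn ℂ F U ∧ ∀ s ∈ U, Complex.exp (F s) = E s := by
  have : ContractibleSpace U := hc.contractibleSpace hne
  have hsc : IsSimplyConnected U := inferInstanceAs (SimplyConnectedSpace U)
  obtain ⟨F, hFc, hF⟩ := exists_continuousOn_eqOn_exp_comp hsc hU hE.continuousOn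
    (by rintro ⟨s, hs, h⟩; exact h0 s hs h)
  refine ⟨F, fun s hs ↦ DifferentiableAt.differentiableWithinAt ?_, fun s hs ↦ hF hs⟩
  have hUs := hU.mem_nhds hs
  have hFs := (hFc s hs).continuousAt hUs
  have hd : DifferentiableAt ℂ (fun z ↦ F s + Complex.log (E z / E s)) s := by
    refine (differentiableAt_const _).add (DifferentiableAt.clog
      (((hE s hs).differentiableAt hUs).div_const _) ?_)
    rw [div_self (h0 s hs)]
    exact one_mem_slitPlane
  refine hd.congr_of_eventuallyEq ?_
  have hb : ∀ᶠ z in 𝓝 s, dist (F z) (F s) < 1 := Metric.tendsto_nhds.1 hFs 1 one_pos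
  filter_upwards [hb, hUs] with z hz hzU
  have him : |(F z - F s).im| < 1 :=
    (Complex.abs_im_le_norm _).trans_lt (by rwa [dist_eq_norm] at hz)
  rw [← hF hzU, ← hF hs, Function.comp_apply, Function.comp_apply, ← Complex.exp_sub,
    Complex.log_exp (by linarith [(abs_lt.1 him).1, Real.pi_gt_three])
      (by linarith [(abs_lt.1 him).2, Real.pi_gt_three])]
  ring

/-- The Phragmén–Lindelöf principle on a vertical strip for functions of exponential type. -/
lemma norm_le_of_strip {f : ℂ → ℂ} {a b C M : ℝ} (hab : a < b)
    (hf : ∀ s, a ≤ s.re → s.re ≤ b → DifferentiableAt ℂ f s)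
    (hC : ∀ s, a ≤ s.re → s.re ≤ b → ‖f s‖ ≤ Real.exp (C * (1 + |s.im|)))
    (hl : ∀ s : ℂ, s.re = a → ‖f s‖ ≤ M) (hr : ∀ s : ℂ, s.re = b → ‖f s‖ ≤ M)
    {s : ℂ} (has : a ≤ s.re) (hsb : s.re ≤ b) : ‖f s‖ ≤ M := by
  have hba : 0 < b - a := sub_pos.2 hab
  have hcl : closure (re ⁻¹' Set.Ioo a b) ⊆ re ⁻¹' Set.Icc a b :=
    closure_minimal (Set.preimage_mono Set.Ioo_subset_Icc_self)
      (isClosed_Icc.preimage Complex.continuous_re)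
  set c := Real.pi / (2 * (b - a)) with hc
  have hc0 : 0 < c := by positivity
  refine PhragmenLindelof.vertical_strip (DifferentiableOn.diffContOnCl
    fun z hz ↦ (hf z (hcl hz).1 (hcl hz).2).differentiableWithinAt)
    ⟨c, ?_, |C| * (1 + 1 / c), ?_⟩ hl hr has hsb
  · rw [hc, div_lt_div_iff_of_pos_left Real.pi_pos (by positivity) hba]
    linarith
  · refine Asymptotics.IsBigO.of_bound 1 ?_
    filter_upwards [mem_inf_of_right (mem_principal_self _)] with z hz
    rw [one_mul, Real.norm_of_nonneg (Real.exp_nonneg _)]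
    refine (hC z hz.1.le hz.2.le).trans (Real.exp_le_exp.2 ?_)
    have h1 : c * |z.im| ≤ Real.exp (c * |z.im|) := by
      linarith [Real.add_one_le_exp (c * |z.im|)]
    have h2 : |z.im| ≤ 1 / c * Real.exp (c * |z.im|) := by
      rw [one_div, inv_mul_eq_div, le_div_iff₀ hc0]; linarith
    have h3 : 1 ≤ Real.exp (c * |z.im|) := Real.one_le_exp (by positivity)
    calc C * (1 + |z.im|) ≤ |C| * (1 + |z.im|) :=
          mul_le_mul_of_nonneg_right (le_abs_self C) (by positivity)
      _ ≤ |C| * (Real.exp (c * |z.im|) + 1 / c * Real.exp (c * |z.im|)) := by gcongr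
      _ = _ := by ring

end LargeStrip

namespace LargeStrip

/-- The Borel–Carathéodory theorem on a disc with arbitrary centre. -/
lemma norm_le_of_re_le {F : ℂ → ℂ} {c s : ℂ} {R r M : ℝ} (hM : 0 < M) (hr : 0 ≤ r) (hrR : r < R)
    (hF : DifferentiableOn ℂ F (Metric.ball c R)) (hre : ∀ z ∈ Metric.ball c R, (F z).re ≤ M)
    (hs : ‖s - c‖ ≤ r) : ‖F s‖ ≤ (2 * M * r + ‖F c‖ * (R + r)) / (R - r) := by
  have hmap : Set.MapsTo (fun z ↦ c + z) (Metric.ball 0 R) (Metric.ball c R) := fun z hz ↦ by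
    simpa using hz
  have h := Complex.borelCaratheodory (f := fun z ↦ F (c + z)) (z := s - c) hM
    (hF.comp (by fun_prop) hmap) (fun z hz ↦ hre _ (hmap hz)) (hr.trans_lt hrR)
    (by simpa using hs.trans_lt hrR)
  simp only [add_sub_cancel, add_zero] at h
  rw [add_div]
  have h1 : 0 < R - r := sub_pos.2 hrR
  have h2 : R - r ≤ R - ‖s - c‖ := by linarith
  have h3 : (0 : ℝ) ≤ R := hr.trans hrR.le
  refine h.trans (add_le_add ?_ ?_) <;> gcongr

/-- A function comparable to `cosh ((Im s - t) / σ₁)` on the strip `0 ≤ Re s ≤ σ₁`. -/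
def stripWeight (σ₁ t : ℝ) (s : ℂ) : ℂ := Complex.cos ((s - (1 / 2 + t * I)) / σ₁)

lemma re_stripWeight (σ₁ t : ℝ) (s : ℂ) :
    (stripWeight σ₁ t s).re = Real.cos ((s.re - 1 / 2) / σ₁) * Real.cosh ((s.im - t) / σ₁) := by
  have h : (s - (1 / 2 + t * I)) / σ₁ =
      ((s.re - 1 / 2) / σ₁ : ℝ) + ((s.im - t) / σ₁ : ℝ) * I := by
    apply Complex.ext <;> simp [Complex.div_ofReal_re, Complex.div_ofReal_im]
  rw [stripWeight, h, Complex.cos_add_mul_I]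
  rw [← Complex.ofReal_cos, ← Complex.ofReal_cosh, ← Complex.ofReal_sin, ← Complex.ofReal_sinh,
    ← Complex.ofReal_mul, ← Complex.ofReal_mul]
  simp only [Complex.sub_re, Complex.mul_re, Complex.ofReal_re, Complex.ofReal_im, Complex.I_re,
    Complex.I_im]
  ring

lemma norm_stripWeight_le (σ₁ t : ℝ) (s : ℂ) :
    ‖stripWeight σ₁ t s‖ ≤ Real.cosh ((s.im - t) / σ₁) := by
  rw [stripWeight, Complex.cos, norm_div, Complex.norm_ofNat, Real.cosh_eq]
  gcongr
  refine (norm_add_le _ _).trans ?_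
  rw [Complex.norm_exp, Complex.norm_exp, add_comm]
  simp [Complex.div_ofReal_re, Complex.div_ofReal_im]

lemma half_cosh_le_re_stripWeight {σ₁ : ℝ} (h1 : 1 / 2 ≤ σ₁) (t : ℝ) {s : ℂ} (hs : 0 ≤ s.re)
    (hs1 : s.re ≤ σ₁) : Real.cosh ((s.im - t) / σ₁) / 2 ≤ (stripWeight σ₁ t s).re := by
  have hσ : 0 < σ₁ := by linarith
  rw [re_stripWeight, div_eq_mul_one_div, mul_comm]
  have hx : |(s.re - 1 / 2) / σ₁| ≤ 1 := by
    rw [abs_div, abs_of_pos hσ, div_le_one hσ, abs_le]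
    constructor <;> linarith
  have hcos : 1 / 2 ≤ Real.cos ((s.re - 1 / 2) / σ₁) := by
    rw [← Real.cos_abs]
    exact Real.cos_pi_div_three.ge.trans <|
      Real.cos_le_cos_of_nonneg_of_le_pi (abs_nonneg _) (by linarith [Real.pi_pos])
      (hx.trans (by linarith [Real.pi_gt_three]))
  exact mul_le_mul_of_nonneg_right hcos (Real.cosh_pos _).le

lemma differentiable_stripWeight (σ₁ t : ℝ) : Differentiable ℂ (stripWeight σ₁ t) := by
  unfold stripWeight
  fun_prop

lemma cosh_add_le (x y : ℝ) : Real.cosh (x + y) ≤ Real.cosh x * Real.exp |y| := by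
  have h1 := Real.exp_le_exp.2 (le_abs_self y)
  have h2 := Real.exp_le_exp.2 (neg_le_abs y)
  rw [Real.cosh_eq, Real.cosh_eq, neg_add, Real.exp_add, Real.exp_add]
  nlinarith [mul_le_mul_of_nonneg_left h1 (Real.exp_pos x).le,
    mul_le_mul_of_nonneg_left h2 (Real.exp_pos (-x)).le]

lemma abs_le_mul_cosh {σ₁ : ℝ} (h : 0 < σ₁) (x : ℝ) : |x| ≤ σ₁ * Real.cosh (x / σ₁) := by
  have h1 : |x / σ₁| ≤ Real.cosh (x / σ₁) := by
    rw [← Real.cosh_abs]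
    exact (Real.self_le_sinh_iff.2 (abs_nonneg _)).trans (Real.sinh_lt_cosh _).le
  rwa [abs_div, abs_of_pos h, div_le_iff₀' h] at h1

end LargeStrip

namespace LargeStrip

lemma deriv_eq_div_of_exp_eq {U : Set ℂ} (hU : IsOpen U) {E F : ℂ → ℂ}
    (hF : DifferentiableOn ℂ F U) (hE : ∀ s ∈ U, Complex.exp (F s) = E s) {s : ℂ} (hs : s ∈ U) :
    deriv F s = deriv E s / E s := by
  have h1 := ((hF s hs).differentiableAt (hU.mem_nhds hs)).hasDerivAt.cexp
  have h2 : HasDerivAt E (Complex.exp (F s) * deriv F s) s :=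
    h1.congr_of_eventuallyEq <| by filter_upwards [hU.mem_nhds hs] with z hz using (hE z hz).symm
  rw [h2.deriv, hE s hs, mul_div_cancel_left₀]
  exact hE s hs ▸ Complex.exp_ne_zero _

lemma norm_log_le_of_norm_sub_one_le {z : ℂ} (hz : ‖z - 1‖ ≤ 3 / 4) : ‖Complex.log z‖ ≤ 5 := by
  refine (Complex.norm_le_abs_re_add_abs_im _).trans ?_
  have h1 := Complex.abs_arg_le_pi z
  have h2 : ‖z‖ ≤ 4 := by
    have := norm_add_le (z - 1) 1
    rw [sub_add_cancel, norm_one] at this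
    linarith
  have h3 : 1 / 4 ≤ ‖z‖ := by
    have := norm_sub_norm_le 1 z
    rw [norm_one, norm_sub_rev] at this
    linarith
  have h4 : Real.log 4 = 2 * Real.log 2 := by
    rw [show (4 : ℝ) = 2 ^ 2 by norm_num, Real.log_pow]; norm_num
  have h5 := Real.log_le_log (by linarith) h2
  have h6 := Real.log_le_log (by norm_num) h3
  rw [one_div, Real.log_inv] at h6
  have h7 : |Real.log ‖z‖| ≤ Real.log 4 := abs_le.2 ⟨h6, h5⟩
  rw [Complex.log_re, Complex.log_im]
  linarith [Real.log_two_lt_d9, Real.pi_lt_d2]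

variable {E F : ℂ → ℂ} {σ₁ C A : ℝ}

lemma IsRegularized.exists_log (h : IsRegularized E σ₁ C A) :
    ∃ F, DifferentiableOn ℂ F {s | 1 / 2 < s.re} ∧
      (∀ s, 1 / 2 < s.re → Complex.exp (F s) = E s) ∧ ∀ s, s.re = σ₁ → ‖F s‖ ≤ 5 := by
  have hσ := h.two_le
  have hopen (a : ℝ) : IsOpen {s : ℂ | a < s.re} := isOpen_lt continuous_const continuous_re
  obtain ⟨G, hG, hGE⟩ := exists_differentiableOn_log (hopen (1 / 2))
    (convex_halfSpace_re_gt _) ⟨1, by norm_num⟩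
    (h.differentiableOn.mono fun s (hs : 1 / 2 < s.re) ↦ show 0 < s.re by linarith)
    h.ne_zero
  set V : Set ℂ := {s | σ₁ - 1 < s.re}
  have hVU : V ⊆ {s : ℂ | 1 / 2 < s.re} := fun s (hs : σ₁ - 1 < s.re) ↦
    show 1 / 2 < s.re by linarith
  have hslit (s) (hs : s ∈ V) : E s ∈ slitPlane := by
    have := mem_slitPlane_of_norm_lt_one ((h.norm_sub_one_le s (le_of_lt hs)).trans_lt
      (by norm_num))
    rwa [add_sub_cancel] at this
  have hEV : DifferentiableOn ℂ E V :=
    h.differentiableOn.mono fun s hs ↦ show 0 < s.re by linarith [show 1 / 2 < s.re from hVU hs]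
  have hL : DifferentiableOn ℂ (fun s ↦ Complex.log (E s)) V := hEV.clog hslit
  have hconst : ∀ s ∈ V, G s - Complex.log (E s) = G σ₁ - Complex.log (E σ₁) := fun s hs ↦ by
    refine (hopen _).is_const_of_deriv_eq_zero (convex_halfSpace_re_gt _).isPreconnected
      ((hG.mono hVU).sub hL) (fun z hz ↦ ?_) hs (show σ₁ - 1 < (σ₁ : ℂ).re by simp)
    have hdG := (hG z (hVU hz)).differentiableAt ((hopen _).mem_nhds (hVU hz))
    have hdL := (hL z hz).differentiableAt ((hopen _).mem_nhds hz)
    rw [deriv_sub hdG hdL, deriv_eq_div_of_exp_eq (hopen _) hG hGE (hVU hz),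
      deriv_eq_div_of_exp_eq (hopen _) hL
        (fun s hs ↦ Complex.exp_log (slitPlane_ne_zero (hslit s hs))) hz]
    exact sub_self _
  refine ⟨fun s ↦ G s - (G σ₁ - Complex.log (E σ₁)), hG.sub_const _, fun s hs ↦ ?_, fun s hs ↦ ?_⟩
  · have hσV : (σ₁ : ℂ) ∈ V := show σ₁ - 1 < (σ₁ : ℂ).re by simp
    rw [Complex.exp_sub, Complex.exp_sub, hGE s hs, hGE _ (hVU hσV),
      Complex.exp_log (slitPlane_ne_zero (hslit _ hσV)),
      div_self (slitPlane_ne_zero (hslit _ hσV)), div_one]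
  · have hsV : s ∈ V := show σ₁ - 1 < s.re by linarith
    beta_reduce
    rw [← hconst s hsV, sub_sub_cancel]
    exact norm_log_le_of_norm_sub_one_le (h.norm_sub_one_le s (le_of_lt hsV))

lemma re_le_of_norm_le_exp {s : ℂ} (hFE : Complex.exp (F s) = E s) {M : ℝ}
    (hM : ‖E s‖ ≤ Real.exp M) : (F s).re ≤ M := by
  rwa [← hFE, Complex.norm_exp, Real.exp_le_exp] at hM

lemma IsRegularized.exists_norm_log_le (h : IsRegularized E σ₁ C A)
    (hF : DifferentiableOn ℂ F {s | 1 / 2 < s.re})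
    (hFE : ∀ s, 1 / 2 < s.re → Complex.exp (F s) = E s) (hF5 : ∀ s, s.re = σ₁ → ‖F s‖ ≤ 5)
    {δ : ℝ} (hδ : 0 < δ) :
    ∃ H, 0 ≤ H ∧ ∀ s, 1 / 2 + δ ≤ s.re → s.re ≤ σ₁ → ‖F s‖ ≤ H * (1 + |s.im|) := by
  have hσ := h.two_le
  have hC := h.one_le
  refine ⟨(2 * (C * (1 + σ₁)) * σ₁ + 5 * (2 * σ₁)) / δ, by positivity, fun s hs hs1 ↦ ?_⟩
  set c : ℂ := σ₁ + s.im * I with hc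
  have hcre : c.re = σ₁ := by simp [hc]
  have hcim : c.im = s.im := by simp [hc]
  have hball (z : ℂ) (hz : z ∈ Metric.ball c (σ₁ - 1 / 2)) :
      1 / 2 < z.re ∧ |z.im| ≤ |s.im| + σ₁ := by
    rw [mem_ball_iff_norm] at hz
    have h1 := (Complex.abs_re_le_norm (z - c)).trans_lt hz
    have h2 := (Complex.abs_im_le_norm (z - c)).trans_lt hz
    rw [Complex.sub_re, hcre] at h1
    rw [Complex.sub_im, hcim] at h2
    refine ⟨by linarith [(abs_lt.1 h1).1], ?_⟩
    have := abs_add_le (z.im - s.im) s.im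
    rw [sub_add_cancel] at this
    linarith
  have hnorm : ‖s - c‖ ≤ σ₁ - 1 / 2 - δ := by
    have : s - c = ((s.re - σ₁ : ℝ) : ℂ) := by apply Complex.ext <;> simp [hcre, hcim]
    rw [this, Complex.norm_real, Real.norm_eq_abs, abs_of_nonpos (by linarith)]
    linarith
  have hM : 0 < C * (1 + σ₁) * (1 + |s.im|) := by positivity
  refine (norm_le_of_re_le hM ((norm_nonneg _).trans hnorm) (by linarith)
    (hF.mono fun z hz ↦ (hball z hz).1) (fun z hz ↦ ?_) hnorm).trans ?_
  · obtain ⟨h1, h2⟩ := hball z hz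
    refine re_le_of_norm_le_exp (hFE z h1)
      ((h.norm_le_exp z (by linarith)).trans (Real.exp_le_exp.2 ?_))
    rw [mul_assoc]
    refine mul_le_mul_of_nonneg_left ?_ (by linarith)
    nlinarith [abs_nonneg s.im]
  · rw [show σ₁ - 1 / 2 - (σ₁ - 1 / 2 - δ) = δ by ring, div_mul_eq_mul_div]
    have h5 := hF5 c hcre
    have h0 := norm_nonneg (F c)
    have hy := abs_nonneg s.im
    have hd : 0 ≤ σ₁ - 1 / 2 - δ := by linarith
    refine div_le_div_of_nonneg_right ?_ hδ.le
    rw [add_mul]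
    refine add_le_add ?_ ?_
    · calc _ ≤ 2 * (C * (1 + σ₁) * (1 + |s.im|)) * σ₁ := by gcongr; linarith
        _ = _ := by ring
    · calc _ ≤ 5 * (2 * σ₁) := by
            refine mul_le_mul h5 (by linarith) (by linarith) (by norm_num)
        _ ≤ _ := le_mul_of_one_le_right (by positivity) (by linarith)

end LargeStrip

namespace LargeStrip

variable {E F : ℂ → ℂ} {σ₁ C A t δ H : ℝ}

/-- The logarithmic loss in moving from the line `Re s = 1 / 2 + δ` to its reflection. -/
def reflectLoss (σ₁ C A t δ : ℝ) : ℝ := Real.log C + A * δ * (2 * Real.log t + σ₁) + 1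

lemma IsRegularized.one_le_reflectLoss (h : IsRegularized E σ₁ C A) (ht : 2 ≤ t) (hδ : 0 < δ) :
    1 ≤ reflectLoss σ₁ C A t δ := by
  have := h.two_le
  have := h.nonneg
  have := Real.log_nonneg h.one_le
  have : 0 ≤ Real.log t := Real.log_nonneg (by linarith)
  rw [reflectLoss]
  have : 0 ≤ A * δ * (2 * Real.log t + σ₁) := by positivity
  linarith

lemma log_abs_add_two_le (hσ : 0 < σ₁) (ht : 2 ≤ t) (y : ℝ) :
    Real.log (|y| + 2) ≤ (2 * Real.log t + σ₁) * Real.cosh ((y - t) / σ₁) := by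
  have h1 := abs_le_mul_cosh hσ (y - t)
  have h2 := Real.one_le_cosh ((y - t) / σ₁)
  have h3 : 0 ≤ Real.log t := Real.log_nonneg (by linarith)
  have h4 : |y| ≤ |y - t| + t := by
    have := abs_add_le (y - t) t
    rwa [sub_add_cancel, abs_of_nonneg (by linarith : (0 : ℝ) ≤ t)] at this
  have h0 := abs_nonneg (y - t)
  have h5 : |y| + 2 ≤ t ^ 2 * (1 + |y - t|) := by
    have h6 : t + 2 ≤ t ^ 2 := by nlinarith
    nlinarith
  calc Real.log (|y| + 2) ≤ Real.log (t ^ 2 * (1 + |y - t|)) :=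
        Real.log_le_log (by positivity) h5
    _ = 2 * Real.log t + Real.log (1 + |y - t|) := by
        rw [Real.log_mul (by positivity) (by positivity), Real.log_pow]; norm_num
    _ ≤ 2 * Real.log t + |y - t| := by
        linarith [Real.log_le_sub_one_of_pos (by positivity : 0 < 1 + |y - t|)]
    _ ≤ _ := by nlinarith

lemma IsRegularized.norm_le_exp_cosh_left (h : IsRegularized E σ₁ C A)
    (hFE : ∀ s, 1 / 2 < s.re → Complex.exp (F s) = E s) (ht : 2 ≤ t) (hδ : 0 < δ)
    (hδ8 : δ ≤ 1 / 8) (hHF : ∀ s, s.re = 1 / 2 + δ → ‖F s‖ ≤ H * Real.cosh ((s.im - t) / σ₁))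
    {s : ℂ} (hs : s.re = 1 / 2 - δ) :
    ‖E s‖ ≤ Real.exp ((H + reflectLoss σ₁ C A t δ) * Real.cosh ((s.im - t) / σ₁)) := by
  have hσ : 0 < σ₁ := by linarith [h.two_le]
  have hC : 0 < C := by linarith [h.one_le]
  set z : ℂ := s + (1 - 2 * s.re : ℝ) with hz
  have hzre : z.re = 1 / 2 + δ := by simp [hz, hs]; ring
  have hzim : z.im = s.im := by simp [hz]
  have hEz : ‖E z‖ ≤ Real.exp (H * Real.cosh ((s.im - t) / σ₁)) := by
    rw [← hFE z (by linarith), Complex.norm_exp, ← hzim]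
    exact Real.exp_le_exp.2 ((Complex.re_le_norm _).trans (hHF z hzre))
  refine (h.norm_le_reflect s (by linarith) (by linarith)).trans ?_
  rw [← hz, hs, show 1 / 2 - (1 / 2 - δ) = δ by ring, Real.rpow_def_of_pos (by positivity)]
  calc C * Real.exp (Real.log (|s.im| + 2) * (A * δ)) * ‖E z‖
      ≤ Real.exp (Real.log C) * Real.exp (Real.log (|s.im| + 2) * (A * δ)) *
        Real.exp (H * Real.cosh ((s.im - t) / σ₁)) := by rw [Real.exp_log hC]; gcongr
    _ ≤ _ := by
        rw [← Real.exp_add, ← Real.exp_add, Real.exp_le_exp, reflectLoss]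
        have h1 := mul_le_mul_of_nonneg_left (log_abs_add_two_le hσ ht s.im)
          (mul_nonneg h.nonneg hδ.le)
        have h2 := le_mul_of_one_le_right (Real.log_nonneg h.one_le)
          (Real.one_le_cosh ((s.im - t) / σ₁))
        have h3 := Real.one_le_cosh ((s.im - t) / σ₁)
        linarith

lemma IsRegularized.norm_le_exp_cosh (h : IsRegularized E σ₁ C A)
    (hFE : ∀ s, 1 / 2 < s.re → Complex.exp (F s) = E s) (ht : 2 ≤ t) (hδ : 0 < δ)
    (hδ8 : δ ≤ 1 / 8) (hH : 0 ≤ H)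
    (hHF : ∀ s, s.re = 1 / 2 + δ → ‖F s‖ ≤ H * Real.cosh ((s.im - t) / σ₁))
    {s : ℂ} (hs : 1 / 2 - δ ≤ s.re) (hs1 : s.re ≤ σ₁) :
    ‖E s‖ ≤ Real.exp (2 * (H + reflectLoss σ₁ C A t δ) * Real.cosh ((s.im - t) / σ₁)) := by
  have hσ := h.two_le
  have hB := h.one_le_reflectLoss ht hδ
  set P := 2 * (H + reflectLoss σ₁ C A t δ) with hP
  have hP0 : 0 ≤ P := by linarith
  have hw (z : ℂ) (hz : 1 / 2 - δ ≤ z.re) (hz1 : z.re ≤ σ₁) :=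
    half_cosh_le_re_stripWeight (by linarith) t (by linarith : 0 ≤ z.re) hz1
  have hnorm (z : ℂ) : ‖E z * Complex.exp (-(P * stripWeight σ₁ t z))‖ =
      ‖E z‖ * Real.exp (-(P * (stripWeight σ₁ t z).re)) := by
    rw [norm_mul, Complex.norm_exp, Complex.neg_re, Complex.re_ofReal_mul]
  have hcosh (y : ℝ) : 1 ≤ Real.cosh y := Real.one_le_cosh y
  have key : ‖E s * Complex.exp (-(P * stripWeight σ₁ t s))‖ ≤ 1 := by
    refine norm_le_of_strip (f := fun z ↦ E z * Complex.exp (-(P * stripWeight σ₁ t z)))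
      (a := 1 / 2 - δ) (b := σ₁) (C := C) (by linarith) (fun z hz hz1 ↦ ?_) (fun z hz hz1 ↦ ?_)
      (fun z hz ↦ ?_) (fun z hz ↦ ?_) hs hs1
    · have hd := (h.differentiableOn z (show 0 < z.re by linarith)).differentiableAt
        ((isOpen_lt continuous_const continuous_re).mem_nhds (show 0 < z.re by linarith))
      exact hd.mul (((differentiable_stripWeight σ₁ t z).const_mul _).neg.cexp)
    · rw [hnorm]
      refine (mul_le_of_le_one_right (norm_nonneg _) (Real.exp_le_one_iff.2 ?_)).trans
        (h.norm_le_exp z (by linarith))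
      have := hw z hz hz1
      have := hcosh ((z.im - t) / σ₁)
      exact neg_nonpos.2 (mul_nonneg hP0 (by linarith))
    · rw [hnorm]
      have h1 := mul_le_mul_of_nonneg_left (hw z hz.ge (by linarith)) hP0
      have h2 := h.norm_le_exp_cosh_left hFE ht hδ hδ8 hHF hz
      refine (mul_le_mul_of_nonneg_right h2 (Real.exp_nonneg _)).trans ?_
      rw [← Real.exp_add, Real.exp_le_one_iff]
      linarith
    · rw [hnorm]
      have h1 := mul_le_mul_of_nonneg_left (hw z (by linarith) hz.le) hP0
      have h2 : ‖E z‖ ≤ Real.exp 1 := by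
        have h3 := norm_add_le (E z - 1) 1
        rw [sub_add_cancel, norm_one] at h3
        linarith [h.norm_sub_one_le z (by linarith), Real.add_one_le_exp (1 : ℝ)]
      refine (mul_le_mul_of_nonneg_right h2 (Real.exp_nonneg _)).trans ?_
      rw [← Real.exp_add, Real.exp_le_one_iff]
      nlinarith [hcosh ((z.im - t) / σ₁)]
  rw [hnorm, ← le_div_iff₀ (Real.exp_pos _), one_div, ← Real.exp_neg, neg_neg] at key
  refine key.trans (Real.exp_le_exp.2 (mul_le_mul_of_nonneg_left ?_ hP0))
  exact (Complex.re_le_norm _).trans (norm_stripWeight_le _ _ _)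

lemma cosh_sub_div_le_two_mul (hσ : 2 ≤ σ₁) {x y : ℝ} (hxy : |x - y| ≤ 1) :
    Real.cosh ((x - t) / σ₁) ≤ 2 * Real.cosh ((y - t) / σ₁) := by
  have h1 := cosh_add_le ((y - t) / σ₁) ((x - y) / σ₁)
  rw [← add_div, show y - t + (x - y) = x - t by ring] at h1
  refine h1.trans ?_
  rw [mul_comm]
  refine mul_le_mul_of_nonneg_right ?_ (Real.cosh_pos _).le
  have h2 : |(x - y) / σ₁| ≤ 1 / 2 := by
    rw [abs_div, abs_of_pos (by linarith : 0 < σ₁), div_le_div_iff₀ (by linarith) two_pos]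
    linarith
  have h3 : Real.exp (1 / 2) ≤ 2 := by
    rw [← Real.le_log_iff_exp_le two_pos]
    linarith [Real.log_two_gt_d9]
  exact (Real.exp_le_exp.2 h2).trans h3

lemma IsRegularized.norm_log_le_cosh (h : IsRegularized E σ₁ C A)
    (hF : DifferentiableOn ℂ F {s | 1 / 2 < s.re})
    (hFE : ∀ s, 1 / 2 < s.re → Complex.exp (F s) = E s) (ht : 2 ≤ t) (hδ : 0 < δ)
    (hδ8 : δ ≤ 1 / 8) (hH : 0 ≤ H)
    (hHF : ∀ s, s.re = 1 / 2 + δ → ‖F s‖ ≤ H * Real.cosh ((s.im - t) / σ₁))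
    {s : ℂ} (hs : s.re = 1 / 2 + δ / 2) :
    ‖F s‖ ≤ 11 * (H + reflectLoss σ₁ C A t δ) * Real.cosh ((s.im - t) / σ₁) := by
  have hσ := h.two_le
  have hB := h.one_le_reflectLoss ht hδ
  set P := H + reflectLoss σ₁ C A t δ with hP
  set V := Real.cosh ((s.im - t) / σ₁) with hV
  have hV1 : 1 ≤ V := Real.one_le_cosh _
  set c : ℂ := s + (δ / 2 : ℝ) with hc
  have hcre : c.re = 1 / 2 + δ := by simp [hc, hs]; ring
  have hcim : c.im = s.im := by simp [hc]
  have hball (z : ℂ) (hz : z ∈ Metric.ball c δ) :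
      1 / 2 < z.re ∧ z.re ≤ σ₁ ∧ |z.im - s.im| ≤ 1 := by
    rw [mem_ball_iff_norm] at hz
    have h1 := (Complex.abs_re_le_norm (z - c)).trans_lt hz
    have h2 := (Complex.abs_im_le_norm (z - c)).trans_lt hz
    rw [Complex.sub_re, hcre] at h1
    rw [Complex.sub_im, hcim] at h2
    exact ⟨by linarith [(abs_lt.1 h1).1], by linarith [(abs_lt.1 h1).2], by linarith⟩
  have hFc : ‖F c‖ ≤ P * V := by
    refine (hHF c hcre).trans ?_
    rw [hcim]
    exact mul_le_mul_of_nonneg_right (by linarith) (by linarith)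
  refine (norm_le_of_re_le (M := 4 * P * V) (r := δ / 2) (by positivity) (by linarith)
    (half_lt_self hδ) (hF.mono fun z hz ↦ (hball z hz).1) (fun z hz ↦ ?_) ?_).trans ?_
  · obtain ⟨h1, h2, h3⟩ := hball z hz
    refine re_le_of_norm_le_exp (hFE z h1)
      ((h.norm_le_exp_cosh hFE ht hδ hδ8 hH hHF (by linarith) h2).trans (Real.exp_le_exp.2 ?_))
    rw [← hP]
    have := mul_le_mul_of_nonneg_left (cosh_sub_div_le_two_mul (t := t) hσ h3)
      (by linarith : 0 ≤ 2 * P)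
    linarith
  · rw [hc, sub_add_cancel_left, norm_neg, Complex.norm_real, Real.norm_of_nonneg (by linarith)]
  · rw [sub_half, div_le_iff₀ (by linarith)]
    nlinarith

end LargeStrip

namespace LargeStrip

variable {E F : ℂ → ℂ} {σ₁ C A t δ : ℝ}

lemma norm_le_cosh_of_edges (hσ : 2 ≤ σ₁) (hF : DifferentiableOn ℂ F {s | 1 / 2 < s.re})
    (hF5 : ∀ s, s.re = σ₁ → ‖F s‖ ≤ 5) {a H₀ K l : ℝ} (ha : 1 / 2 < a) (haσ : a < σ₁)
    (hH₀ : 0 ≤ H₀) (hgrow : ∀ s, a ≤ s.re → s.re ≤ σ₁ → ‖F s‖ ≤ H₀ * (1 + |s.im|))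
    (hK : 0 ≤ K) (hl : 0 ≤ l)
    (hFa : ∀ s, s.re = a → ‖F s‖ ≤ K * Real.cosh ((s.im - t) / σ₁))
    {s : ℂ} (hs : a ≤ s.re) (hs1 : s.re ≤ σ₁) :
    ‖F s‖ ≤ (2 * K + 10 * Real.exp (l * (σ₁ - a))) * Real.exp (-(l * (s.re - a))) *
      Real.cosh ((s.im - t) / σ₁) := by
  have hcosh (y : ℝ) : 1 ≤ Real.cosh y := Real.one_le_cosh y
  have hw (z : ℂ) (hz : a ≤ z.re) (hz1 : z.re ≤ σ₁) :
      Real.cosh ((z.im - t) / σ₁) ≤ 2 * ‖stripWeight σ₁ t z‖ := by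
    have h1 := half_cosh_le_re_stripWeight (by linarith) t (by linarith : 0 ≤ z.re) hz1
    have h2 := Complex.re_le_norm (stripWeight σ₁ t z)
    linarith
  have hw0 (z : ℂ) (hz : a ≤ z.re) (hz1 : z.re ≤ σ₁) : 0 < ‖stripWeight σ₁ t z‖ := by
    linarith [hw z hz hz1, hcosh ((z.im - t) / σ₁)]
  have hnorm (z : ℂ) : ‖F z * Complex.exp (l * (z - a)) / stripWeight σ₁ t z‖ =
      ‖F z‖ * Real.exp (l * (z.re - a)) / ‖stripWeight σ₁ t z‖ := by
    rw [norm_div, norm_mul, Complex.norm_exp, Complex.re_ofReal_mul, Complex.sub_re,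
      Complex.ofReal_re]
  have hexp (z : ℂ) (hz1 : z.re ≤ σ₁) : Real.exp (l * (z.re - a)) ≤ Real.exp (l * (σ₁ - a)) :=
    Real.exp_le_exp.2 (mul_le_mul_of_nonneg_left (by linarith) hl)
  set X := Real.exp (l * (σ₁ - a)) with hX
  have hX0 : 0 < X := Real.exp_pos _
  have key : ‖F s * Complex.exp (l * (s - a)) / stripWeight σ₁ t s‖ ≤ 2 * K + 10 * X := by
    refine norm_le_of_strip (f := fun z ↦ F z * Complex.exp (l * (z - a)) / stripWeight σ₁ t z)
      (C := 2 * H₀ * X) haσ (fun z hz hz1 ↦ ?_) (fun z hz hz1 ↦ ?_) (fun z hz ↦ ?_)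
      (fun z hz ↦ ?_) hs hs1
    · have hd := (hF z (show 1 / 2 < z.re by linarith)).differentiableAt
        ((isOpen_lt continuous_const continuous_re).mem_nhds (show 1 / 2 < z.re by linarith))
      exact (hd.mul (by fun_prop)).div (differentiable_stripWeight σ₁ t z)
        (norm_pos_iff.1 (hw0 z hz hz1))
    · rw [hnorm, div_le_iff₀ (hw0 z hz hz1)]
      have h1 : 1 / 2 ≤ ‖stripWeight σ₁ t z‖ := by
        linarith [hw z hz hz1, hcosh ((z.im - t) / σ₁)]
      have h2 : 2 * H₀ * X * (1 + |z.im|) ≤ Real.exp (2 * H₀ * X * (1 + |z.im|)) := by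
        linarith [Real.add_one_le_exp (2 * H₀ * X * (1 + |z.im|))]
      calc _ ≤ H₀ * (1 + |z.im|) * X :=
            mul_le_mul (hgrow z hz hz1) (hexp z hz1) (Real.exp_nonneg _) (by positivity)
        _ = 2 * H₀ * X * (1 + |z.im|) * (1 / 2) := by ring
        _ ≤ _ := mul_le_mul h2 h1 (by norm_num) (Real.exp_nonneg _)
    · have hz0 := hw0 z hz.ge (by linarith)
      rw [hnorm, div_le_iff₀ hz0, hz, sub_self, mul_zero, Real.exp_zero, mul_one]
      have h1 := mul_le_mul_of_nonneg_left (hw z hz.ge (by linarith)) hK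
      have h2 : 0 ≤ 10 * X * ‖stripWeight σ₁ t z‖ := by positivity
      linarith [hFa z hz]
    · have hz0 := hw0 z (by linarith) hz.le
      rw [hnorm, div_le_iff₀ hz0, hz, ← hX]
      have h1 := hw z (by linarith) hz.le
      have h2 := hcosh ((z.im - t) / σ₁)
      have h3 := mul_le_mul_of_nonneg_right (hF5 z hz) hX0.le
      have h4 : 0 ≤ 2 * K * ‖stripWeight σ₁ t z‖ := by positivity
      nlinarith
  rw [hnorm, div_le_iff₀ (hw0 s hs hs1), ← le_div_iff₀ (Real.exp_pos _), div_eq_mul_inv,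
    ← Real.exp_neg] at key
  refine key.trans ?_
  rw [mul_right_comm]
  exact mul_le_mul_of_nonneg_left (norm_stripWeight_le _ _ _) (by positivity)

/-- The self-improving bound for `log E`: on the line `Re s = 1 / 2 + δ`, it is bounded
in terms of the loss in the reflection step. -/
lemma IsRegularized.norm_log_le (h : IsRegularized E σ₁ C A)
    (hF : DifferentiableOn ℂ F {s | 1 / 2 < s.re})
    (hFE : ∀ s, 1 / 2 < s.re → Complex.exp (F s) = E s) (hF5 : ∀ s, s.re = σ₁ → ‖F s‖ ≤ 5)
    (ht : 2 ≤ t) (hδ : 0 < δ) (hδ8 : δ ≤ 1 / 8) {s : ℂ} (hs : s.re = 1 / 2 + δ) :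
    ‖F s‖ ≤ (reflectLoss σ₁ C A t δ + 14 * Real.exp (10 * σ₁ / δ)) *
      Real.cosh ((s.im - t) / σ₁) := by
  have hσ := h.two_le
  have hB := h.one_le_reflectLoss ht hδ
  set B := reflectLoss σ₁ C A t δ with hBdef
  set X := Real.exp (10 * σ₁ / δ) with hX
  obtain ⟨H₀, hH₀, hgrow⟩ := h.exists_norm_log_le hF hFE hF5 (half_pos hδ)
  let S : Set ℝ := {H | 0 ≤ H ∧ ∀ s, s.re = 1 / 2 + δ → ‖F s‖ ≤ H * Real.cosh ((s.im - t) / σ₁)}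
  have hSbdd : BddBelow S := ⟨0, fun H hH ↦ hH.1⟩
  have hSclosed : IsClosed S := by
    have hS : S = Set.Ici 0 ∩ ⋂ (s : ℂ) (_ : s.re = 1 / 2 + δ),
        {H | ‖F s‖ ≤ H * Real.cosh ((s.im - t) / σ₁)} := by
      ext H; simp [S]
    rw [hS]
    exact isClosed_Ici.inter <| isClosed_iInter fun s ↦ isClosed_iInter fun _ ↦
      isClosed_le continuous_const (by fun_prop)
  have hSne : S.Nonempty := by
    refine ⟨H₀ * (1 + t + σ₁), by positivity, fun s hs ↦
      (hgrow s (by linarith) (by linarith)).trans ?_⟩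
    rw [mul_assoc]
    refine mul_le_mul_of_nonneg_left ?_ hH₀
    have h1 := abs_le_mul_cosh (by linarith : 0 < σ₁) (s.im - t)
    have h2 := Real.one_le_cosh ((s.im - t) / σ₁)
    have h3 := abs_add_le (s.im - t) t
    rw [sub_add_cancel, abs_of_nonneg (by linarith : 0 ≤ t)] at h3
    nlinarith
  have himp : ∀ H ∈ S, 22 * (H + B) * Real.exp (-5) + 10 * X ∈ S := fun H hH ↦ by
    have hH0 := hH.1
    refine ⟨by positivity, fun s hs ↦ ?_⟩
    have hK : 0 ≤ 11 * (H + B) := by positivity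
    refine (norm_le_cosh_of_edges (a := 1 / 2 + δ / 2) (l := 10 / δ) hσ hF hF5 (by linarith)
      (by linarith) hH₀ hgrow hK (by positivity)
      (fun z hz ↦ h.norm_log_le_cosh hF hFE ht hδ hδ8 hH.1 hH.2 hz) (by linarith)
      (by linarith)).trans (mul_le_mul_of_nonneg_right ?_ (Real.cosh_pos _).le)
    have h5 : 10 / δ * (s.re - (1 / 2 + δ / 2)) = 5 := by rw [hs]; field_simp; ring
    rw [h5, add_mul]
    refine add_le_add (by linarith) ?_
    rw [mul_assoc, ← Real.exp_add]
    refine mul_le_mul_of_nonneg_left (Real.exp_le_exp.2 ?_) (by norm_num)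
    rw [mul_div_right_comm]
    have : 0 ≤ 10 / δ := by positivity
    nlinarith
  have hmem := hSclosed.csInf_mem hSne hSbdd
  have hle := csInf_le hSbdd (himp _ hmem)
  have h5 : Real.exp (-5) ≤ 1 / 88 := by
    rw [Real.exp_neg, inv_eq_one_div]
    refine one_div_le_one_div_of_le (by norm_num) ?_
    have h1 : (2.7 : ℝ) ^ 5 ≤ Real.exp 1 ^ 5 :=
      pow_le_pow_left₀ (by norm_num) (by linarith [Real.exp_one_gt_d9]) 5
    rw [← Real.exp_nat_mul, mul_one] at h1
    exact le_trans (by norm_num) h1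
  have hH0 := hmem.1
  refine (hmem.2 s hs).trans (mul_le_mul_of_nonneg_right ?_ (Real.cosh_pos _).le)
  have h6 := mul_le_mul_of_nonneg_left h5 (by positivity : 0 ≤ 22 * (sInf S + B))
  have : 0 < X := Real.exp_pos _
  linarith

end LargeStrip

namespace LargeStrip

variable {E F : ℂ → ℂ} {σ₁ C A t δ : ℝ}

lemma IsRegularized.norm_le_exp_near (h : IsRegularized E σ₁ C A) (ht : 2 ≤ t) (hδ : 0 < δ)
    (hδ8 : δ ≤ 1 / 8) {M : ℝ}
    (hM : 8 * reflectLoss σ₁ C A t δ + 56 * Real.exp (10 * σ₁ / δ) + 20 ≤ M) {s : ℂ}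
    (hs1 : s.re ≤ σ₁) (hst : |s.im - t| ≤ 1) :
    (1 / 2 - δ ≤ s.re → ‖E s‖ ≤ Real.exp M) ∧ (1 / 2 + δ ≤ s.re → Real.exp (-M) ≤ ‖E s‖) := by
  have hσ := h.two_le
  have hB := h.one_le_reflectLoss ht hδ
  obtain ⟨F, hF, hFE, hF5⟩ := h.exists_log
  have hFδ (z : ℂ) (hz : z.re = 1 / 2 + δ) := h.norm_log_le hF hFE hF5 ht hδ hδ8 hz
  have hX : 0 < Real.exp (10 * σ₁ / δ) := Real.exp_pos _
  set B := reflectLoss σ₁ C A t δ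
  set X := Real.exp (10 * σ₁ / δ)
  have hV : Real.cosh ((s.im - t) / σ₁) ≤ 2 := by
    simpa using cosh_sub_div_le_two_mul (t := t) hσ hst
  have hH : 0 ≤ B + 14 * X := by positivity
  refine ⟨fun hs ↦ ?_, fun hs ↦ ?_⟩
  · refine (h.norm_le_exp_cosh hFE ht hδ hδ8 hH hFδ hs hs1).trans (Real.exp_le_exp.2 ?_)
    have := mul_le_mul_of_nonneg_left hV (by positivity : 0 ≤ 2 * (B + 14 * X + B))
    linarith
  · obtain ⟨H₀, hH₀, hgrow⟩ := h.exists_norm_log_le hF hFE hF5 hδ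
    have h1 := norm_le_cosh_of_edges (l := 0) hσ hF hF5 (by linarith) (by linarith) hH₀ hgrow hH
      le_rfl hFδ hs hs1
    simp only [zero_mul, neg_zero, Real.exp_zero, mul_one] at h1
    rw [← hFE s (by linarith), Complex.norm_exp, Real.exp_le_exp]
    have h2 := mul_le_mul_of_nonneg_left hV (by positivity : 0 ≤ 2 * (B + 14 * X) + 10)
    linarith [(abs_le.1 (Complex.abs_re_le_norm (F s))).1]

lemma IsRegularized.exists_bounds (h : IsRegularized E σ₁ C A) :
    ∃ C' t₀ : ℝ, 0 < C' ∧ ∀ t, t₀ ≤ t → 0 < Real.log (Real.log t) ∧ ∃ δ, 0 < δ ∧ δ ≤ 1 / 8 ∧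
      ∀ s : ℂ, s.re ≤ σ₁ → |s.im - t| ≤ 1 →
        (1 / 2 - δ ≤ s.re → ‖E s‖ ≤ Real.exp (C' * (Real.log t / Real.log (Real.log t)))) ∧
        (1 / 2 + δ ≤ s.re →
          Real.exp (-(C' * (Real.log t / Real.log (Real.log t)))) ≤ ‖E s‖) := by
  have hσ := h.two_le
  have hA := h.nonneg
  have hC := Real.log_nonneg h.one_le
  refine ⟨8 * (Real.log C + 1) + 160 * (A * σ₁ * (2 + σ₁)) + 132,
    Real.exp (Real.exp (160 * σ₁)), by positivity, fun t ht ↦ ?_⟩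
  have ht0 : 0 < t := (Real.exp_pos _).trans_le ht
  have hL : Real.exp (160 * σ₁) ≤ Real.log t := (Real.le_log_iff_exp_le ht0).2 ht
  have hL0 : 0 < Real.log t := (Real.exp_pos _).trans_le hL
  have hl : 160 * σ₁ ≤ Real.log (Real.log t) := (Real.le_log_iff_exp_le hL0).2 hL
  have hl0 : 0 < Real.log (Real.log t) := by linarith
  have hL1 : 1 ≤ Real.log t := (Real.one_le_exp (by positivity)).trans hL
  have ht2 : 2 ≤ t := by
    have := Real.add_one_le_exp (Real.log t)
    rw [Real.exp_log ht0] at this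
    linarith
  refine ⟨hl0, 20 * σ₁ / Real.log (Real.log t), by positivity, ?_, fun s hs hst ↦
    h.norm_le_exp_near ht2 (by positivity) ?_ ?_ hs hst⟩
  · rw [div_le_div_iff₀ hl0 (by norm_num)]; linarith
  · rw [div_le_div_iff₀ hl0 (by norm_num)]; linarith
  have hX : Real.exp (10 * σ₁ / (20 * σ₁ / Real.log (Real.log t))) = √(Real.log t) := by
    rw [Real.sqrt_eq_rpow, Real.rpow_def_of_pos hL0]
    congr 1
    field_simp
    norm_num
  rw [hX, reflectLoss]
  set L := Real.log t
  set l := Real.log L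
  have h1 : 1 ≤ L / l := by
    rw [one_le_div hl0]
    exact (Real.log_le_sub_one_of_pos hL0).trans (by linarith)
  have h2 : √L ≤ 2 * (L / l) := by
    rw [← mul_div_assoc, le_div_iff₀ hl0]
    have h3 : l = 2 * Real.log √L := by rw [Real.log_sqrt hL0.le]; ring
    have h4 := Real.log_le_sub_one_of_pos (Real.sqrt_pos.2 hL0)
    nlinarith [Real.sq_sqrt hL0.le, Real.sqrt_pos.2 hL0]
  have h3 : A * (20 * σ₁ / l) * (2 * L + σ₁) ≤ 20 * (A * σ₁ * (2 + σ₁)) * (L / l) := by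
    calc _ = 20 * (A * σ₁ * (2 * L + σ₁)) / l := by ring
      _ ≤ 20 * (A * σ₁ * ((2 + σ₁) * L)) / l := by gcongr; nlinarith
      _ = _ := by ring
  have h4 : 8 * (Real.log C + 1) + 20 ≤ (8 * (Real.log C + 1) + 20) * (L / l) :=
    le_mul_of_one_le_right (by positivity) h1
  linarith

end LargeStrip

namespace LargeStrip

open scoped ComplexConjugate

lemma exists_one_div_four_pow_le_prod (Γ : Multiset ℝ) :
    ∃ x : ℝ, |x| ≤ 1 / 2 ∧ (1 / 4) ^ Γ.card ≤ (Γ.map fun γ ↦ |x - γ|).prod := by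
  let q (γ : ℝ) : Polynomial ℝ := .C 2 * .X + .C (-(4 * γ))
  set P : Polynomial ℝ := (Γ.map q).prod with hP
  have hq (γ : ℝ) : (q γ).leadingCoeff = 2 := Polynomial.leadingCoeff_linear two_ne_zero
  have hlead : P.leadingCoeff = 2 ^ Γ.card := by
    simp [hP, Polynomial.leadingCoeff_multiset_prod, hq]
  have hdeg : P.degree ≤ Γ.card := by
    refine Polynomial.natDegree_le_iff_degree_le.1 ?_
    refine (Polynomial.natDegree_multiset_prod_le _).trans ?_
    rw [Multiset.map_map]
    refine (Multiset.sum_le_card_nsmul _ 1 fun n hn ↦ ?_).trans (by simp)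
    obtain ⟨γ, -, rfl⟩ := Multiset.mem_map.1 hn
    exact Polynomial.natDegree_linear_le
  obtain ⟨y, hy, hPy⟩ : ∃ y ∈ Set.Icc (-1 : ℝ) 1, 1 ≤ |P.eval y| := by
    by_contra! hcon
    have h := Polynomial.Chebyshev.leadingCoeff_le_of_forall_abs_le_one hdeg
      fun y hy ↦ (hcon y hy).le
    rw [hlead, pow_le_pow_iff_right₀ one_lt_two] at h
    have h0 : Γ = 0 := Multiset.card_eq_zero.1 (by omega)
    simpa [hP, h0] using hcon 0 (by simp)
  refine ⟨y / 2, by rw [abs_div, abs_two]; linarith [abs_le.2 hy], ?_⟩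
  have hval (Γ : Multiset ℝ) : |((Γ.map q).prod).eval y| =
      4 ^ Γ.card * (Γ.map fun γ ↦ |y / 2 - γ|).prod := by
    induction Γ using Multiset.induction_on with
    | empty => simp
    | cons γ Γ ih =>
      have h4 : |(q γ).eval y| = 4 * |y / 2 - γ| := by
        have h5 : (q γ).eval y = 4 * (y / 2 - γ) := by
          simp only [q, Polynomial.eval_add, Polynomial.eval_mul, Polynomial.eval_C,
            Polynomial.eval_X]
          ring
        rw [h5, abs_mul, abs_of_pos four_pos]
      simp only [Multiset.map_cons, Multiset.prod_cons, Polynomial.eval_mul, abs_mul, h4, ih,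
        Multiset.card_cons]
      ring
  rw [hP, hval] at hPy
  rw [one_div, inv_pow, inv_le_iff_one_le_mul₀' (by positivity)]
  exact hPy

/-- Division of a bounded holomorphic function by its zeros in the disc of radius `3 / 2`,
with control on the quotient in the disc of radius `2`. -/
lemma exists_multiset_zeros {f : ℂ → ℂ} {M : ℝ} (N : ℕ)
    (hf : DifferentiableOn ℂ f (Metric.ball 0 3))
    (hM : ∀ s ∈ Metric.closedBall (0 : ℂ) 2, ‖f s‖ ≤ M) (hN : M < ‖f 0‖ * (4 / 3) ^ N) :
    ∃ (zs : Multiset ℂ) (g : ℂ → ℂ), (∀ z ∈ zs, ‖z‖ ≤ 3 / 2) ∧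
      DifferentiableOn ℂ g (Metric.ball 0 3) ∧ (∀ s ∈ Metric.closedBall (0 : ℂ) 2, ‖g s‖ ≤ M) ∧
      (∀ s ∈ Metric.closedBall (0 : ℂ) (3 / 2), g s ≠ 0) ∧
      ‖f 0‖ * (4 / 3) ^ zs.card ≤ ‖g 0‖ ∧
      ∀ s, ‖f s‖ * (zs.map fun z ↦ ‖4 - conj z * s‖).prod =
        ‖g s‖ * (zs.map fun z ↦ 2 * ‖s - z‖).prod := by
  induction N generalizing f with
  | zero =>
    have := hM 0 (by simp)
    simp at hN
    linarith
  | succ N ih =>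
    by_cases hz : ∀ s ∈ Metric.closedBall (0 : ℂ) (3 / 2), f s ≠ 0
    · exact ⟨0, f, by simp, hf, hM, hz, by simp, by simp⟩
    push Not at hz
    obtain ⟨z, hz, hfz⟩ := hz
    rw [mem_closedBall_zero_iff] at hz
    set g : ℂ → ℂ := fun s ↦ dslope f z s * ((4 - conj z * s) / 2) with hg
    have hgd : DifferentiableOn ℂ g (Metric.ball 0 3) :=
      ((differentiableOn_dslope (Metric.isOpen_ball.mem_nhds (by simp; linarith))).2 hf).mul
        (by fun_prop)
    have hgf (s : ℂ) : ‖f s‖ * ‖4 - conj z * s‖ = ‖g s‖ * (2 * ‖s - z‖) := by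
      rw [← sub_smul_dslope_of_zero hfz s, hg, smul_eq_mul, norm_mul, norm_mul, norm_div,
        Complex.norm_ofNat]
      ring
    have hbd (s : ℂ) (hs : ‖s‖ = 2) : ‖4 - conj z * s‖ = 2 * ‖s - z‖ := by
      have h1 : (4 : ℂ) - conj z * s = conj (s - z) * s := by
        rw [map_sub, sub_mul, ← Complex.normSq_eq_conj_mul_self, Complex.normSq_eq_norm_sq, hs]
        norm_num
      rw [h1, norm_mul, Complex.norm_conj, hs, mul_comm]
    have hgM : ∀ s ∈ Metric.closedBall (0 : ℂ) 2, ‖g s‖ ≤ M := fun s hs ↦ by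
      refine Complex.norm_le_of_forall_mem_frontier_norm_le (U := Metric.ball 0 2)
        Metric.isBounded_ball (DifferentiableOn.diffContOnCl (hgd.mono ?_)) (fun w hw ↦ ?_)
        (by rwa [closure_ball _ two_ne_zero])
      · rw [closure_ball _ two_ne_zero]
        exact Metric.closedBall_subset_ball (by norm_num)
      · rw [frontier_ball _ two_ne_zero, mem_sphere_zero_iff_norm] at hw
        have hwz : 0 < 2 * ‖w - z‖ := by
          have := norm_sub_norm_le w z
          linarith
        have h1 := hgf w
        rw [hbd w hw] at h1
        rw [← mul_right_cancel₀ hwz.ne' h1]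
        exact hM w (by simp [hw])
    have hg0 : ‖f 0‖ * (4 / 3) ≤ ‖g 0‖ := by
      have h1 := hgf 0
      simp only [mul_zero, sub_zero, zero_sub, norm_neg, Complex.norm_ofNat] at h1
      nlinarith [norm_nonneg (g 0)]
    obtain ⟨zs, G, hzs, hGd, hGM, hG0, hGf, hGE⟩ := ih hgd hgM <| hN.trans_le <| by
      rw [pow_succ', ← mul_assoc]
      gcongr
    refine ⟨z ::ₘ zs, G, ?_, hGd, hGM, hG0, ?_, fun s ↦ ?_⟩
    · simpa using ⟨hz, hzs⟩
    · rw [Multiset.card_cons, pow_succ', ← mul_assoc]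
      exact le_trans (by gcongr) hGf
    · simp only [Multiset.map_cons, Multiset.prod_cons]
      rw [← mul_assoc, hgf, mul_right_comm, hGE, mul_comm (2 * ‖s - z‖), mul_assoc]

/-- A lower bound for a zero-free holomorphic function in terms of its value at the centre. -/
lemma exp_le_norm_of_ne_zero {g : ℂ → ℂ} {M : ℝ} (hM : 0 < M)
    (hg : DifferentiableOn ℂ g (Metric.ball 0 3))
    (hgM : ∀ s ∈ Metric.closedBall (0 : ℂ) 2, ‖g s‖ ≤ Real.exp M)
    (hg0 : ∀ s ∈ Metric.closedBall (0 : ℂ) (3 / 2), g s ≠ 0) (h0 : Real.exp (-M) ≤ ‖g 0‖)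
    {s : ℂ} (hs : ‖s‖ ≤ 5 / 4) : Real.exp (-(21 * M)) ≤ ‖g s‖ := by
  obtain ⟨h, hh, hhg⟩ := exists_differentiableOn_log (U := Metric.ball 0 (3 / 2))
    Metric.isOpen_ball (convex_ball _ _) (by simp) (hg.mono (Metric.ball_subset_ball (by norm_num)))
    fun z hz ↦ hg0 z (Metric.ball_subset_closedBall hz)
  have hre0 : -M ≤ (h 0).re := by
    rwa [← hhg 0 (by simp), Complex.norm_exp, Real.exp_le_exp] at h0
  have hsb : s ∈ Metric.ball (0 : ℂ) (3 / 2) := by rw [mem_ball_zero_iff]; linarith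
  have hbd := norm_le_of_re_le (F := fun z ↦ h z - h 0) (c := 0) (s := s) (R := 3 / 2)
    (r := 5 / 4) (M := 2 * M) (by linarith) (by norm_num) (by norm_num) (hh.sub_const _)
    (fun z hz ↦ by
      have h1 := re_le_of_norm_le_exp (hhg z hz) (hgM z
        (Metric.ball_subset_closedBall (Metric.ball_subset_ball (by norm_num) hz)))
      rw [Complex.sub_re]
      linarith)
    (by simpa using hs)
  rw [sub_self, norm_zero, zero_mul, add_zero] at hbd
  rw [← hhg s hsb, Complex.norm_exp, Real.exp_le_exp]
  have h2 := (abs_le.1 (Complex.abs_re_le_norm (h s - h 0))).1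
  rw [Complex.sub_re] at h2
  norm_num at hbd
  linarith

/-- A form of Cartan's lemma: a holomorphic function that is not small at the origin is bounded
below on some horizontal segment near the origin. -/
lemma exists_forall_exp_le_norm {f : ℂ → ℂ} {M : ℝ} (hM : 0 < M)
    (hf : DifferentiableOn ℂ f (Metric.ball 0 3))
    (hfM : ∀ s ∈ Metric.closedBall (0 : ℂ) 2, ‖f s‖ ≤ Real.exp M)
    (hf0 : Real.exp (-M) ≤ ‖f 0‖) :
    ∃ x : ℝ, |x| ≤ 1 / 2 ∧ ∀ u : ℝ, |u| ≤ 1 → Real.exp (-(45 * M)) ≤ ‖f (u + x * I)‖ := by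
  have hf0' : 0 < ‖f 0‖ := (Real.exp_pos _).trans_le hf0
  obtain ⟨N, hN⟩ := pow_unbounded_of_one_lt (Real.exp M / ‖f 0‖) (by norm_num : (1 : ℝ) < 4 / 3)
  rw [div_lt_iff₀' hf0'] at hN
  obtain ⟨zs, g, hzs, hg, hgM, hg0, hfg, hfgE⟩ := exists_multiset_zeros N hf hfM hN
  have hcard : (zs.card : ℝ) ≤ 8 * M := by
    have h1 : Real.exp (-M) * Real.exp (1 / 4) ^ zs.card ≤ Real.exp M := by
      refine le_trans ?_ (hfg.trans (hgM 0 (by simp)))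
      gcongr
      rw [← Real.le_log_iff_exp_le (by norm_num)]
      exact le_trans (by norm_num) (Real.one_sub_inv_le_log_of_pos (by norm_num))
    rw [← Real.exp_nat_mul, ← Real.exp_add, Real.exp_le_exp] at h1
    linarith
  obtain ⟨x, hx, hprod⟩ := exists_one_div_four_pow_le_prod (zs.map Complex.im)
  rw [Multiset.card_map, Multiset.map_map] at hprod
  refine ⟨x, hx, fun u hu ↦ ?_⟩
  set s : ℂ := u + x * I with hs
  have hsn : ‖s‖ ≤ 5 / 4 := by
    have h1 : s.re = u := by simp [hs]
    have h2 : s.im = x := by simp [hs]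
    refine le_of_sq_le_sq ?_ (by norm_num)
    rw [Complex.sq_norm, Complex.normSq_apply, h1, h2]
    nlinarith [abs_le.1 hx, abs_le.1 hu, sq_abs u, sq_abs x, abs_nonneg u, abs_nonneg x]
  have hgs : Real.exp (-(21 * M)) ≤ ‖g s‖ := by
    refine exp_le_norm_of_ne_zero hM hg hgM hg0 (hf0.trans (le_trans ?_ hfg)) hsn
    exact le_mul_of_one_le_right hf0'.le (one_le_pow₀ (by norm_num))
  have hnum : (1 / 2 : ℝ) ^ zs.card ≤ (zs.map fun z ↦ 2 * ‖s - z‖).prod := by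
    rw [Multiset.prod_map_mul, Multiset.map_const', Multiset.prod_replicate,
      show (1 / 2 : ℝ) = 2 * (1 / 4) by norm_num, mul_pow]
    refine mul_le_mul_of_nonneg_left (hprod.trans ?_) (by positivity)
    refine Multiset.prod_map_le_prod_map₀ _ _ (fun z _ ↦ abs_nonneg _) fun z _ ↦ ?_
    simpa [hs] using Complex.abs_im_le_norm (s - z)
  have hden : (zs.map fun z ↦ ‖4 - conj z * s‖).prod ≤ 6 ^ zs.card := by
    rw [← Multiset.prod_replicate, ← Multiset.map_const']
    refine Multiset.prod_map_le_prod_map₀ _ _ (fun z _ ↦ norm_nonneg _) fun z hz ↦ ?_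
    refine (norm_sub_le _ _).trans ?_
    rw [norm_mul, Complex.norm_conj, Complex.norm_ofNat]
    nlinarith [hzs z hz, norm_nonneg z, norm_nonneg s]
  have hpow : Real.exp (-(24 * M)) * 6 ^ zs.card ≤ (1 / 2 : ℝ) ^ zs.card := by
    have h1 : (12 : ℝ) ≤ Real.exp 3 := by
      have h2 : (2.7 : ℝ) ^ 3 ≤ Real.exp 1 ^ 3 :=
        pow_le_pow_left₀ (by norm_num) (by linarith [Real.exp_one_gt_d9]) 3
      rw [← Real.exp_nat_mul, mul_one] at h2
      exact le_trans (by norm_num) h2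
    rw [one_div, inv_pow, ← one_div, le_div_iff₀ (by positivity), mul_assoc, ← mul_pow]
    calc Real.exp (-(24 * M)) * (6 * 2) ^ zs.card
        ≤ Real.exp (-(24 * M)) * Real.exp 3 ^ zs.card := by gcongr; linarith
      _ ≤ 1 := by
        rw [← Real.exp_nat_mul, ← Real.exp_add, Real.exp_le_one_iff]
        linarith
  have hE := hfgE s
  have h3 : ‖f s‖ * (zs.map fun z ↦ ‖4 - conj z * s‖).prod ≤ ‖f s‖ * 6 ^ zs.card :=
    mul_le_mul_of_nonneg_left hden (norm_nonneg _)
  have h4 := mul_le_mul hgs hnum (by positivity) (norm_nonneg _)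
  have h5 := mul_le_mul_of_nonneg_left hpow (Real.exp_nonneg (-(21 * M)))
  rw [← mul_assoc, ← Real.exp_add] at h5
  refine le_of_mul_le_mul_right (a := 6 ^ zs.card) ?_ (by positivity)
  rw [show -(45 * M) = -(21 * M) + -(24 * M) by ring]
  linarith

end LargeStrip

namespace LargeStrip

lemma IsRegularized.exists_height {E : ℂ → ℂ} {σ₁ C A : ℝ} (h : IsRegularized E σ₁ C A) :
    ∃ C' t₀ : ℝ, 0 < C' ∧ ∀ t, t₀ ≤ t → ∃ T : ℝ, |T - t| < 1 / 2 ∧ ∀ σ : ℝ, 1 / 2 ≤ σ → σ ≤ 2 →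
      Real.exp (-(C' * (Real.log t / Real.log (Real.log t)))) ≤ ‖E (σ + T * I)‖ := by
  have hσ := h.two_le
  obtain ⟨C', t₀, hC', hbd⟩ := h.exists_bounds
  refine ⟨45 * C', max t₀ 1, by positivity, fun t ht ↦ ?_⟩
  obtain ⟨hl, δ, hδ, hδ8, hE⟩ := hbd t ((le_max_left _ _).trans ht)
  have ht1 : 0 < Real.log t := by
    refine (Real.log_nonneg ((le_max_right _ _).trans ht)).lt_of_ne' fun h0 ↦ ?_
    simp [h0] at hl
  set M := C' * (Real.log t / Real.log (Real.log t)) with hMdef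
  have hM : 0 < M := by positivity
  set s₀ : ℂ := (1 / 2 + δ : ℝ) + t * I with hs₀
  have hs₀re : s₀.re = 1 / 2 + δ := by simp [hs₀]
  have hs₀im : s₀.im = t := by simp [hs₀]
  have hre (w : ℂ) : (s₀ + δ * w).re = 1 / 2 + δ + δ * w.re := by
    rw [Complex.add_re, Complex.re_ofReal_mul, hs₀re]
  have him (w : ℂ) : (s₀ + δ * w).im = t + δ * w.im := by
    rw [Complex.add_im, Complex.im_ofReal_mul, hs₀im]
  have hball (w : ℂ) {r : ℝ} (hw : ‖w‖ ≤ r) :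
      1 / 2 + δ - δ * r ≤ (s₀ + δ * w).re ∧ (s₀ + δ * w).re ≤ 1 / 2 + δ + δ * r ∧
      |(s₀ + δ * w).im - t| ≤ δ * r := by
    have h1 := abs_le.1 ((Complex.abs_re_le_norm w).trans hw)
    have h2 := (Complex.abs_im_le_norm w).trans hw
    rw [hre, him, add_sub_cancel_left, abs_mul, abs_of_pos hδ]
    exact ⟨by nlinarith, by nlinarith, by gcongr⟩
  obtain ⟨x, hx, hxf⟩ := exists_forall_exp_le_norm (f := fun w ↦ E (s₀ + δ * w)) hM
    (h.differentiableOn.comp (by fun_prop) fun w hw ↦ by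
      have := (hball w (mem_ball_zero_iff.1 hw).le).1
      show 0 < (s₀ + δ * w).re
      linarith)
    (fun w hw ↦ by
      obtain ⟨h1, h2, h3⟩ := hball w (mem_closedBall_zero_iff.1 hw)
      exact (hE _ (by linarith) (by linarith)).1 (by linarith))
    (by
      rw [mul_zero, add_zero]
      exact (hE s₀ (by linarith) (by simp [hs₀im])).2 hs₀re.ge)
  refine ⟨t + δ * x, ?_, fun σ hσ1 hσ2 ↦ ?_⟩
  · rw [add_sub_cancel_left, abs_mul, abs_of_pos hδ]
    nlinarith
  have hTt : |t + δ * x - t| ≤ 1 := by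
    rw [add_sub_cancel_left, abs_mul, abs_of_pos hδ]
    nlinarith
  rcases le_total σ (1 / 2 + δ) with hσδ | hσδ
  · have hu : |(σ - (1 / 2 + δ)) / δ| ≤ 1 := by
      rw [abs_div, abs_of_pos hδ, div_le_one hδ, abs_le]
      constructor <;> linarith
    have hpt : s₀ + δ * (((σ - (1 / 2 + δ)) / δ : ℝ) + x * I) = σ + (t + δ * x : ℝ) * I := by
      have hδ0 : (δ : ℂ) ≠ 0 := by exact_mod_cast hδ.ne'
      rw [hs₀]
      push_cast
      field_simp
      ring
    have := hxf _ hu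
    rwa [hpt, ← mul_assoc] at this
  · set z : ℂ := σ + (t + δ * x : ℝ) * I with hz
    have hzre : z.re = σ := by simp [hz]
    have hzim : z.im = t + δ * x := by simp [hz]
    have hEz := (hE z (by linarith) (by rwa [hzim])).2 (by rwa [hzre])
    refine le_trans (Real.exp_le_exp.2 ?_) hEz
    rw [mul_assoc, ← hMdef]
    linarith

end LargeStrip

namespace LargeStrip

variable {K : Type} [Field K] [NumberField K] {Z : ℂ → ℂ}

lemma one_lt_log_natCast {n : ℕ} (hn : 4 ≤ n) : 1 < Real.log n := by
  have hn4 : (4 : ℝ) ≤ n := by exact_mod_cast hn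
  rw [Real.lt_log_iff_exp_lt (by linarith)]
  linarith [Real.exp_one_lt_d9]

lemma one_le_log_div_log_log {n : ℕ} (hn : 4 ≤ n) :
    1 ≤ Real.log n / Real.log (Real.log n) := by
  have hl := one_lt_log_natCast hn
  rw [one_le_div (Real.log_pos hl)]
  exact Real.log_le_self (by linarith)

lemma exists_height_of_half_le (hZ : IsDedekindZeta K Z) (hRH : ZetaRH Z) :
    ∃ (C : ℝ) (N : ℕ), 0 < C ∧ ∀ n : ℕ, N ≤ n → 4 ≤ n → ∃ T : ℝ, n ≤ T ∧ T < n + 1 ∧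
      ∀ σ : ℝ, 1 / 2 ≤ σ → σ ≤ 2 →
        Real.exp (-(C * (Real.log n / Real.log (Real.log n)))) ≤ ‖Z (σ + T * I)‖ := by
  obtain ⟨E, σ₁, C, A, hE, hZE⟩ := exists_isRegularized hZ hRH
  obtain ⟨C', t₀, hC', h⟩ := hE.exists_height
  refine ⟨C' * 2, ⌈t₀⌉₊, by positivity, fun n hn hn4 ↦ ?_⟩
  have hn4' : (4 : ℝ) ≤ n := by exact_mod_cast hn4
  obtain ⟨T, hT, hTE⟩ := h (n + 1 / 2) (by linarith [Nat.le_of_ceil_le hn])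
  rw [abs_lt] at hT
  refine ⟨T, by linarith, by linarith, fun σ h1 h2 ↦ ?_⟩
  set s : ℂ := σ + T * I with hs
  have hre : s.re = σ := by simp [hs]
  have him : s.im = T := by simp [hs]
  have hs1 : s ≠ 1 := fun h0 ↦ by
    rw [h0, Complex.one_im] at him
    linarith
  have hs2 : s + 2 ≠ 0 := fun h0 ↦ by
    have := congrArg Complex.im h0
    simp [him] at this
    linarith
  have hle : ‖(s - 1) / (s + 2)‖ ≤ 1 := by
    rw [norm_div, div_le_one (norm_pos_iff.2 hs2), ← sq_le_sq₀ (norm_nonneg _) (norm_nonneg _),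
      ← Complex.normSq_eq_norm_sq, ← Complex.normSq_eq_norm_sq, Complex.normSq_apply,
      Complex.normSq_apply]
    simp [hre, him]
    nlinarith
  have hEZ : ‖E s‖ ≤ ‖Z s‖ := by
    rw [← hZE s (by linarith) hs1, norm_mul]
    exact mul_le_of_le_one_right (norm_nonneg _) hle
  refine (Real.exp_le_exp.2 (neg_le_neg ?_)).trans ((hTE σ h1 h2).trans hEZ)
  rw [mul_assoc]
  gcongr
  have hl := one_lt_log_natCast hn4
  have hll := Real.log_pos hl
  have hlt : Real.log n ≤ Real.log (n + 1 / 2) := Real.log_le_log (by linarith) (by linarith)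
  have hlt2 : Real.log (n + 1 / 2) ≤ 2 * Real.log n := by
    rw [two_mul, ← Real.log_mul (by linarith) (by linarith)]
    exact Real.log_le_log (by linarith) (by nlinarith)
  rw [← mul_div_assoc]
  have hl0 := one_pos.trans hl
  gcongr

lemma exists_height_of_large (hZ : IsDedekindZeta K Z) (hRH : ZetaRH Z) :
    ∃ (C : ℝ) (N : ℕ), 0 < C ∧ ∀ n : ℕ, N ≤ n → 4 ≤ n → ∃ T : ℝ, n ≤ T ∧ T < n + 1 ∧
      ∀ σ : ℝ, -1 ≤ σ → σ ≤ 2 →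
        Real.exp (-(C * (Real.log n / Real.log (Real.log n)))) ≤ ‖Z (σ + T * I)‖ := by
  obtain ⟨C, N, hC, h⟩ := exists_height_of_half_le hZ hRH
  obtain ⟨D, hD, hrefl⟩ := norm_dedekindZeta_reflect_le hZ
  refine ⟨C + |Real.log D|, N, by positivity, fun n hN hn4 ↦ ?_⟩
  obtain ⟨T, hT1, hT2, hT⟩ := h n hN hn4
  have hL := one_le_log_div_log_log hn4
  refine ⟨T, hT1, hT2, fun σ h1 h2 ↦ ?_⟩
  set L := Real.log n / Real.log (Real.log n)
  have hn4' : (4 : ℝ) ≤ n := by exact_mod_cast hn4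
  have hDL := mul_le_mul_of_nonneg_left hL (abs_nonneg (Real.log D))
  rcases le_total (1 / 2) σ with hσ | hσ
  · refine (Real.exp_le_exp.2 ?_).trans (hT σ hσ h2)
    linarith [abs_nonneg (Real.log D)]
  · have hre : (σ + T * I : ℂ).re = σ := by simp
    have him : (σ + T * I : ℂ).im = T := by simp
    have key := hrefl (σ + T * I) (by rwa [hre]) (by rwa [hre])
      (by rw [him]; exact le_abs.2 (Or.inl (by linarith)))
    have hpt : σ + T * I + (1 - 2 * (σ + T * I : ℂ).re : ℝ) = (1 - σ : ℝ) + T * I := by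
      rw [hre]
      push_cast
      ring
    rw [hpt] at key
    have := (hT (1 - σ) (by linarith) (by linarith)).trans key
    rw [← div_le_iff₀' hD] at this
    refine le_trans ?_ this
    rw [le_div_iff₀ hD, ← Real.exp_log hD, ← Real.exp_add, Real.exp_le_exp, Real.exp_log hD]
    linarith [le_abs_self (Real.log D)]

end LargeStrip

namespace LargeStrip

variable {K : Type} [Field K] [NumberField K] {Z : ℂ → ℂ}

lemma exists_height_forall_ne_zero (hZ : IsDedekindZeta K Z) {n : ℕ} (hn : 4 ≤ n) :
    ∃ T : ℝ, n ≤ T ∧ T < n + 1 ∧ ∀ σ : ℝ, -1 ≤ σ → σ ≤ 2 → Z (σ + T * I) ≠ 0 := by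
  by_contra! hcon
  have hn0 : (4 : ℝ) ≤ n := by exact_mod_cast hn
  set S : Set ℂ := {s | Z s = 0} ∩ (Set.Icc (-1) 2 ×ℂ Set.Icc (n : ℝ) (n + 1)) with hS
  have hinf : S.Infinite := by
    refine Set.Infinite.of_image Complex.im (Set.Infinite.mono ?_ (Set.Ico_infinite
      (lt_add_one (n : ℝ))))
    rintro T ⟨h1, h2⟩
    obtain ⟨σ, h3, h4, h5⟩ := hcon T h1 h2
    exact ⟨σ + T * I, ⟨h5, by simp [Complex.mem_reProdIm, h1, h2.le, h3, h4]⟩, by simp⟩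
  obtain ⟨z, hz, hacc⟩ := hinf.exists_accPt_of_subset_isCompact
    (isCompact_Icc.reProdIm isCompact_Icc) Set.inter_subset_right
  have hz1 : z ≠ 1 := by
    rintro rfl
    have := hz.2.1
    simp at this
    linarith
  have hdiff : DifferentiableOn ℂ Z {1}ᶜ := fun s hs ↦ (hZ.1 s hs).differentiableWithinAt
  have hfreq : ∃ᶠ s in 𝓝[≠] z, Z s = 0 :=
    (accPt_iff_frequently_nhdsNE.1 hacc).mono fun s hs ↦ hs.1
  have han := hdiff.analyticOnNhd isOpen_compl_singleton
  have h0 := han.eqOn_zero_of_preconnected_of_frequently_eq_zero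
    ((Set.countable_singleton (1 : ℂ)).isConnected_compl_of_one_lt_rank (by simp)).isPreconnected
    hz1 hfreq
  exact dedekindZeta_ne_zero hZ (s := 2) (by simp) (by norm_num) (h0 (by simp))

lemma exists_height_pos (hZ : IsDedekindZeta K Z) {n : ℕ} (hn : 4 ≤ n) :
    ∃ c : ℝ, ∃ T : ℝ, n ≤ T ∧ T < n + 1 ∧
      ∀ σ : ℝ, -1 ≤ σ → σ ≤ 2 → Real.exp (-c) ≤ ‖Z (σ + T * I)‖ := by
  obtain ⟨T, h1, h2, h3⟩ := exists_height_forall_ne_zero hZ hn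
  have hn0 : (4 : ℝ) ≤ n := by exact_mod_cast hn
  have hcont : Continuous fun σ : ℝ ↦ ‖Z (σ + T * I)‖ := by
    refine continuous_iff_continuousAt.2 fun σ ↦ ?_
    have hne : (σ + T * I : ℂ) ≠ 1 := fun h ↦ by
      have := congrArg Complex.im h
      simp at this
      linarith
    exact ((hZ.1 _ hne).continuousAt.comp (f := fun σ : ℝ ↦ (σ + T * I : ℂ)) (by fun_prop)).norm
  obtain ⟨σ₀, ⟨h4, h5⟩, hmin⟩ := isCompact_Icc.exists_isMinOn (s := Set.Icc (-1 : ℝ) 2)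
    ⟨0, by simp⟩ hcont.continuousOn
  refine ⟨-Real.log ‖Z (σ₀ + T * I)‖, T, h1, h2, fun σ h6 h7 ↦ ?_⟩
  rw [neg_neg, Real.exp_log (norm_pos_iff.2 (h3 σ₀ h4 h5))]
  exact hmin ⟨h6, h7⟩

lemma exists_height_forall (hZ : IsDedekindZeta K Z) (hRH : ZetaRH Z) :
    ∃ C : ℝ, 0 < C ∧ ∀ n : ℕ, 4 ≤ n → ∃ T : ℝ, n ≤ T ∧ T < n + 1 ∧
      ∀ σ : ℝ, -1 ≤ σ → σ ≤ 2 →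
        Real.exp (-(C * (Real.log n / Real.log (Real.log n)))) ≤ ‖Z (σ + T * I)‖ := by
  obtain ⟨C, N, hC, h⟩ := exists_height_of_large hZ hRH
  choose! c hc using fun (n : ℕ) (hn : 4 ≤ n) ↦ exists_height_pos hZ hn
  have hpos : 0 ≤ ∑ m ∈ Finset.range N, |c m| := Finset.sum_nonneg fun m _ ↦ abs_nonneg _
  refine ⟨C + ∑ m ∈ Finset.range N, |c m|, by positivity, fun n hn ↦ ?_⟩
  have hL := one_le_log_div_log_log hn
  set L := Real.log n / Real.log (Real.log n)
  rcases le_or_gt N n with hNn | hNn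
  · obtain ⟨T, h1, h2, h3⟩ := h n hNn hn
    refine ⟨T, h1, h2, fun σ h4 h5 ↦ (Real.exp_le_exp.2 ?_).trans (h3 σ h4 h5)⟩
    nlinarith
  · obtain ⟨T, h1, h2, h3⟩ := hc n hn
    refine ⟨T, h1, h2, fun σ h4 h5 ↦ (Real.exp_le_exp.2 ?_).trans (h3 σ h4 h5)⟩
    have := Finset.single_le_sum (f := fun m ↦ |c m|) (fun m _ ↦ abs_nonneg _)
      (Finset.mem_range.2 hNn)
    nlinarith [le_abs_self (c n)]

end LargeStrip

/-- **Lower bounds for `ζ_K` on horizontal lines (Lemma 2.4).**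
Assume the Riemann hypothesis for `ζ_K`. There is a constant `C > 0` such that for each
integer `n ≥ 4` there is some `T_n ∈ [n, n+1)` with
`|ζ_K(σ + iT_n)| ≥ exp(-C log n / log log n)` for all `-1 ≤ σ ≤ 2`. -/
theorem large_horizontal_strip
    (K : Type) [Field K] [NumberField K]
    (Z : ℂ → ℂ) (hZ : IsDedekindZeta K Z) (hRH : ZetaRH Z) :
    ∃ C : ℝ, 0 < C ∧
      ∀ n : ℕ, 4 ≤ n → ∃ T : ℝ, (n : ℝ) ≤ T ∧ T < n + 1 ∧
        ∀ σ : ℝ, -1 ≤ σ → σ ≤ 2 →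
          Real.exp (-(C * Real.log n) / Real.log (Real.log n))
            ≤ ‖Z (σ + Complex.I * T)‖ := by
  obtain ⟨C, hC, h⟩ := LargeStrip.exists_height_forall hZ hRH
  refine ⟨C, hC, fun n hn ↦ ?_⟩
  obtain ⟨T, h1, h2, h3⟩ := h n hn
  refine ⟨T, h1, h2, fun σ h4 h5 ↦ ?_⟩
  rw [mul_comm Complex.I, neg_div, mul_div_assoc]
  exact h3 σ h4 h5
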